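/- As functions on the upper half-plane, 2·j₁₀'(τ) - G₂^{(10*)}(τ) = (1/6)E₂^{(10)}(τ) + (1/2)E₂^{(5)}(2τ), where j₁₀'(τ) = (2πi)^{-1} d/dτ j₁₀(τ) and E₂^{(N)}(τ) = NE₂(Nτ) - E₂(τ). In particular, 2·j₁₀' - G₂^{(10*)} lies in the space M₂(Γ₀(10)) of holomorphic modular forms of weight 2 on Γ₀(10), which is spanned by E₂^{(10)}(τ), E₂^{(5)}(2τ), E₂^{(2)}(5τ). -/

import Mathlib

open Complex Matrix

noncomputable section

/-- `SL(2, ℝ)`. -/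
abbrev SL2R := Matrix.SpecialLinearGroup (Fin 2) ℝ

/-- `q = e^{2πiz}` (also used as `ζ = e^{2πiz}`). -/
def qc (z : ℂ) : ℂ := Complex.exp (2 * Real.pi * Complex.I * z)

/-- The Dedekind eta function `η(z) = q^{1/24} ∏_{n ≥ 1} (1 - q^n)` (intended for `Im z > 0`). -/
def dedekindEta (z : ℂ) : ℂ :=
  Complex.exp (Real.pi * Complex.I * z / 12) *
    ∏' n : ℕ, (1 - Complex.exp (2 * Real.pi * Complex.I * ((n : ℂ) + 1) * z))

/-- The hauptmodul `j_N` of `Γ₀(N)` for `N ∈ {2, 3, 5, 7, 13, 6, 10}`. -/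
def jn (N : ℕ) (z : ℂ) : ℂ :=
  if N = 6 then (dedekindEta (2 * z) * dedekindEta (3 * z) ^ 3 / (dedekindEta z * dedekindEta (6 * z) ^ 3)) ^ 3 - 3
  else if N = 10 then dedekindEta (2 * z) * dedekindEta (5 * z) ^ 5 / (dedekindEta z * dedekindEta (10 * z) ^ 5) - 1
  else (dedekindEta z / dedekindEta ((N : ℂ) * z)) ^ (24 / (N - 1)) + 24 / ((N : ℂ) - 1)

/-- The hauptmodul `j_N^*` of the Fricke group `Γ₀^*(N)` for `N ∈ {2, 3, 5, 7, 13, 6, 10}`. -/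
def jnStar (N : ℕ) (z : ℂ) : ℂ :=
  if N = 6 then
    (dedekindEta z * dedekindEta (3 * z) / (dedekindEta (2 * z) * dedekindEta (6 * z))) ^ 6 + 6 +
      2 ^ 6 * (dedekindEta (2 * z) * dedekindEta (6 * z) / (dedekindEta z * dedekindEta (3 * z))) ^ 6
  else if N = 10 then
    (dedekindEta z * dedekindEta (5 * z) / (dedekindEta (2 * z) * dedekindEta (10 * z))) ^ 4 + 4 +
      2 ^ 4 * (dedekindEta (2 * z) * dedekindEta (10 * z) / (dedekindEta z * dedekindEta (5 * z))) ^ 4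
  else
    (dedekindEta z / dedekindEta ((N : ℂ) * z)) ^ (24 / (N - 1)) + 24 / ((N : ℂ) - 1) +
      (N : ℂ) ^ (12 / (N - 1)) * (dedekindEta ((N : ℂ) * z) / dedekindEta z) ^ (24 / (N - 1))

/-- `f` has the `q`-expansion `f(τ) = Σ_{n ≥ n₀} (a n) q^n` on the upper half-plane. -/
def HasQExp (f : ℂ → ℂ) (a : ℤ → ℂ) (n₀ : ℤ) : Prop :=
  (∀ n < n₀, a n = 0) ∧
    ∀ τ : ℂ, 0 < τ.im →
      HasSum (fun m : ℕ => a (n₀ + m) * qc τ ^ (n₀ + (m : ℤ))) (f τ)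

/-- `Γ₀(N)` viewed as a subgroup of `SL(2, ℝ)`. -/
def Gamma0SL2R (N : ℕ) : Subgroup SL2R :=
  (CongruenceSubgroup.Gamma0 N).map
    (Matrix.SpecialLinearGroup.map (Int.castRingHom ℝ))

/-- The set of Atkin–Lehner matrices `W_e` of level `N`:
`W_e = e^{-1/2} [[xe, y], [zN, we]]`, `x, y, z, w ∈ ℤ` (determinant `1` being automatic). -/
def atkinLehnerSet (N e : ℕ) : Set SL2R :=
  { g | ∃ x y z w : ℤ,
      g.1 = (Real.sqrt e)⁻¹ • !![(x : ℝ) * e, (y : ℝ); (z : ℝ) * N, (w : ℝ) * e] }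

/-- The Fricke group `Γ₀^*(N)`, generated by `Γ₀(N)` and all Atkin–Lehner involutions `W_e`
for `e ∣ N` with `gcd(e, N/e) = 1`. -/
def FrickeGroup (N : ℕ) : Subgroup SL2R :=
  Subgroup.closure
    ((Gamma0SL2R N : Set SL2R) ∪
      ⋃ e ∈ {e : ℕ | e ∣ N ∧ Nat.Coprime e (N / e)}, atkinLehnerSet N e)

/-- The Gram matrix of the integral binary quadratic form `[a, b, c]`. -/
def formMat (a b c : ℤ) : Matrix (Fin 2) (Fin 2) ℝ :=
  !![(a : ℝ), (b : ℝ) / 2; (b : ℝ) / 2, (c : ℝ)]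

/-- `𝒬_{d,N}`: positive definite integral binary quadratic forms `[a, b, c]` of
discriminant `-d` with `N ∣ a`. -/
def QdN (d : ℤ) (N : ℕ) : Set (Matrix (Fin 2) (Fin 2) ℝ) :=
  { M | ∃ a b c : ℤ, M = formMat a b c ∧ 0 < a ∧ b ^ 2 - 4 * a * c = -d ∧ (N : ℤ) ∣ a }

/-- `𝒬_{d,N,h}`: members of `𝒬_{d,N}` with `b ≡ h (mod 2N)`. -/
def QdNh (d : ℤ) (N : ℕ) (h : ℤ) : Set (Matrix (Fin 2) (Fin 2) ℝ) :=
  { M | ∃ a b c : ℤ, M = formMat a b c ∧ 0 < a ∧ b ^ 2 - 4 * a * c = -d ∧ (N : ℤ) ∣ a ∧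
      (b : ZMod (2 * N)) = (h : ZMod (2 * N)) }

/-- Orbit relation of the (right) action `Q ↦ Q ∘ g`, i.e. `M ↦ gᵀ M g`, of `Γ ≤ SL(2, ℝ)`
on a set `S` of Gram matrices of quadratic forms. -/
def formRel (Γ : Subgroup SL2R) (S : Set (Matrix (Fin 2) (Fin 2) ℝ)) (Q Q' : S) : Prop :=
  ∃ g ∈ Γ, Q'.1 = (g.1)ᵀ * Q.1 * g.1

/-- The CM point `α_Q` of a positive definite form (as a point of `ℂ`; it lies in the upper
half-plane): `α_Q = (-b + i √d) / (2a) = (-(b/2) + i √(det M)) / a`. -/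
def cmPointC (M : Matrix (Fin 2) (Fin 2) ℝ) : ℂ :=
  ((-(M 0 1) : ℝ) + Complex.I * Real.sqrt M.det) / ((M 0 0 : ℝ) : ℂ)

/-- The order of the stabilizer of the form `M` in `Γ/{±1}` (the stabilizer in `Γ` contains
`±1` and has twice the cardinality). -/
def stabOrder (Γ : Subgroup SL2R) (M : Matrix (Fin 2) (Fin 2) ℝ) : ℕ :=
  Nat.card { g : SL2R // g ∈ Γ ∧ (g.1)ᵀ * M * g.1 = M } / 2

/-- The modular trace `Σ_{Q ∈ S/Γ} f(α_Q) / |Γ̄_Q|`. -/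
def classTrace (Γ : Subgroup SL2R) (f : ℂ → ℂ)
    (S : Set (Matrix (Fin 2) (Fin 2) ℝ)) : ℂ :=
  ∑ᶠ O : Quot (formRel Γ S),
    f (cmPointC (Quot.out O).1) / (stabOrder Γ (Quot.out O).1 : ℂ)

/-- `t₂^{(N*)}(d)`, where `P` is the polynomial with `φ₂(j_N^*) = P(j_N^*)`;
includes the paper's conventions at nonpositive indices. -/
def t2Star (N : ℕ) (P : Polynomial ℂ) (d : ℤ) : ℂ :=
  if 0 < d then
    classTrace (FrickeGroup N) (fun z => Polynomial.eval (jnStar N z) P) (QdN d N)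
  else if d = 0 then (if N = 2 then 5 else if N = 6 ∨ N = 10 then 5 / 2 else 3)
  else if d = -1 then -1
  else if d = -4 then -2
  else 0

/-- `σ₁^{(N)}(x) = Σ_{d ∣ x, N ∤ d} d` for `x ∈ ℤ_{>0}`, `(N-1)/24` at `x = 0`, and `0`
off `ℤ_{≥0}`. -/
def sigmaN (N : ℕ) (x : ℚ) : ℂ :=
  if x = 0 then ((N : ℂ) - 1) / 24
  else if 0 < x ∧ x.den = 1 then
    ∑ d ∈ (Nat.divisors x.num.toNat).filter (fun d => ¬ N ∣ d), (d : ℂ)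
  else 0

/-- `σ₁(x) = Σ_{d ∣ x} d` for `x ∈ ℤ_{>0}` and `0` otherwise. -/
def sigmaQ (x : ℚ) : ℂ :=
  if 0 < x ∧ x.den = 1 then ∑ d ∈ Nat.divisors x.num.toNat, (d : ℂ) else 0

/-- A weakly holomorphic Jacobi form of weight `k` and index `m`. -/
structure WeakJacobiForm (k : ℤ) (m : ℕ) where
  toFun : ℂ → ℂ → ℂ
  holo : DifferentiableOn ℂ (fun p : ℂ × ℂ => toFun p.1 p.2)
      ({τ : ℂ | 0 < τ.im} ×ˢ (Set.univ : Set ℂ))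
  slash_inv : ∀ a b c d : ℤ, a * d - b * c = 1 → ∀ τ z : ℂ, 0 < τ.im →
    ((c : ℂ) * τ + d) ^ (-k) *
        Complex.exp (-(2 * Real.pi * Complex.I * m * c * z ^ 2) / ((c : ℂ) * τ + d)) *
        toFun (((a : ℂ) * τ + b) / ((c : ℂ) * τ + d)) (z / ((c : ℂ) * τ + d)) =
      toFun τ z
  elliptic : ∀ lm mu : ℤ, ∀ τ z : ℂ, 0 < τ.im →
    Complex.exp (2 * Real.pi * Complex.I * m * ((lm : ℂ) ^ 2 * τ + 2 * lm * z)) *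
        toFun τ (z + lm * τ + mu) = toFun τ z
  coeff : ℤ → ℤ → ℂ
  coeff_neg_finite : {n : ℤ | n < 0 ∧ ∃ r : ℤ, coeff n r ≠ 0}.Finite
  expansion : ∀ τ z : ℂ, 0 < τ.im →
    HasSum (fun p : ℤ × ℤ => coeff p.1 p.2 * qc τ ^ p.1 * qc z ^ p.2) (toFun τ z)

/-- Meromorphy of weight `k` at all cusps: at each cusp `γ∞`, the function `F|_k γ` has a
Fourier expansion in fractional powers of `q` with only finitely many negative terms. -/
def MeromAtCusps (k : ℤ) (F : ℂ → ℂ) : Prop :=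
  ∀ a b c d : ℤ, a * d - b * c = 1 →
    ∃ (M : ℕ) (cs : ℤ → ℂ) (n₀ : ℤ), 0 < M ∧
      ∀ τ : ℂ, 0 < τ.im →
        HasSum
          (fun j : ℕ => cs (n₀ + j) *
            Complex.exp (2 * Real.pi * Complex.I * τ / M) ^ (n₀ + (j : ℤ)))
          (((c : ℂ) * τ + d) ^ (-k) * F (((a : ℂ) * τ + b) / ((c : ℂ) * τ + d)))

/-- The Möbius action of an element of `SL(2, ℝ)` on `ℂ`. -/
def moebius (g : SL2R) (z : ℂ) : ℂ :=
  ((g.1 0 0 : ℝ) * z + ((g.1 0 1 : ℝ) : ℂ)) / ((g.1 1 0 : ℝ) * z + ((g.1 1 1 : ℝ) : ℂ))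

/-- A weakly holomorphic modular function on `Γ`: holomorphic on the upper half-plane,
`Γ`-invariant, with poles only at the cusps. -/
def IsWeaklyHolModularFn (Γ : Subgroup SL2R) (f : ℂ → ℂ) : Prop :=
  DifferentiableOn ℂ f {z : ℂ | 0 < z.im} ∧
    (∀ g ∈ Γ, ∀ z : ℂ, 0 < z.im → f (moebius g z) = f z) ∧
    MeromAtCusps 0 f

/-- The set `L_{h, d/4N}` of vectors
`X = [[b + h/2N, c/N], [-a, -(b + h/2N)]]`, `a, b, c ∈ ℤ`, of norm `q(X) = d/4N`. -/
def LhSet (N : ℕ) (h d : ℤ) : Set (Matrix (Fin 2) (Fin 2) ℝ) :=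
  { X | ∃ a b c : ℤ,
      X = !![(b : ℝ) + (h : ℝ) / (2 * N), (c : ℝ) / N;
             -(a : ℝ), -((b : ℝ) + (h : ℝ) / (2 * N))] ∧
      (2 * b * N + h) ^ 2 - 4 * a * c * N = -d }

/-- The map `X ↦ N ⬝ [[0,-1],[1,0]] ⬝ X` from vectors to Gram matrices of quadratic forms. -/
def vecToForm (N : ℕ) (X : Matrix (Fin 2) (Fin 2) ℝ) : Matrix (Fin 2) (Fin 2) ℝ :=
  (N : ℝ) • (!![(0 : ℝ), -1; 1, 0] * X)

/-- Orbit relation of `Γ` acting by conjugation `g.X = g X g⁻¹` on a set `S` of vectors. -/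
def vecRel (Γ : Subgroup SL2R) (S : Set (Matrix (Fin 2) (Fin 2) ℝ)) (X X' : S) : Prop :=
  ∃ g ∈ Γ, X'.1 = g.1 * X.1 * (g⁻¹).1

/-- The Heegner point `D_X ∈ ℍ` of a vector `X` of positive norm. -/
def heegnerC (X : Matrix (Fin 2) (Fin 2) ℝ) : ℂ :=
  ((X 0 0 / X 1 0 : ℝ) : ℂ) + Complex.I * Real.sqrt (X.det / (X 1 0) ^ 2)

/-- The order of the stabilizer of the vector `X` in `Γ/{±1}`. -/
def vecStabOrder (Γ : Subgroup SL2R) (X : Matrix (Fin 2) (Fin 2) ℝ) : ℕ :=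
  Nat.card { g : SL2R // g ∈ Γ ∧ g.1 * X * (g⁻¹).1 = X } / 2

/-- The modular trace `t_f(h, m) = Σ_{X ∈ Γ\L_{h,m}} f(D_X) / |Γ̄_X|`. -/
def vecTrace (Γ : Subgroup SL2R) (f : ℂ → ℂ) (S : Set (Matrix (Fin 2) (Fin 2) ℝ)) : ℂ :=
  ∑ᶠ O : Quot (vecRel Γ S), f (heegnerC (Quot.out O).1) / (vecStabOrder Γ (Quot.out O).1 : ℂ)

/-- The weight-2 Eisenstein series `E₂(z) = 1 - 24 Σ_{n ≥ 1} σ₁(n) qⁿ`. -/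
def E2 (z : ℂ) : ℂ :=
  1 - 24 * ∑' n : ℕ, (∑ d ∈ Nat.divisors (n + 1), (d : ℂ)) * qc z ^ (n + 1)

/-- `E₂^{(N)}(z) = N E₂(Nz) - E₂(z)`. -/
def E2N (N : ℕ) (z : ℂ) : ℂ := (N : ℂ) * E2 ((N : ℂ) * z) - E2 z

end
namespace LevelTen

/-! ### The nome and the Dedekind eta function -/

lemma qc_add (z w : ℂ) : qc (z + w) = qc z * qc w := by
  rw [qc, qc, qc, ← Complex.exp_add]; congr 1; ring

lemma qc_ne_zero (z : ℂ) : qc z ≠ 0 := Complex.exp_ne_zero _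

lemma norm_qc (z : ℂ) : ‖qc z‖ = Real.exp (-(2 * Real.pi * z.im)) := by
  rw [qc, Complex.norm_exp]
  congr 1
  simp

lemma norm_qc_lt_one {z : ℂ} (hz : 0 < z.im) : ‖qc z‖ < 1 := by
  rw [norm_qc, Real.exp_lt_one_iff]
  have := Real.pi_pos
  nlinarith [mul_pos this hz]

lemma qc_nat_mul (n : ℕ) (z : ℂ) : qc (n * z) = qc z ^ n := by
  rw [qc, qc, ← Complex.exp_nat_mul]; congr 1; ring

lemma qc_int (n : ℤ) : qc n = 1 := by
  rw [qc, mul_comm]; exact Complex.exp_int_mul_two_pi_mul_I n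

lemma qc_eq_iff {z w : ℂ} : qc z = qc w ↔ ∃ n : ℤ, z = w + n := by
  rw [qc, qc, Complex.exp_eq_exp_iff_exists_int]
  have h : (2 * (Real.pi : ℂ) * I) ≠ 0 := Complex.two_pi_I_ne_zero
  constructor
  · rintro ⟨n, hn⟩
    exact ⟨n, mul_left_cancel₀ h (by rw [hn]; ring)⟩
  · rintro ⟨n, hn⟩
    exact ⟨n, by rw [hn]; ring⟩

lemma exists_qc_eq {q : ℂ} (h0 : q ≠ 0) : ∃ z : ℂ, qc z = q := by
  refine ⟨Complex.log q / (2 * Real.pi * I), ?_⟩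
  rw [qc, mul_div_cancel₀ _ Complex.two_pi_I_ne_zero, Complex.exp_log h0]

lemma im_pos_of_norm_qc_lt_one {z : ℂ} (h : ‖qc z‖ < 1) : 0 < z.im := by
  rw [norm_qc, Real.exp_lt_one_iff] at h
  have := Real.pi_pos
  by_contra hz
  nlinarith [mul_nonneg this.le (neg_nonneg.2 (not_lt.1 hz))]

lemma differentiable_qc : Differentiable ℂ qc := by
  unfold qc; fun_prop

/-- The sum of divisors as a complex number (`0` at `0`). -/
noncomputable def sg (n : ℕ) : ℂ := ∑ d ∈ n.divisors, (d : ℂ)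

lemma sg_zero : sg 0 = 0 := by simp [sg]

/-- `L(q) = ∑ σ(k) q^k / k`, so that `∏ (1 - q^n) = exp (-L(q))`. -/
noncomputable def lg (q : ℂ) : ℂ := ∑' k : ℕ, sg k / k * q ^ k

lemma norm_sg_le (n : ℕ) : ‖sg n‖ ≤ (n : ℝ) ^ 2 := by
  rw [sg]
  refine (norm_sum_le _ _).trans ?_
  have : ∀ d ∈ n.divisors, ‖(d : ℂ)‖ ≤ (n : ℝ) := fun d hd => by
    rw [Complex.norm_natCast]; exact_mod_cast Nat.divisor_le hd
  refine (Finset.sum_le_card_nsmul _ _ _ this).trans ?_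
  rw [nsmul_eq_mul, sq]
  gcongr
  exact_mod_cast Nat.card_divisors_le_self n

lemma norm_sg_div_le (n : ℕ) : ‖sg n / n‖ ≤ (n : ℝ) := by
  rcases Nat.eq_zero_or_pos n with rfl | hn
  · simp
  · rw [norm_div, Complex.norm_natCast, div_le_iff₀ (by exact_mod_cast hn), ← sq]
    exact norm_sg_le n

lemma summable_sg_div {q : ℂ} (hq : ‖q‖ < 1) : Summable fun k : ℕ => sg k / k * q ^ k := by
  have := summable_norm_pow_mul_geometric_of_norm_lt_one 1 hq
  refine Summable.of_norm_bounded this fun n => ?_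
  rw [norm_mul, norm_mul]
  gcongr
  simpa using norm_sg_div_le n

lemma tprod_one_sub_pow {q : ℂ} (hq : ‖q‖ < 1) :
    ∏' n : ℕ, (1 - q ^ (n + 1)) = Complex.exp (-lg q) := by
  have hpow : ∀ n : ℕ, ‖q ^ (n + 1)‖ < 1 := fun n => by
    rw [norm_pow]; exact pow_lt_one₀ (norm_nonneg _) hq (by simp)
  have hne : ∀ n : ℕ, (1 - q ^ (n + 1)) ≠ 0 := fun n h => by
    have := hpow n
    rw [← sub_eq_zero.1 h] at this; simp at this
  have hs : Summable fun n : ℕ => Complex.log (1 - q ^ (n + 1)) := by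
    have h : Summable fun n : ℕ => -q ^ (n + 1) :=
      ((summable_nat_add_iff (f := fun n : ℕ => q ^ n) 1).mpr
        (summable_geometric_of_norm_lt_one hq)).neg
    have h' := Complex.summable_log_one_add_of_summable h
    simpa only [← sub_eq_add_neg] using h'
  rw [← Complex.cexp_tsum_eq_tprod hne hs]
  congr 1
  have hsum2 : Summable fun c : ℕ+ × ℕ+ => q ^ (c.1 * c.2 : ℕ) / ((c.2 : ℕ) : ℂ) := by
    refine Summable.of_norm_bounded (summable_prod_mul_pow 0 hq).norm fun c => ?_
    rw [norm_div, pow_zero, one_mul, Complex.norm_natCast]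
    exact div_le_self (norm_nonneg _) (by exact_mod_cast c.2.2)
  have h1 : ∑' c : ℕ+ × ℕ+, q ^ (c.1 * c.2 : ℕ) / ((c.2 : ℕ) : ℂ) =
      ∑' n : ℕ, -Complex.log (1 - q ^ (n + 1)) := by
    rw [hsum2.tsum_prod, tsum_pnat_eq_tsum_succ
      (f := fun n : ℕ => ∑' m : ℕ+, q ^ (n * m : ℕ) / ((m : ℕ) : ℂ))]
    refine tsum_congr fun n => ?_
    rw [tsum_pnat_eq_tsum_succ (f := fun m : ℕ => q ^ ((n + 1) * m : ℕ) / (m : ℂ)),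
      ← (Complex.hasSum_taylorSeries_neg_log' (hpow n)).tsum_eq]
    refine tsum_congr fun m => ?_
    rw [pow_mul]; push_cast; rfl
  have h2 : ∑' c : ℕ+ × ℕ+, q ^ (c.1 * c.2 : ℕ) / ((c.2 : ℕ) : ℂ) = lg q := by
    have hsig := sigmaAntidiagonalEquivProd.summable_iff.2 hsum2
    rw [← sigmaAntidiagonalEquivProd.tsum_eq]
    simp only [Function.comp_def] at hsig
    rw [hsig.tsum_sigma, lg]
    have h0 : ∑' k : ℕ, sg k / k * q ^ k = ∑' k : ℕ, sg (k + 1) / (k + 1 : ℕ) * q ^ (k + 1) := by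
      rw [(summable_sg_div hq).tsum_eq_zero_add]; simp [sg_zero]
    rw [h0, ← tsum_pnat_eq_tsum_succ (f := fun k : ℕ => sg k / k * q ^ k)]
    refine tsum_congr fun n => ?_
    have hn : ((n : ℕ) : ℂ) ≠ 0 := by exact_mod_cast n.2.ne'
    simp only [sigmaAntidiagonalEquivProd, divisorsAntidiagonalFactors, PNat.mk_coe,
      Equiv.coe_fn_mk, tsum_fintype, Finset.univ_eq_attach]
    rw [(n : ℕ).divisorsAntidiagonal.sum_attach fun x : ℕ × ℕ => q ^ (x.1 * x.2) / (x.2 : ℂ),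
      Nat.sum_divisorsAntidiagonal fun x y => q ^ (x * y) / (y : ℂ), sg, Finset.sum_div,
      Finset.sum_mul]
    refine Finset.sum_congr rfl fun i hi => ?_
    have hi' := Nat.dvd_of_mem_divisors hi
    have hi0 : (i : ℂ) ≠ 0 := by exact_mod_cast (Nat.pos_of_mem_divisors hi).ne'
    rw [Nat.mul_div_cancel' hi', Nat.cast_div hi' hi0]
    field_simp
  rw [← h2, h1, tsum_neg, neg_neg]

lemma dedekindEta_eq_eta (z : ℂ) : dedekindEta z = ModularForm.eta z := by
  rw [dedekindEta, ModularForm.eta, Function.Periodic.qParam]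
  congr 1
  · congr 1; push_cast; ring
  · simp only [ModularForm.eta_q_eq_cexp]

lemma dedekindEta_eq_exp {z : ℂ} (hz : 0 < z.im) :
    dedekindEta z = Complex.exp (Real.pi * I * z / 12 - lg (qc z)) := by
  rw [sub_eq_add_neg, Complex.exp_add, ← tprod_one_sub_pow (norm_qc_lt_one hz), dedekindEta]
  congr 2
  ext n
  rw [qc, ← Complex.exp_nat_mul]
  congr 2; push_cast; ring

lemma dedekindEta_ne_zero {z : ℂ} (hz : 0 < z.im) : dedekindEta z ≠ 0 := by
  rw [dedekindEta_eq_exp hz]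
  exact Complex.exp_ne_zero _

lemma differentiableAt_dedekindEta {z : ℂ} (hz : 0 < z.im) :
    DifferentiableAt ℂ dedekindEta z := by
  rw [show dedekindEta = ModularForm.eta from funext dedekindEta_eq_eta]
  exact ModularForm.differentiableAt_eta_of_mem_upperHalfPlaneSet hz

/-- The transformation law of `η ^ 24` under `SL(2, ℤ)`. -/
lemma dedekindEta_pow_smul {a b c d : ℤ} (h : a * d - b * c = 1) {z : ℂ} (hz : 0 < z.im) :
    dedekindEta ((a * z + b) / (c * z + d)) ^ 24 =
      (c * z + d) ^ 12 * dedekindEta z ^ 24 := by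
  let γ : SpecialLinearGroup (Fin 2) ℤ := ⟨!![a, b; c, d], by rw [Matrix.det_fin_two_of, h]⟩
  let w : UpperHalfPlane := ⟨z, hz⟩
  have hγ : SpecialLinearGroup.mapGL ℝ γ ∈ (SpecialLinearGroup.mapGL (n := Fin 2) (R := ℤ) ℝ).range :=
    ⟨γ, rfl⟩
  have key := SlashInvariantForm.slash_action_eqn'' CuspForm.discriminant hγ w
  have hw : ((SpecialLinearGroup.mapGL ℝ γ • w : UpperHalfPlane) : ℂ) =
      (a * z + b) / (c * z + d) := by
    rw [show SpecialLinearGroup.mapGL ℝ γ • w = γ • w from rfl,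
      UpperHalfPlane.coe_specialLinearGroup_apply γ w]
    simp [γ, w]
  have hden : UpperHalfPlane.denom (SpecialLinearGroup.mapGL ℝ γ) w = c * z + d := by
    rw [UpperHalfPlane.denom]
    simp only [SpecialLinearGroup.mapGL_coe_matrix, SpecialLinearGroup.map_apply_coe,
      RingHom.mapMatrix_apply, Matrix.map_apply]
    simp [γ, w]
  simp only [CuspForm.coe_discriminant, ModularForm.discriminant, hw, hden] at key
  rw [dedekindEta_eq_eta, dedekindEta_eq_eta, key]
  norm_cast

end LevelTen

namespace LevelTen

/-! ### Integral matrices acting on the upper half-plane -/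

/-- Integral `2 × 2` matrices. -/
abbrev M2 := Matrix (Fin 2) (Fin 2) ℤ

/-- The automorphy factor `c z + d`. -/
noncomputable def jf (A : M2) (z : ℂ) : ℂ := A 1 0 * z + A 1 1

/-- The fractional linear action of an integral matrix. -/
noncomputable def mo (A : M2) (z : ℂ) : ℂ := (A 0 0 * z + A 0 1) / jf A z

lemma jf_ne_zero {A : M2} (hA : A.det ≠ 0) {z : ℂ} (hz : 0 < z.im) : jf A z ≠ 0 := by
  intro h
  have him := congrArg Complex.im h
  have hre := congrArg Complex.re h
  simp [jf] at him hre
  rcases him with h1 | h1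
  · rw [Matrix.det_fin_two] at hA
    apply hA
    have : A 1 1 = 0 := by
      have h2 : (A 1 1 : ℝ) = 0 := by simpa [h1] using hre
      exact_mod_cast h2
    simp [h1, this]
  · exact hz.ne' h1

lemma im_mo (A : M2) (z : ℂ) : (mo A z).im = A.det * z.im / Complex.normSq (jf A z) := by
  rw [mo, Complex.div_im, Matrix.det_fin_two]
  simp only [jf, Complex.add_im, Complex.mul_im, Complex.intCast_re, Complex.intCast_im,
    Complex.add_re, Complex.mul_re]
  push_cast
  ring

lemma mo_im_pos {A : M2} (hA : 0 < A.det) {z : ℂ} (hz : 0 < z.im) : 0 < (mo A z).im := by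
  rw [im_mo]
  have := Complex.normSq_pos.2 (jf_ne_zero hA.ne' hz)
  have hA' : (0 : ℝ) < A.det := by exact_mod_cast hA
  positivity

lemma jf_mul (A B : M2) {z : ℂ} (hB : jf B z ≠ 0) :
    jf (A * B) z = jf A (mo B z) * jf B z := by
  simp only [jf, mo, Matrix.mul_apply, Fin.sum_univ_two] at *
  push_cast
  field_simp
  ring

lemma mo_mul (A B : M2) {z : ℂ} (hB : jf B z ≠ 0) :
    mo (A * B) z = mo A (mo B z) := by
  have h := jf_mul A B hB
  rw [mo, mo, h]
  have : (((A * B) 0 0 : ℤ) * z + ((A * B) 0 1 : ℤ) : ℂ) =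
      (A 0 0 * mo B z + A 0 1) * jf B z := by
    simp only [mo, Matrix.mul_apply, Fin.sum_univ_two]
    rw [add_mul, mul_assoc, div_mul_cancel₀ _ hB, jf]
    push_cast
    ring
  rw [this, mul_div_mul_right _ _ hB]

lemma jf_smul (k : ℤ) (A : M2) (z : ℂ) : jf (k • A) z = k * jf A z := by
  simp [jf]; ring

lemma mo_smul {k : ℤ} (hk : k ≠ 0) (A : M2) (z : ℂ) : mo (k • A) z = mo A z := by
  have hk' : (k : ℂ) ≠ 0 := by exact_mod_cast hk
  rw [mo, mo, jf_smul, ← mul_div_mul_left _ (jf A z) hk']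
  congr 1
  simp; ring

lemma mo_one (z : ℂ) : mo 1 z = z := by simp [mo, jf]

lemma jf_one (z : ℂ) : jf 1 z = 1 := by simp [jf]

lemma mo_adjugate {A : M2} (hA : 0 < A.det) {z : ℂ} (hz : 0 < z.im) :
    mo A.adjugate (mo A z) = z := by
  rw [← mo_mul _ _ (jf_ne_zero hA.ne' hz), Matrix.adjugate_mul, mo_smul hA.ne', mo_one]

lemma det_adjugate_two (A : M2) : A.adjugate.det = A.det := by
  rw [Matrix.det_adjugate]; simp

lemma mo_mo_adjugate {A : M2} (hA : 0 < A.det) {z : ℂ} (hz : 0 < z.im) :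
    mo A (mo A.adjugate z) = z := by
  have h : A.adjugate.det ≠ 0 := by rw [det_adjugate_two]; exact hA.ne'
  rw [← mo_mul _ _ (jf_ne_zero h hz), Matrix.mul_adjugate, mo_smul hA.ne', mo_one]

lemma hasDerivAt_mo (A : M2) {z : ℂ} (h : jf A z ≠ 0) :
    HasDerivAt (mo A) (A.det / jf A z ^ 2) z := by
  have h1 : HasDerivAt (fun z : ℂ => (A 0 0 : ℂ) * z + A 0 1) (A 0 0 : ℂ) z := by
    simpa using ((hasDerivAt_id z).const_mul (A 0 0 : ℂ)).add_const (A 0 1 : ℂ)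
  have h2 : HasDerivAt (fun z : ℂ => (A 1 0 : ℂ) * z + A 1 1) (A 1 0 : ℂ) z := by
    simpa using ((hasDerivAt_id z).const_mul (A 1 0 : ℂ)).add_const (A 1 1 : ℂ)
  refine (h1.div h2 h).congr_deriv ?_
  rw [Matrix.det_fin_two, jf]
  push_cast
  ring

lemma differentiableAt_mo {A : M2} (hA : A.det ≠ 0) {z : ℂ} (hz : 0 < z.im) :
    DifferentiableAt ℂ (mo A) z :=
  (hasDerivAt_mo A (jf_ne_zero hA hz)).differentiableAt

/-- The open upper half-plane as a set of complex numbers. -/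
def UH : Set ℂ := {z | 0 < z.im}

lemma isOpen_UH : IsOpen UH := isOpen_lt continuous_const Complex.continuous_im

lemma UH_mem_nhds {z : ℂ} (hz : 0 < z.im) : UH ∈ nhds z := isOpen_UH.mem_nhds hz

lemma isPreconnected_UH : IsPreconnected UH := (convex_halfSpace_im_gt 0).isPreconnected

/-! ### Atkin–Lehner matrices of level ten -/

/-- Integral Atkin–Lehner matrices of level `10` and type `e`. -/
structure AL (e : ℕ) (A : M2) : Prop where
  dvd_ten : e ∣ 10
  dvd_a : (e : ℤ) ∣ A 0 0
  dvd_d : (e : ℤ) ∣ A 1 1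
  dvd_c : (10 : ℤ) ∣ A 1 0
  det_eq : A.det = e

/-- The composition law of Atkin–Lehner types. -/
def star (e f : ℕ) : ℕ := e * f / (Nat.gcd e f) ^ 2

lemma dvd_ten_cases {e : ℕ} (h : e ∣ 10) : e = 1 ∨ e = 2 ∨ e = 5 ∨ e = 10 := by
  have : e ∈ Nat.divisors 10 := by simp [h]
  rw [show Nat.divisors 10 = {1, 2, 5, 10} by decide] at this
  simpa using this

lemma AL.pos {e : ℕ} {A : M2} (h : AL e A) : 0 < e := Nat.pos_of_dvd_of_pos h.dvd_ten (by norm_num)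

lemma AL.det_pos {e : ℕ} {A : M2} (h : AL e A) : 0 < A.det := by
  rw [h.det_eq]; exact_mod_cast h.pos

lemma AL.det_ne {e : ℕ} {A : M2} (h : AL e A) : A.det ≠ 0 := h.det_pos.ne'

lemma AL.one : AL 1 1 := ⟨by norm_num, by simp, by simp, by simp, by simp⟩

lemma AL.adjugate {e : ℕ} {A : M2} (h : AL e A) : AL e A.adjugate := by
  refine ⟨h.dvd_ten, ?_, ?_, ?_, ?_⟩
  · rw [Matrix.adjugate_fin_two]; simpa using h.dvd_d
  · rw [Matrix.adjugate_fin_two]; simpa using h.dvd_a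
  · rw [Matrix.adjugate_fin_two]; simpa using h.dvd_c
  · rw [det_adjugate_two, h.det_eq]

lemma AL.neg {e : ℕ} {A : M2} (h : AL e A) : AL e (-A) := by
  refine ⟨h.dvd_ten, by simpa using h.dvd_a, by simpa using h.dvd_d, by simpa using h.dvd_c, ?_⟩
  rw [Matrix.det_neg, h.det_eq]; simp

lemma AL.mul {e f : ℕ} {A B : M2} (hA : AL e A) (hB : AL f B) :
    ∃ C : M2, A * B = ((Nat.gcd e f : ℕ) : ℤ) • C ∧ AL (star e f) C := by
  have hee := dvd_ten_cases hA.dvd_ten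
  have hff := dvd_ten_cases hB.dvd_ten
  obtain ⟨a, ha⟩ := hA.dvd_a
  obtain ⟨d, hd⟩ := hA.dvd_d
  obtain ⟨c, hc⟩ := hA.dvd_c
  obtain ⟨a', ha'⟩ := hB.dvd_a
  obtain ⟨d', hd'⟩ := hB.dvd_d
  obtain ⟨c', hc'⟩ := hB.dvd_c
  have hg : 0 < Nat.gcd e f := Nat.gcd_pos_of_pos_left _ hA.pos
  have hg2 : (e * f : ℤ) = (star e f : ℕ) * (Nat.gcd e f : ℤ) ^ 2 := by
    rcases hee with rfl | rfl | rfl | rfl <;> rcases hff with rfl | rfl | rfl | rfl <;>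
      norm_num [star]
  have hs : star e f ∣ 10 := by
    rcases hee with rfl | rfl | rfl | rfl <;> rcases hff with rfl | rfl | rfl | rfl <;>
      norm_num [star]
  have k1 : ((Nat.gcd e f : ℕ) * (star e f : ℕ) : ℤ) ∣ e * f :=
    ⟨Nat.gcd e f, by rw [hg2]; ring⟩
  have k2 : ((Nat.gcd e f : ℕ) * (star e f : ℕ) : ℤ) ∣ 10 := by
    rcases hee with rfl | rfl | rfl | rfl <;> rcases hff with rfl | rfl | rfl | rfl <;>
      norm_num [star]
  have k3 : ((Nat.gcd e f : ℕ) : ℤ) ∣ e := by exact_mod_cast Nat.gcd_dvd_left e f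
  have k4 : ((Nat.gcd e f : ℕ) : ℤ) ∣ f := by exact_mod_cast Nat.gcd_dvd_right e f
  have m00 : (A * B) 0 0 = e * f * (a * a') + 10 * (A 0 1 * c') := by
    rw [Matrix.mul_apply, Fin.sum_univ_two, ha, ha', hc']; ring
  have m11 : (A * B) 1 1 = e * f * (d * d') + 10 * (B 0 1 * c) := by
    rw [Matrix.mul_apply, Fin.sum_univ_two, hd, hd', hc]; ring
  have m01 : (A * B) 0 1 = e * (a * B 0 1) + f * (A 0 1 * d') := by
    rw [Matrix.mul_apply, Fin.sum_univ_two, ha, hd']; ring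
  have m10 : (A * B) 1 0 = 10 * (f * (c * a') + e * (d * c')) := by
    rw [Matrix.mul_apply, Fin.sum_univ_two, ha', hd, hc, hc']; ring
  obtain ⟨x, hx⟩ : ((Nat.gcd e f : ℕ) * (star e f : ℕ) : ℤ) ∣ (A * B) 0 0 := by
    rw [m00]; exact dvd_add (k1.mul_right _) (k2.mul_right _)
  obtain ⟨w, hw⟩ : ((Nat.gcd e f : ℕ) * (star e f : ℕ) : ℤ) ∣ (A * B) 1 1 := by
    rw [m11]; exact dvd_add (k1.mul_right _) (k2.mul_right _)
  obtain ⟨y, hy⟩ : ((Nat.gcd e f : ℕ) : ℤ) ∣ (A * B) 0 1 := by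
    rw [m01]; exact dvd_add (k3.mul_right _) (k4.mul_right _)
  obtain ⟨v, hv⟩ : ((Nat.gcd e f : ℕ) : ℤ) ∣ (f * (c * a') + e * (d * c')) :=
    dvd_add (k4.mul_right _) (k3.mul_right _)
  have hC : A * B = ((Nat.gcd e f : ℕ) : ℤ) • !![star e f * x, y; 10 * v, star e f * w] := by
    ext i j
    fin_cases i <;> fin_cases j
    · simpa [mul_assoc] using hx
    · simpa using hy
    · simp only [Fin.mk_one, Fin.zero_eta]
      rw [m10, hv]; simp; ring
    · simpa [mul_assoc] using hw
  refine ⟨_, hC, hs, by simp, by simp, by simp, ?_⟩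
  have hdet := congrArg Matrix.det hC
  rw [Matrix.det_mul, hA.det_eq, hB.det_eq, Matrix.det_smul, hg2] at hdet
  have hgz : ((Nat.gcd e f : ℕ) : ℤ) ^ 2 ≠ 0 := by positivity
  simp only [Fintype.card_fin] at hdet
  exact (mul_left_cancel₀ hgz (by rw [← hdet]; ring)).symm

lemma AL.mo_mul {e f : ℕ} {A B : M2} (hA : AL e A) (hB : AL f B) :
    ∃ C : M2, AL (star e f) C ∧ ∀ z : ℂ, 0 < z.im → mo A (mo B z) = mo C z := by
  obtain ⟨C, hC, hC'⟩ := hA.mul hB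
  refine ⟨C, hC', fun z hz => ?_⟩
  have hg : 0 < Nat.gcd e f := Nat.gcd_pos_of_pos_left _ hA.pos
  rw [← LevelTen.mo_mul _ _ (jf_ne_zero hB.det_ne hz), hC, mo_smul (by exact_mod_cast hg.ne')]

lemma AL.mo_im_pos {e : ℕ} {A : M2} (hA : AL e A) {z : ℂ} (hz : 0 < z.im) : 0 < (mo A z).im :=
  LevelTen.mo_im_pos hA.det_pos hz

/-- Every point has an Atkin–Lehner translate of height at least `1/20`. -/
lemma exists_AL_im_ge {z : ℂ} (hz : 0 < z.im) :
    ∃ e, ∃ A : M2, AL e A ∧ 1 / 20 ≤ (mo A z).im := by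
  obtain ⟨γ, hγ⟩ := ModularGroup.exists_smul_mem_fd ⟨z, hz⟩
  have him := ModularGroup.three_le_four_mul_im_sq_of_mem_fd hγ
  set c := γ 1 0 with hc
  set d := γ 1 1 with hd
  have hdet : γ 0 0 * d - γ 0 1 * c = 1 := by
    have := γ.det_coe; rw [Matrix.det_fin_two] at this; exact this
  have himγ : (γ • (⟨z, hz⟩ : UpperHalfPlane)).im = z.im / Complex.normSq (c * z + d) := by
    rw [← UpperHalfPlane.coe_im, UpperHalfPlane.coe_specialLinearGroup_apply]
    have := im_mo γ.1 z
    rw [γ.det_coe] at this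
    simpa [mo, jf, hc, hd] using this
  rw [himγ] at him
  -- the type `e` of the translate
  obtain ⟨e, he, hec, hcop⟩ : ∃ e : ℕ, e ∣ 10 ∧ (10 : ℤ) ∣ e * c ∧ IsCoprime (e : ℤ) c := by
    have hc10 : ∀ p : ℕ, p.Prime → (¬ (p : ℤ) ∣ c) → IsCoprime (p : ℤ) c := fun p hp h =>
      (Nat.prime_iff_prime_int.1 hp).coprime_iff_not_dvd.2 h
    have p2 := hc10 2 Nat.prime_two
    have p5 := hc10 5 Nat.prime_five
    by_cases h2 : (2 : ℤ) ∣ c <;> by_cases h5 : (5 : ℤ) ∣ c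
    · exact ⟨1, by norm_num, by omega, by simpa using isCoprime_one_left⟩
    · exact ⟨5, by norm_num, by omega, p5 h5⟩
    · exact ⟨2, by norm_num, by omega, p2 h2⟩
    · refine ⟨10, by norm_num, by omega, ?_⟩
      have := (p2 h2).mul_left (p5 h5)
      norm_num at this ⊢
      exact this
  have hcd : IsCoprime d c := ⟨γ 0 0, -γ 0 1, by linarith⟩
  obtain ⟨x, y, hxy⟩ := hcop.mul_left hcd
  have hepos : 0 < e := Nat.pos_of_dvd_of_pos he (by norm_num)
  refine ⟨e, !![e * x, -y; e * c, e * d], ⟨he, by simp, by simp, by simpa using hec, ?_⟩, ?_⟩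
  · rw [Matrix.det_fin_two_of]; linear_combination (e : ℤ) * hxy
  · rw [im_mo]
    have h1 : Matrix.det !![(e : ℤ) * x, -y; e * c, e * d] = e := by
      rw [Matrix.det_fin_two_of]; linear_combination (e : ℤ) * hxy
    have h2 : jf !![(e : ℤ) * x, -y; e * c, e * d] z = (e : ℂ) * (c * z + d) := by
      simp [jf]; ring
    rw [h1, h2, Complex.normSq_mul, Complex.normSq_natCast]
    have hY : 0 < z.im / Complex.normSq (c * z + d) := by
      rw [← himγ]; exact (γ • (⟨z, hz⟩ : UpperHalfPlane)).im_pos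
    set Y := z.im / Complex.normSq (c * z + d)
    have : ((e : ℤ) : ℝ) * z.im / ((e : ℝ) * e * Complex.normSq (c * z + d)) = Y / e := by
      have : (e : ℝ) ≠ 0 := by exact_mod_cast hepos.ne'
      simp only [Y]; push_cast; field_simp
    rw [this]
    have he10 : (e : ℝ) ≤ 10 := by exact_mod_cast Nat.le_of_dvd (by norm_num) he
    have he0 : (0 : ℝ) < e := by exact_mod_cast hepos
    rw [le_div_iff₀ he0]
    nlinarith

end LevelTen

namespace LevelTen

/-! ### Generators of `Γ₀(10)` -/

lemma AL.mul_one_type {A B : M2} (hA : AL 1 A) (hB : AL 1 B) : AL 1 (A * B) := by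
  obtain ⟨C, hC, hC'⟩ := hA.mul hB
  simp only [Nat.gcd_self, Nat.cast_one, one_smul] at hC
  rw [hC]; exact hC'

/-- An induction principle for `Γ₀(10)`, by descent on the lower left entry. -/
lemma gamma0_induction (S : M2 → Prop)
    (hmul : ∀ A g, AL 1 A → AL 1 g → S g → S (A * g) → S A)
    (hneg : ∀ A, AL 1 A → S (-A) → S A)
    (hT : ∀ k : ℤ, S !![1, k; 0, 1])
    (h₁ : S !![1, 0; 10, 1]) (h₂ : S !![1, 0; -10, 1])
    (h₃ : S !![3, -1; 10, -3]) (h₄ : S !![-3, -1; 10, 3])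
    (h₅ : S !![9, -5; 20, -11]) (h₆ : S !![-9, -5; 20, 11]) :
    ∀ A, AL 1 A → S A := by
  have main : ∀ n : ℕ, ∀ C a b d : ℤ, C.natAbs ≤ n → a * d - b * (10 * C) = 1 →
      S !![a, b; 10 * C, d] := by
    have al : ∀ a b C d : ℤ, a * d - b * (10 * C) = 1 → AL 1 !![a, b; 10 * C, d] :=
      fun a b C d h => ⟨by norm_num, by simp, by simp, by simp, by
        rw [Matrix.det_fin_two_of, h]; rfl⟩
    intro n
    induction n with
    | zero =>
      intro C a b d hC h
      obtain rfl : C = 0 := by omega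
      have had : a * d = 1 := by linarith
      rcases Int.eq_one_or_neg_one_of_mul_eq_one' had with ⟨rfl, rfl⟩ | ⟨rfl, rfl⟩
      · simpa using hT b
      · apply hneg _ (al _ _ _ _ h)
        simpa using hT (-b)
    | succ n ih =>
      -- the positive case
      have pos : ∀ C a b d : ℤ, 0 < C → C ≤ n + 1 → a * d - b * (10 * C) = 1 →
          S !![a, b; 10 * C, d] := by
        intro C a b d hC0 hC h
        obtain ⟨k, hk1, hk2⟩ : ∃ k : ℤ, -5 * C ≤ d + k * (10 * C) ∧ d + k * (10 * C) < 5 * C := by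
          refine ⟨-((d + 5 * C) / (10 * C)), ?_, ?_⟩
          · have := Int.emod_nonneg (d + 5 * C) (show 10 * C ≠ 0 by omega)
            have h' := Int.emod_add_mul_ediv (d + 5 * C) (10 * C)
            nlinarith
          · have := Int.emod_lt_of_pos (d + 5 * C) (show 0 < 10 * C by omega)
            have h' := Int.emod_add_mul_ediv (d + 5 * C) (10 * C)
            nlinarith
        refine hmul _ !![1, k; 0, 1] (al _ _ _ _ h) (by simpa using al 1 k 0 1 (by ring)) (hT k) ?_
        have hprod : !![a, b; 10 * C, d] * !![1, k; 0, 1] =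
            !![a, b + k * a; 10 * C, d + k * (10 * C)] := by
          ext i j; fin_cases i <;> fin_cases j <;> simp [Matrix.mul_apply, Fin.sum_univ_two] <;> ring
        rw [hprod]
        generalize hD : d + k * (10 * C) = D at *
        have hdet : a * D - (b + k * a) * (10 * C) = 1 := by rw [← hD]; linarith
        generalize b + k * a = b at *
        have step : ∀ α β κ δ : ℤ, α * δ - β * (10 * κ) = 1 → S !![α, β; 10 * κ, δ] →
            |C * α + D * κ| < C → S !![a, b; 10 * C, D] := by
          intro α β κ δ hg hS hlt
          refine hmul _ _ (al _ _ _ _ hdet) (al _ _ _ _ hg) hS ?_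
          have hp : !![a, b; 10 * C, D] * !![α, β; 10 * κ, δ] =
              !![a * α + b * (10 * κ), a * β + b * δ; 10 * (C * α + D * κ),
                10 * C * β + D * δ] := by
            ext i j
            fin_cases i <;> fin_cases j <;> simp [Matrix.mul_apply, Fin.sum_univ_two] <;> ring
          rw [hp]
          refine ih _ _ _ _ ?_ (by linear_combination hdet * (α * δ - β * (10 * κ)) + hg)
          have : (C * α + D * κ).natAbs = |C * α + D * κ| := Int.natCast_natAbs _
          omega
        have bd : ∀ m : ℤ, D = m * C → (2 ∣ m ∨ 5 ∣ m) → False := by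
          intro m hm hm'
          rw [hm] at hdet
          have h1 : C * (a * m - 10 * b) = 1 := by linear_combination hdet
          rcases Int.eq_one_or_neg_one_of_mul_eq_one' h1 with ⟨_, h2⟩ | ⟨h2, _⟩
          · rcases hm' with ⟨x, rfl⟩ | ⟨x, rfl⟩
            · have : 2 * (a * x - 5 * b) = 1 := by linear_combination h2
              omega
            · have : 5 * (a * x - 2 * b) = 1 := by linear_combination h2
              omega
          · omega
        have b0 := fun h => bd 0 h (by norm_num)
        have b2 := fun h => bd 2 h (by norm_num)
        have b2' := fun h => bd (-2) h (by norm_num)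
        have b4 := fun h => bd 4 h (by norm_num)
        have b4' := fun h => bd (-4) h (by norm_num)
        have b5' := fun h => bd (-5) h (by norm_num)
        have b5'' : -5 * C < D := lt_of_le_of_ne hk1 (fun h => b5' h.symm)
        rcases lt_trichotomy D (-4 * C) with hlt | heq | hgt
        · exact step 9 (-5) 2 (-11) (by norm_num) (by simpa using h₅)
            (abs_lt.2 ⟨by omega, by omega⟩)
        · exact (b4' heq).elim
        rcases lt_trichotomy D (-2 * C) with hlt | heq | hgt
        · exact step 3 (-1) 1 (-3) (by norm_num) (by simpa using h₃)
            (abs_lt.2 ⟨by omega, by omega⟩)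
        · exact (b2' heq).elim
        rcases lt_trichotomy D 0 with hlt | heq | hgt
        · exact step 1 0 1 1 (by norm_num) (by simpa using h₁) (abs_lt.2 ⟨by omega, by omega⟩)
        · exact (b0 (by omega)).elim
        rcases lt_trichotomy D (2 * C) with hlt | heq | hgt
        · exact step 1 0 (-1) 1 (by norm_num) (by simpa using h₂) (abs_lt.2 ⟨by omega, by omega⟩)
        · exact (b2 heq).elim
        rcases lt_trichotomy D (4 * C) with hlt | heq | hgt
        · exact step (-3) (-1) 1 3 (by norm_num) (by simpa using h₄)
            (abs_lt.2 ⟨by omega, by omega⟩)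
        · exact (b4 heq).elim
        · exact step (-9) (-5) 2 11 (by norm_num) (by simpa using h₆)
            (abs_lt.2 ⟨by omega, by omega⟩)
      intro C a b d hC h
      rcases lt_trichotomy C 0 with hlt | rfl | hgt
      · apply hneg _ (al _ _ _ _ h)
        have := pos (-C) (-a) (-b) (-d) (by omega) (by omega) (by linarith)
        simpa using this
      · exact ih 0 a b d (by simp) h
      · exact pos C a b d hgt (by omega) h
  intro A hA
  obtain ⟨C, hC⟩ := hA.dvd_c
  have hdet := hA.det_eq
  rw [Matrix.det_fin_two, hC] at hdet
  have := main C.natAbs C (A 0 0) (A 0 1) (A 1 1) le_rfl (by exact_mod_cast hdet)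
  rw [← hC] at this
  rwa [← Matrix.eta_fin_two A] at this

end LevelTen

namespace LevelTen

/-! ### Eta quotients of level ten -/

/-- The index set `{1, 2, 5, 10}`. -/
abbrev D10 : Finset ℕ := Nat.divisors 10

lemma D10_eq : D10 = {1, 2, 5, 10} := by decide

lemma mem_D10 {d : ℕ} : d ∈ D10 ↔ d ∣ 10 := by simp [D10]

lemma star_data {d e : ℕ} (hd : d ∣ 10) (he : e ∣ 10) : ∃ g d₁ e₁ m : ℕ,
    d = g * d₁ ∧ e = g * e₁ ∧ g * d₁ * e₁ * m = 10 ∧ star d e = d₁ * e₁ ∧ Nat.gcd d e = g := by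
  refine ⟨Nat.gcd d e, d / Nat.gcd d e, e / Nat.gcd d e, 10 / Nat.lcm d e, ?_⟩
  rcases dvd_ten_cases hd with rfl | rfl | rfl | rfl <;>
    rcases dvd_ten_cases he with rfl | rfl | rfl | rfl <;> decide

lemma star_dvd {d e : ℕ} (hd : d ∣ 10) (he : e ∣ 10) : star d e ∣ 10 := by
  rcases dvd_ten_cases hd with rfl | rfl | rfl | rfl <;>
    rcases dvd_ten_cases he with rfl | rfl | rfl | rfl <;> decide

lemma star_star {d e : ℕ} (hd : d ∣ 10) (he : e ∣ 10) : star (star d e) e = d := by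
  rcases dvd_ten_cases hd with rfl | rfl | rfl | rfl <;>
    rcases dvd_ten_cases he with rfl | rfl | rfl | rfl <;> decide

lemma eta_pow_mo {d e : ℕ} (hd : d ∣ 10) {A : M2} (hA : AL e A) {z : ℂ} (hz : 0 < z.im) :
    dedekindEta (d * mo A z) ^ 24 =
      (jf A z / (Nat.gcd d e : ℕ)) ^ 12 * dedekindEta (star d e * z) ^ 24 := by
  have hj := jf_ne_zero hA.det_ne hz
  obtain ⟨g, d₁, e₁, m, hd', he', h10, hs, hg⟩ := star_data hd hA.dvd_ten
  obtain ⟨a, ha⟩ := hA.dvd_a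
  obtain ⟨c, hc⟩ := hA.dvd_c
  obtain ⟨δ, hδ⟩ := hA.dvd_d
  have hdet := hA.det_eq
  rw [hg, hs]
  have g0 : g ≠ 0 := by rintro rfl; simp at h10
  have d0 : d₁ ≠ 0 := by rintro rfl; simp at h10
  have e0 : e₁ ≠ 0 := by rintro rfl; simp at h10
  have h10' : (g * d₁ * e₁ * m : ℤ) = 10 := by exact_mod_cast h10
  rw [Matrix.det_fin_two, ha, hc, hδ, he'] at hdet
  push_cast at hdet
  have hγ : (a * g) * (δ * e₁) - (d₁ * A 0 1) * (c * m) = 1 := by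
    have : (g * e₁ : ℤ) ≠ 0 := by positivity
    apply mul_left_cancel₀ this
    linear_combination hdet - A 0 1 * c * h10'
  have hw : 0 < (((d₁ * e₁ : ℕ) : ℂ) * z).im := by
    have : (0:ℝ) < (d₁ * e₁ : ℕ) := by positivity
    simpa using mul_pos this hz
  have key := dedekindEta_pow_smul hγ hw
  have g0' : (g : ℂ) ≠ 0 := by exact_mod_cast g0
  have hden : ((c * m : ℤ) * (((d₁ * e₁ : ℕ) : ℂ) * z) + (δ * e₁ : ℤ) : ℂ) = jf A z / g := by
    rw [jf, hc, hδ, he', eq_div_iff g0']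
    have h10c : (g * d₁ * e₁ * m : ℂ) = 10 := by exact_mod_cast h10
    push_cast
    linear_combination c * z * h10c
  rw [hden] at key
  rw [← key]
  congr 2
  rw [mo, ha, he', hd']
  push_cast
  field_simp

/-- The eta quotient `∏ η(dz)^{r d}`. -/
noncomputable def etaQ (r : ℕ → ℤ) (z : ℂ) : ℂ := ∏ d ∈ D10, dedekindEta (d * z) ^ r d

lemma im_natCast_mul_pos {d : ℕ} (hd : d ≠ 0) {z : ℂ} (hz : 0 < z.im) : 0 < ((d : ℂ) * z).im := by
  have : (0:ℝ) < d := by positivity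
  simpa using mul_pos this hz

lemma ne_zero_of_mem_D10 {d : ℕ} (hd : d ∈ D10) : d ≠ 0 := (Nat.pos_of_mem_divisors hd).ne'

lemma etaQ_ne_zero (r : ℕ → ℤ) {z : ℂ} (hz : 0 < z.im) : etaQ r z ≠ 0 :=
  Finset.prod_ne_zero_iff.2 fun _ hd =>
    zpow_ne_zero _ (dedekindEta_ne_zero (im_natCast_mul_pos (ne_zero_of_mem_D10 hd) hz))

lemma differentiableAt_etaQ (r : ℕ → ℤ) {z : ℂ} (hz : 0 < z.im) :
    DifferentiableAt ℂ (etaQ r) z := by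
  unfold etaQ
  refine DifferentiableAt.fun_finsetProd fun d hd => ?_
  have h := im_natCast_mul_pos (ne_zero_of_mem_D10 hd) hz
  refine DifferentiableAt.zpow ?_ (Or.inl (dedekindEta_ne_zero h))
  exact (differentiableAt_dedekindEta h).comp z (differentiableAt_id.const_mul (d : ℂ))

lemma prod_star {M : Type*} [CommMonoid M] {e : ℕ} (he : e ∣ 10) (f : ℕ → M) :
    ∏ d ∈ D10, f (star d e) = ∏ d ∈ D10, f d := by
  refine Finset.prod_nbij' (fun d => star d e) (fun d => star d e) ?_ ?_ ?_ ?_ ?_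
  · exact fun d hd => mem_D10.2 (star_dvd (mem_D10.1 hd) he)
  · exact fun d hd => mem_D10.2 (star_dvd (mem_D10.1 hd) he)
  · exact fun d hd => star_star (mem_D10.1 hd) he
  · exact fun d hd => star_star (mem_D10.1 hd) he
  · exact fun d _ => rfl

lemma etaQ_pow_mo (r : ℕ → ℤ) {e : ℕ} {A : M2} (hA : AL e A) {z : ℂ} (hz : 0 < z.im) :
    etaQ r (mo A z) ^ 24 = jf A z ^ (12 * ∑ d ∈ D10, r d) *
      (∏ d ∈ D10, ((Nat.gcd d e : ℕ) : ℂ) ^ (-12 * r d)) *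
        etaQ (fun d => r (star d e)) z ^ 24 := by
  have hj := jf_ne_zero hA.det_ne hz
  have h1 : etaQ (fun d => r (star d e)) z = ∏ d ∈ D10, dedekindEta (star d e * z) ^ r d := by
    rw [etaQ, ← prod_star hA.dvd_ten]
    refine Finset.prod_congr rfl fun d hd => ?_
    rw [star_star (mem_D10.1 hd) hA.dvd_ten]
  have h2 : jf A z ^ (12 * ∑ d ∈ D10, r d) = ∏ d ∈ D10, jf A z ^ (12 * r d) := by
    rw [Finset.mul_sum]
    induction D10 using Finset.induction_on with
    | empty => simp
    | insert a s ha ih => rw [Finset.sum_insert ha, Finset.prod_insert ha, zpow_add₀ hj, ih]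
  rw [h1, h2, etaQ, ← Finset.prod_pow, ← Finset.prod_pow, ← Finset.prod_mul_distrib,
    ← Finset.prod_mul_distrib]
  refine Finset.prod_congr rfl fun d hd => ?_
  have h24 : ∀ (x : ℂ), (x ^ r d) ^ 24 = (x ^ 24) ^ r d := fun x => by
    rw [← zpow_natCast, ← zpow_natCast, zpow_comm]
  rw [h24, eta_pow_mo (mem_D10.1 hd) hA hz, mul_zpow, h24]
  congr 1
  rw [div_pow, div_zpow, ← zpow_natCast, ← zpow_natCast, ← _root_.zpow_mul, ← _root_.zpow_mul,
    div_eq_mul_inv, ← _root_.zpow_neg]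
  norm_num

/-- A holomorphic function on the upper half-plane with constant power is constant. -/
lemma constant_of_pow_constant {f : ℂ → ℂ} (hf : ∀ z : ℂ, 0 < z.im → DifferentiableAt ℂ f z)
    {n : ℕ} (hn : n ≠ 0) {c : ℂ} (h : ∀ z : ℂ, 0 < z.im → f z ^ n = c) {z : ℂ} (hz : 0 < z.im) :
    f z = f I := by
  have hI : I ∈ UH := by simp [UH]
  refine Complex.eqOn_of_isPreconnected_of_isMaxOn_norm (c := I) (U := UH) isPreconnected_UH
    isOpen_UH (fun z hz => (hf z hz).differentiableWithinAt) hI ?_ hz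
  intro w hw
  have : ‖f w‖ ^ n = ‖f I‖ ^ n := by rw [← norm_pow, ← norm_pow, h w hw, h I hI]
  exact ((pow_left_inj₀ (norm_nonneg _) (norm_nonneg _) hn).1 this).le

lemma etaQ_mo {r : ℕ → ℤ} (hr : ∑ d ∈ D10, r d = 0) {e : ℕ} {A : M2} (hA : AL e A) :
    ∃ χ : ℂ, χ ^ 24 = ∏ d ∈ D10, ((Nat.gcd d e : ℕ) : ℂ) ^ (-12 * r d) ∧
      ∀ z : ℂ, 0 < z.im → etaQ r (mo A z) = χ * etaQ (fun d => r (star d e)) z := by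
  set f : ℂ → ℂ := fun z => etaQ r (mo A z) / etaQ (fun d => r (star d e)) z with hf
  have hpow : ∀ z : ℂ, 0 < z.im →
      f z ^ 24 = ∏ d ∈ D10, ((Nat.gcd d e : ℕ) : ℂ) ^ (-12 * r d) := fun z hz => by
    have h0 := etaQ_ne_zero (fun d => r (star d e)) hz
    rw [hf]
    simp only [div_pow]
    rw [etaQ_pow_mo r hA hz, hr, mul_zero, zpow_zero, one_mul, mul_div_assoc,
      div_self (pow_ne_zero _ h0), mul_one]
  have hd : ∀ z : ℂ, 0 < z.im → DifferentiableAt ℂ f z := fun z hz =>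
    ((differentiableAt_etaQ r (hA.mo_im_pos hz)).comp z (differentiableAt_mo hA.det_ne hz)).div
      (differentiableAt_etaQ _ hz) (etaQ_ne_zero _ hz)
  refine ⟨f I, hpow I (by simp), fun z hz => ?_⟩
  rw [← constant_of_pow_constant hd (by norm_num) hpow hz, hf]
  simp only
  rw [div_mul_cancel₀ _ (etaQ_ne_zero _ hz)]

/-- The logarithmic form of an eta quotient. -/
lemma etaQ_eq_exp {r : ℕ → ℤ} {m : ℤ} (hm : ∑ d ∈ D10, (d : ℤ) * r d = 24 * m) {z : ℂ}
    (hz : 0 < z.im) :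
    etaQ r z = qc z ^ m * exp (-∑ d ∈ D10, r d * lg (qc z ^ d)) := by
  have : ∀ d ∈ D10, dedekindEta (d * z) ^ r d =
      exp (Real.pi * I * z / 12 * (d * r d) - r d * lg (qc z ^ d)) := fun d hd => by
    rw [dedekindEta_eq_exp (im_natCast_mul_pos (ne_zero_of_mem_D10 hd) hz), ← Complex.exp_int_mul,
      qc_nat_mul]
    congr 1; ring
  rw [etaQ, Finset.prod_congr rfl this, ← Complex.exp_sum, qc, ← Complex.exp_int_mul,
    ← Complex.exp_add, Finset.sum_sub_distrib, ← Finset.mul_sum]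
  have hm' : (∑ d ∈ D10, (d : ℂ) * r d) = 24 * m := by exact_mod_cast hm
  rw [hm']
  congr 1
  ring

/-- Eta quotients of weight `0` with integral orders at all cusps. -/
structure Adm (r : ℕ → ℤ) (m : ℕ → ℤ) : Prop where
  weight : ∑ d ∈ D10, r d = 0
  order : ∀ e ∈ D10, ∑ d ∈ D10, (d : ℤ) * r (star d e) = 24 * m e

lemma star_one (d : ℕ) : star d 1 = d := by simp [star]

lemma star_comm (d e : ℕ) : star d e = star e d := by
  rw [star, star, mul_comm, Nat.gcd_comm]

lemma etaQ_congr {r r' : ℕ → ℤ} (h : ∀ d ∈ D10, r d = r' d) : etaQ r = etaQ r' := by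
  funext z; exact Finset.prod_congr rfl fun d hd => by rw [h d hd]

lemma qc_add_int (z : ℂ) (k : ℤ) : qc (z + k) = qc z := by
  rw [qc_add, qc_int, mul_one]

lemma Adm.periodic {r m : ℕ → ℤ} (h : Adm r m) {e : ℕ} (he : e ∣ 10) (k : ℤ) {z : ℂ}
    (hz : 0 < z.im) :
    etaQ (fun d => r (star d e)) (z + k) = etaQ (fun d => r (star d e)) z := by
  have hz' : 0 < (z + k).im := by simpa using hz
  rw [etaQ_eq_exp (h.order e (mem_D10.2 he)) hz', etaQ_eq_exp (h.order e (mem_D10.2 he)) hz,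
    qc_add_int]

lemma mo_neg (A : M2) (z : ℂ) : mo (-A) z = mo A z := by
  have := mo_smul (k := -1) (by norm_num) A z
  simpa using this

lemma AL.of {e : ℕ} {a b c d : ℤ} (he : e ∣ 10) (ha : (e : ℤ) ∣ a) (hd : (e : ℤ) ∣ d)
    (hc : (10 : ℤ) ∣ c) (h : a * d - b * c = e) : AL e !![a, b; c, d] :=
  ⟨he, by simpa using ha, by simpa using hd, by simpa using hc, by rw [Matrix.det_fin_two_of, h]⟩

lemma mo_translation (k : ℤ) (z : ℂ) : mo !![1, k; 0, 1] z = z + k := by simp [mo, jf]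

/-- Invariance of an eta quotient under `Γ₀(10)`. -/
lemma Adm.invariant {r m : ℕ → ℤ} (h : Adm r m) {A : M2} (hA : AL 1 A) {z : ℂ} (hz : 0 < z.im) :
    etaQ r (mo A z) = etaQ r z := by
  have hr1 : etaQ (fun d => r (star d 1)) = etaQ r := etaQ_congr fun d _ => by rw [star_one]
  -- parabolic elements, conjugated to translations by an Atkin–Lehner matrix
  have par : ∀ (e : ℕ) (P W : M2) (k u : ℤ), u ≠ 0 → P.det ≠ 0 → AL e W →
      P * W = u • (W * !![1, k; 0, 1]) → ∀ z : ℂ, 0 < z.im → etaQ r (mo P z) = etaQ r z := by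
    intro e P W k u hu hP hW hPW z hz
    obtain ⟨χ, -, hχ⟩ := etaQ_mo h.weight hW
    set w := mo W.adjugate z with hw
    have hw0 : 0 < w.im := hW.adjugate.mo_im_pos hz
    have hzw : z = mo W w := (mo_mo_adjugate hW.det_pos hz).symm
    have hTw : 0 < (w + k).im := by simpa using hw0
    have : mo P z = mo W (w + k) := by
      rw [hzw, ← mo_mul _ _ (jf_ne_zero hW.det_ne hw0), hPW, mo_smul hu, mo_mul, mo_translation]
      simp [jf]
    rw [this, hχ _ hTw, h.periodic hW.dvd_ten k hw0, ← hχ _ hw0, ← hzw]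
  -- elliptic elements
  have ell : ∀ (P : M2) (z₀ : ℂ), AL 1 P → 0 < z₀.im → mo P z₀ = z₀ →
      ∀ z : ℂ, 0 < z.im → etaQ r (mo P z) = etaQ r z := by
    intro P z₀ hP hz₀ hfix z hz
    obtain ⟨χ, -, hχ⟩ := etaQ_mo h.weight hP
    rw [hr1] at hχ
    have h1 := hχ z₀ hz₀
    rw [hfix] at h1
    have : χ = 1 := by
      have h2 := etaQ_ne_zero r hz₀
      apply mul_right_cancel₀ h2
      rw [one_mul, ← h1]
    rw [hχ z hz, this, one_mul]
  refine gamma0_induction (fun A => ∀ z : ℂ, 0 < z.im → etaQ r (mo A z) = etaQ r z)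
    ?_ ?_ ?_ ?_ ?_ ?_ ?_ ?_ ?_ A hA z hz
  · intro A g hA hg hS hAg z hz
    have hw := hg.adjugate.mo_im_pos hz
    have h1 := hAg _ hw
    have h2 := hS _ hw
    rw [mo_mul _ _ (jf_ne_zero hg.det_ne hw), mo_mo_adjugate hg.det_pos hz] at h1
    rw [mo_mo_adjugate hg.det_pos hz] at h2
    rw [h1, h2]
  · intro A hA hS z hz
    rw [← mo_neg]; exact hS z hz
  · intro k z hz
    rw [mo_translation, ← hr1]
    exact h.periodic (one_dvd _) k hz
  · exact par 10 _ !![0, -1; 10, 0] (-1) 1 (by norm_num) (by simp)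
      (AL.of (by norm_num) (by norm_num) (by norm_num) (by norm_num) (by norm_num)) (by decide)
  · exact par 10 _ !![0, -1; 10, 0] 1 1 (by norm_num) (by simp)
      (AL.of (by norm_num) (by norm_num) (by norm_num) (by norm_num) (by norm_num)) (by decide)
  · refine ell _ ((3 + I) / 10) (AL.of (by norm_num) (by norm_num) (by norm_num) (by norm_num)
      (by norm_num)) (by simp) ?_
    have : I ^ 2 = -1 := Complex.I_sq
    have hI := Complex.I_ne_zero
    simp [mo, jf]
    field_simp
    linear_combination -this
  · refine ell _ ((-3 + I) / 10) (AL.of (by norm_num) (by norm_num) (by norm_num) (by norm_num)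
      (by norm_num)) (by simp) ?_
    have : I ^ 2 = -1 := Complex.I_sq
    have hI := Complex.I_ne_zero
    simp [mo, jf]
    field_simp
    linear_combination -this
  · exact par 5 _ !![5, 2; 10, 5] 1 (-1) (by norm_num) (by simp)
      (AL.of (by norm_num) (by norm_num) (by norm_num) (by norm_num) (by norm_num)) (by decide)
  · exact par 5 _ !![5, -2; -10, 5] (-1) 1 (by norm_num) (by simp)
      (AL.of (by norm_num) (by norm_num) (by norm_num) (by norm_num) (by norm_num)) (by decide)

end LevelTen

namespace LevelTen

/-! ### Functions on the punctured disc and Liouville's theorem -/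

lemma differentiableAt_lg {q : ℂ} (hq : ‖q‖ < 1) : DifferentiableAt ℂ lg q := by
  obtain ⟨ρ, hρ, hρ1⟩ := exists_between hq
  have hρ0 : 0 ≤ ρ := (norm_nonneg q).trans hρ.le
  have hs : Summable fun k : ℕ => (k : ℝ) * ρ ^ k := by
    have := summable_pow_mul_geometric_of_norm_lt_one 1 (r := ρ)
      (by rwa [Real.norm_of_nonneg hρ0])
    simpa using this
  have : DifferentiableOn ℂ lg (Metric.ball 0 ρ) := by
    refine differentiableOn_tsum_of_summable_norm hs (fun k => by fun_prop) Metric.isOpen_ball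
      fun k w hw => ?_
    rw [norm_mul, norm_pow]
    have hw' : ‖w‖ ≤ ρ := by simpa using (mem_ball_zero_iff.1 hw).le
    gcongr
    exact norm_sg_div_le k
  exact this.differentiableAt (Metric.isOpen_ball.mem_nhds (by simpa using hρ))

lemma lg_zero : lg 0 = 0 := by
  rw [lg, tsum_eq_single 0]
  · simp
  · intro k hk; simp [hk]

/-- Removable singularity at the cusp for periodic functions on the upper half-plane. -/
lemma exists_disc_function {f : ℂ → ℂ} (hf : ∀ z : ℂ, 0 < z.im → DifferentiableAt ℂ f z)
    (hper : ∀ z : ℂ, 0 < z.im → f (z + 1) = f z) {C Y : ℝ}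
    (hbd : ∀ z : ℂ, 0 < z.im → Y < z.im → ‖f z‖ ≤ C) :
    ∃ F : ℂ → ℂ, (∀ q : ℂ, ‖q‖ < 1 → DifferentiableAt ℂ F q) ∧
      ∀ z : ℂ, 0 < z.im → f z = F (qc z) := by
  classical
  set g : ℂ → ℂ := fun z => if 0 < z.im then f z else 0 with hg
  have hgp : Function.Periodic g ((1 : ℝ) : ℂ) := by
    intro z
    by_cases hz : 0 < z.im
    · simp [hg, hz, hper z hz]
    · simp [hg, hz]
  have hgd : ∀ z : ℂ, 0 < z.im → DifferentiableAt ℂ g z := fun z hz => by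
    refine (hf z hz).congr_of_eventuallyEq ?_
    filter_upwards [UH_mem_nhds hz] with w hw
    exact if_pos hw
  have hq : ∀ z, Function.Periodic.qParam 1 z = qc z := fun z => by
    simp [Function.Periodic.qParam, qc]
  refine ⟨Function.Periodic.cuspFunction 1 g, fun q hq1 => ?_, fun z hz => ?_⟩
  · by_cases h0 : q = 0
    · subst h0
      refine Function.Periodic.differentiableAt_cuspFunction_zero one_pos hgp ?_ ?_
      · rw [Filter.eventually_comap]
        filter_upwards [Filter.eventually_gt_atTop 0] with y hy z hz
        exact hgd z (hz ▸ hy)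
      · refine Asymptotics.IsBigO.of_bound C ?_
        rw [Filter.eventually_comap]
        filter_upwards [Filter.eventually_gt_atTop 0, Filter.eventually_gt_atTop Y] with y hy hy' z hz
        subst hz
        simpa [hg, hy] using hbd z hy hy'
    · obtain ⟨z, rfl⟩ := exists_qc_eq h0
      rw [← hq]
      exact Function.Periodic.differentiableAt_cuspFunction one_ne_zero hgp
        (hgd z (im_pos_of_norm_qc_lt_one hq1))
  · rw [← hq, Function.Periodic.eq_cuspFunction one_ne_zero hgp]
    simp [hg, hz]

/-- Representatives of the four Atkin–Lehner types. -/
def W (e : ℕ) : M2 :=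
  if e = 2 then !![2, 1; 10, 6] else if e = 5 then !![5, 2; 10, 5]
  else if e = 10 then !![0, -1; 10, 0] else 1

lemma W_one : W 1 = 1 := by simp [W]

lemma AL_W {e : ℕ} (he : e ∣ 10) : AL e (W e) := by
  rcases dvd_ten_cases he with rfl | rfl | rfl | rfl
  · rw [W_one]; exact AL.one
  all_goals
    exact AL.of (by norm_num) (by norm_num) (by norm_num) (by norm_num) (by norm_num)

lemma star_self {e : ℕ} (he : e ∣ 10) : star e e = 1 := by
  rcases dvd_ten_cases he with rfl | rfl | rfl | rfl <;> decide

/-- Two Atkin–Lehner matrices of the same type differ by an element of `Γ₀(10)`. -/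
lemma AL.factor {e : ℕ} {A B : M2} (hA : AL e A) (hB : AL e B) :
    ∃ C : M2, AL 1 C ∧ ∀ z : ℂ, 0 < z.im → mo A z = mo C (mo B z) := by
  obtain ⟨C, hC, hC'⟩ := hA.mo_mul hB.adjugate
  rw [star_self hA.dvd_ten] at hC
  refine ⟨C, hC, fun z hz => ?_⟩
  rw [← hC' _ (hB.mo_im_pos hz), mo_adjugate hB.det_pos hz]

/-- Invariance under `Γ₀(10)`. -/
def Inv (g : ℂ → ℂ) : Prop := ∀ A, AL 1 A → ∀ z : ℂ, 0 < z.im → g (mo A z) = g z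

/-- Boundedness of `g ∘ W_e` near `i∞`. -/
def BddAt (g : ℂ → ℂ) (e : ℕ) : Prop :=
  ∃ C Y : ℝ, ∀ z : ℂ, 0 < z.im → Y < z.im → ‖g (mo (W e) z)‖ ≤ C

lemma Inv.of_AL {g : ℂ → ℂ} (hg : Inv g) {e : ℕ} {A : M2} (hA : AL e A) {z : ℂ} (hz : 0 < z.im) :
    g (mo A z) = g (mo (W e) z) := by
  have hW := AL_W hA.dvd_ten
  obtain ⟨C, hC, h⟩ := hA.factor hW
  rw [h z hz, hg C hC _ (hW.mo_im_pos hz)]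

lemma AL.mul_translation {e : ℕ} {A : M2} (hA : AL e A) : 
    ∃ B, AL e B ∧ ∀ z : ℂ, 0 < z.im → mo A (z + 1) = mo B z := by
  have hT : AL 1 !![1, 1; 0, 1] :=
    AL.of (by norm_num) (by norm_num) (by norm_num) (by norm_num) (by norm_num)
  obtain ⟨B, hB, h⟩ := hA.mo_mul hT
  rw [star_one] at hB
  refine ⟨B, hB, fun z hz => ?_⟩
  rw [← h z hz, mo_translation]; simp

lemma Inv.periodic {g : ℂ → ℂ} (hg : Inv g) {e : ℕ} (he : e ∣ 10) {z : ℂ} (hz : 0 < z.im) :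
    g (mo (W e) (z + 1)) = g (mo (W e) z) := by
  obtain ⟨B, hB, h⟩ := (AL_W he).mul_translation
  rw [h z hz, hg.of_AL hB hz]

lemma norm_qc_le {z : ℂ} {y : ℝ} (h : y ≤ z.im) : ‖qc z‖ ≤ Real.exp (-(2 * Real.pi * y)) := by
  rw [norm_qc]; gcongr

/-- Liouville's theorem on the compactification of `Γ₀(10) \ ℍ`. -/
theorem liouville {g : ℂ → ℂ} (hd : ∀ z : ℂ, 0 < z.im → DifferentiableAt ℂ g z) (hg : Inv g)
    (hb : ∀ e ∈ D10, BddAt g e) {z : ℂ} (hz : 0 < z.im) : g z = g I := by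
  have hF : ∀ e ∈ D10, ∃ F : ℂ → ℂ, (∀ q : ℂ, ‖q‖ < 1 → DifferentiableAt ℂ F q) ∧
      ∀ z : ℂ, 0 < z.im → g (mo (W e) z) = F (qc z) := fun e he => by
    obtain ⟨C, Y, h⟩ := hb e he
    have hW := AL_W (mem_D10.1 he)
    exact exists_disc_function (f := fun z => g (mo (W e) z))
      (fun z hz => (hd _ (hW.mo_im_pos hz)).comp z (differentiableAt_mo hW.det_ne hz))
      (fun z hz => hg.periodic (mem_D10.1 he) hz) h
  choose! F hFd hFg using hF
  set ρ := Real.exp (-(2 * Real.pi * (1 / 20))) with hρ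
  have hρ1 : ρ < 1 := by rw [hρ, Real.exp_lt_one_iff]; linarith [Real.pi_pos]
  have hρ0 : 0 < ρ := Real.exp_pos _
  have hmax : ∀ e ∈ D10, ∃ q : ℂ, ‖q‖ ≤ ρ ∧ ∀ q' : ℂ, ‖q'‖ ≤ ρ → ‖F e q'‖ ≤ ‖F e q‖ := by
    intro e he
    obtain ⟨q, hq, hmax⟩ := (isCompact_closedBall (0 : ℂ) ρ).exists_isMaxOn
      (f := fun q => ‖F e q‖) ⟨0, by simp [hρ0.le]⟩ (fun q hq => ((hFd e he q
        ((mem_closedBall_zero_iff.1 hq).trans_lt hρ1)).continuousAt.norm).continuousWithinAt)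
    exact ⟨q, by simpa using hq, fun q' hq' => hmax (by simpa using hq')⟩
  choose! q hq hqmax using hmax
  obtain ⟨e, he, hemax⟩ := D10.exists_max_image (fun e => ‖F e (q e)‖) ⟨1, by simp⟩
  have hbound : ∀ z : ℂ, 0 < z.im → ‖g z‖ ≤ ‖F e (q e)‖ := by
    intro z hz
    obtain ⟨f, A, hA, him⟩ := exists_AL_im_ge hz
    have hf := mem_D10.2 hA.dvd_ten
    have hw := hA.mo_im_pos hz
    have : g z = F f (qc (mo A z)) := by
      rw [← hFg f hf _ hw, ← hg.of_AL hA.adjugate hw, mo_adjugate hA.det_pos hz]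
    rw [this]
    exact (hqmax f hf _ (norm_qc_le him)).trans (hemax f hf)
  have hball : ∀ q' : ℂ, ‖q'‖ < 1 → ‖F e q'‖ ≤ ‖F e (q e)‖ := by
    intro q' hq'
    by_cases h0 : q' = 0
    · exact hqmax e he _ (by simp [h0, hρ0.le])
    · obtain ⟨z, rfl⟩ := exists_qc_eq h0
      have hz := im_pos_of_norm_qc_lt_one hq'
      rw [← hFg e he z hz]
      exact hbound _ ((AL_W (mem_D10.1 he)).mo_im_pos hz)
  have hconst : ∀ q' : ℂ, ‖q'‖ < 1 → F e q' = F e (q e) := by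
    intro q' hq'
    refine Complex.eqOn_of_isPreconnected_of_isMaxOn_norm (U := Metric.ball 0 1) (c := q e)
      (convex_ball _ _).isPreconnected Metric.isOpen_ball ?_ (by simpa using (hq e he).trans_lt hρ1)
      ?_ (by simpa using hq')
    · exact fun w hw => (hFd e he w (by simpa using hw)).differentiableWithinAt
    · exact fun w hw => hball w (by simpa using hw)
  have hgc : ∀ z : ℂ, 0 < z.im → g z = F e (q e) := by
    intro z hz
    have hW := AL_W (mem_D10.1 he)
    have hw := hW.adjugate.mo_im_pos hz
    rw [← hconst _ (norm_qc_lt_one hw), ← hFg e he _ hw, mo_mo_adjugate hW.det_pos hz]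
  rw [hgc z hz, hgc I (by simp)]

end LevelTen

namespace LevelTen

/-! ### The hauptmoduln as eta quotients -/

/-- The power series factor of an eta quotient. -/
noncomputable def pe (r : ℕ → ℤ) (q : ℂ) : ℂ := exp (-∑ d ∈ D10, r d * lg (q ^ d))

lemma pe_ne_zero (r : ℕ → ℤ) (q : ℂ) : pe r q ≠ 0 := Complex.exp_ne_zero _

lemma pe_zero (r : ℕ → ℤ) : pe r 0 = 1 := by
  rw [pe, Finset.sum_eq_zero, neg_zero, Complex.exp_zero]
  intro d hd
  rw [zero_pow (ne_zero_of_mem_D10 hd), lg_zero, mul_zero]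

lemma norm_pow_lt_one {q : ℂ} (hq : ‖q‖ < 1) {d : ℕ} (hd : d ≠ 0) : ‖q ^ d‖ < 1 := by
  rw [norm_pow]; exact pow_lt_one₀ (norm_nonneg _) hq hd

lemma differentiableAt_pe (r : ℕ → ℤ) {q : ℂ} (hq : ‖q‖ < 1) : DifferentiableAt ℂ (pe r) q := by
  unfold pe
  refine DifferentiableAt.cexp (DifferentiableAt.neg (DifferentiableAt.fun_sum fun d hd => ?_))
  refine DifferentiableAt.const_mul ?_ _
  exact (differentiableAt_lg (norm_pow_lt_one hq (ne_zero_of_mem_D10 hd))).comp q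
    (differentiableAt_id.pow d)

lemma Adm.eq_pe {r m : ℕ → ℤ} (h : Adm r m) {z : ℂ} (hz : 0 < z.im) :
    etaQ r z = qc z ^ m 1 * pe r (qc z) := by
  have := h.order 1 (by decide)
  simp only [star_one] at this
  exact etaQ_eq_exp this hz

lemma Adm.eq_pe_W {r m : ℕ → ℤ} (h : Adm r m) {e : ℕ} (he : e ∈ D10) :
    ∃ χ : ℂ, χ ≠ 0 ∧ ∀ z : ℂ, 0 < z.im →
      etaQ r (mo (W e) z) = χ * (qc z ^ m e * pe (fun d => r (star d e)) (qc z)) := by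
  obtain ⟨χ, -, hχ⟩ := etaQ_mo h.weight (AL_W (mem_D10.1 he))
  refine ⟨χ, ?_, fun z hz => ?_⟩
  · rintro rfl
    have := hχ I (by simp)
    rw [zero_mul] at this
    exact etaQ_ne_zero r ((AL_W (mem_D10.1 he)).mo_im_pos (by simp)) this
  · rw [hχ z hz, etaQ_eq_exp (h.order e he) hz, pe]

lemma exists_im_gt {p : ℂ → Prop} (h : ∀ᶠ q in nhds (0 : ℂ), p q) :
    ∃ Y : ℝ, 0 < Y ∧ ∀ z : ℂ, Y < z.im → p (qc z) := by
  obtain ⟨ε, hε, h⟩ := Metric.eventually_nhds_iff.1 h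
  refine ⟨max 1 (-Real.log ε / (2 * Real.pi)), by positivity, fun z hz => h ?_⟩
  rw [dist_zero_right, norm_qc, ← Real.lt_log_iff_exp_lt hε]
  have := (le_max_right _ _).trans_lt hz
  rw [div_lt_iff₀ (by positivity)] at this
  linarith

/-- A function with four prescribed values on the divisors of `10`. -/
def r4 (a b c d : ℤ) (n : ℕ) : ℤ :=
  if n = 1 then a else if n = 2 then b else if n = 5 then c else if n = 10 then d else 0

/-- Exponents of the eta quotients with divisor `(W_f ∞) - (∞)`. -/
def vexp (f : ℕ) : ℕ → ℤ :=
  if f = 2 then r4 (-1) 1 5 (-5) else if f = 5 then r4 (-2) 4 2 (-4)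
  else if f = 10 then r4 3 (-1) 1 (-3) else r4 0 0 0 0

/-- Orders of vanishing of the eta quotients at the cusps. -/
def vord (f e : ℕ) : ℤ := if f = 1 then 0 else if e = 1 then -1 else if e = f then 1 else 0

lemma adm_vexp {f : ℕ} (hf : f ∣ 10) : Adm (vexp f) (vord f) := by
  rcases dvd_ten_cases hf with rfl | rfl | rfl | rfl <;> exact ⟨by decide, by decide⟩

/-- The eta quotients with divisor `(W_f ∞) - (∞)`. -/
noncomputable def V (f : ℕ) : ℂ → ℂ := etaQ (vexp f)

lemma V_ne_zero (f : ℕ) {z : ℂ} (hz : 0 < z.im) : V f z ≠ 0 := etaQ_ne_zero _ hz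

lemma differentiableAt_V (f : ℕ) {z : ℂ} (hz : 0 < z.im) : DifferentiableAt ℂ (V f) z :=
  differentiableAt_etaQ _ hz

lemma inv_V {f : ℕ} (hf : f ∣ 10) : Inv (V f) := fun _ hA _ hz => (adm_vexp hf).invariant hA hz

lemma V_one (z : ℂ) : V 1 z = 1 := by
  rw [V, etaQ, D10_eq]; simp [vexp, r4]

lemma V_eq_pe {f : ℕ} (hf : f ∣ 10) (hf1 : f ≠ 1) {z : ℂ} (hz : 0 < z.im) :
    V f z = (qc z)⁻¹ * pe (vexp f) (qc z) := by
  rw [V, (adm_vexp hf).eq_pe hz]; simp [vord, hf1]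

/-- The hauptmodul of `Γ₀(10)`. -/
noncomputable def jj (z : ℂ) : ℂ := V 2 z - 1

lemma jn_ten (z : ℂ) : jn 10 z = jj z := by
  simp [jn, jj, V, etaQ, D10_eq, vexp, r4]
  rw [div_eq_mul_inv, mul_inv]
  ring

lemma inv_jj : Inv jj := fun A hA z hz => by rw [jj, jj, inv_V (by norm_num) A hA z hz]

lemma differentiableAt_jj {z : ℂ} (hz : 0 < z.im) : DifferentiableAt ℂ jj z :=
  (differentiableAt_V 2 hz).sub_const 1

lemma V_sub_bddAt {f : ℕ} (hf : f ∣ 10) (hf1 : f ≠ 1) {e : ℕ} (he : e ∈ D10) :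
    BddAt (fun z => V f z - V 2 z) e := by
  by_cases he1 : e = 1
  · subst he1
    have hd : DifferentiableAt ℂ (fun q => pe (vexp f) q - pe (vexp 2) q) 0 :=
      (differentiableAt_pe _ (by simp)).sub (differentiableAt_pe _ (by simp))
    have hO := hd.isBigO_sub
    obtain ⟨C, hC⟩ := hO.bound
    obtain ⟨Y, -, hY⟩ := exists_im_gt hC
    refine ⟨C, Y, fun z hz hzY => ?_⟩
    have h := hY z hzY
    simp only [pe_zero, sub_self, sub_zero] at h
    simp only [W_one, mo_one]
    rw [V_eq_pe hf hf1 hz, V_eq_pe (by norm_num) (by norm_num) hz, ← mul_sub,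
      norm_mul, norm_inv, inv_mul_le_iff₀ (norm_pos_iff.2 (qc_ne_zero z))]
    linarith
  · have key : ∀ g : ℕ, g ∣ 10 → ∃ C Y : ℝ, 0 < Y ∧ ∀ z : ℂ, Y < z.im → ‖V g (mo (W e) z)‖ ≤ C := by
      intro g hg
      obtain ⟨χ, -, hχ⟩ := (adm_vexp hg).eq_pe_W he
      have hc : ContinuousAt (fun q => ‖pe (fun d => vexp g (star d e)) q‖) 0 :=
        (differentiableAt_pe _ (by simp)).continuousAt.norm
      obtain ⟨Y, hY0, hY⟩ := exists_im_gt (hc.eventually (eventually_lt_nhds (b := 2)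
        (by simp only [pe_zero]; norm_num)))
      refine ⟨‖χ‖ * (1 * 2), Y, hY0, fun z hz => ?_⟩
      rw [V, hχ z (hY0.trans hz), norm_mul, norm_mul]
      gcongr
      · have hm : 0 ≤ vord g e := by unfold vord; split_ifs <;> norm_num
        obtain ⟨n, hn⟩ := Int.eq_ofNat_of_zero_le hm
        rw [hn, norm_zpow]
        simpa using pow_le_one₀ (norm_nonneg _) (norm_qc_lt_one (hY0.trans hz)).le
      · exact (hY z hz).le
    obtain ⟨C, Y, hY0, h⟩ := key f hf
    obtain ⟨C', Y', hY0', h'⟩ := key 2 (by norm_num)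
    refine ⟨C + C', max Y Y', fun z hz hzY => ?_⟩
    exact (norm_sub_le _ _).trans (add_le_add (h z ((le_max_left _ _).trans_lt hzY))
      (h' z ((le_max_right _ _).trans_lt hzY)))

/-- The constants `V f - j`. -/
noncomputable def kc (f : ℕ) : ℂ := V f I - jj I

lemma V_eq {f : ℕ} (hf : f ∣ 10) (hf1 : f ≠ 1) {z : ℂ} (hz : 0 < z.im) : V f z = jj z + kc f := by
  have := liouville (g := fun z => V f z - V 2 z)
    (fun z hz => (differentiableAt_V f hz).sub (differentiableAt_V 2 hz))
    (fun A hA z hz => by simp only [inv_V hf A hA z hz, inv_V (show 2 ∣ 10 by norm_num) A hA z hz])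
    (fun e he => V_sub_bddAt hf hf1 he) hz
  rw [kc, jj, jj]
  linear_combination this

lemma V_W {f : ℕ} (hf : f ∣ 10) (hf1 : f ≠ 1) :
    ∃ β : ℂ, β ≠ 0 ∧ ∀ z : ℂ, 0 < z.im → V f (mo (W f) z) = β / V f z := by
  obtain ⟨χ, h0, hχ⟩ := (adm_vexp hf).eq_pe_W (mem_D10.2 hf)
  refine ⟨χ, h0, fun z hz => ?_⟩
  rw [V_eq_pe hf hf1 hz, V, hχ z hz, div_eq_mul_inv, mul_inv, inv_inv, pe, pe, ← Complex.exp_neg,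
    ← Finset.sum_neg_distrib, ← Finset.sum_neg_distrib, vord, if_neg hf1, if_neg hf1, if_pos rfl, zpow_one]
  congr 3
  rw [← Finset.sum_neg_distrib]
  refine Finset.sum_congr rfl fun d hd => ?_
  have : vexp f (star d f) = - vexp f d := by
    rcases dvd_ten_cases hf with rfl | rfl | rfl | rfl <;> first | exact (hf1 rfl).elim | skip
    all_goals
      rcases dvd_ten_cases (mem_D10.1 hd) with rfl | rfl | rfl | rfl <;> decide
  rw [this]; push_cast; ring

/-- The hauptmodul translated by an Atkin–Lehner matrix. -/
noncomputable def jE (e : ℕ) (z : ℂ) : ℂ := jj (mo (W e) z)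

lemma jE_one (z : ℂ) : jE 1 z = jj z := by rw [jE, W_one, mo_one]

lemma jE_mo {e f : ℕ} {A : M2} (he : e ∣ 10) (hA : AL f A) {z : ℂ} (hz : 0 < z.im) :
    jE e (mo A z) = jE (star e f) z := by
  obtain ⟨C, hC, h⟩ := (AL_W he).mo_mul hA
  rw [jE, h z hz, inv_jj.of_AL hC hz, jE]

lemma differentiableAt_jE {e : ℕ} (he : e ∣ 10) {z : ℂ} (hz : 0 < z.im) :
    DifferentiableAt ℂ (jE e) z :=
  (differentiableAt_jj ((AL_W he).mo_im_pos hz)).comp z (differentiableAt_mo (AL_W he).det_ne hz)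

/-- The constants `β_f` with `V f ∘ W_f = β_f / V f`. -/
lemma exists_beta : ∃ β : ℕ → ℂ, ∀ f ∈ D10, f ≠ 1 → β f ≠ 0 ∧ ∀ z : ℂ, 0 < z.im →
    V f (mo (W f) z) = β f / V f z ∧ jE f z = β f / V f z - kc f := by
  have : ∀ f ∈ D10, f ≠ 1 → ∃ β : ℂ, β ≠ 0 ∧ ∀ z : ℂ, 0 < z.im → V f (mo (W f) z) = β / V f z :=
    fun f hf hf1 => V_W (mem_D10.1 hf) hf1
  choose! β hβ using this
  refine ⟨β, fun f hf hf1 => ⟨(hβ f hf hf1).1, fun z hz => ⟨(hβ f hf hf1).2 z hz, ?_⟩⟩⟩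
  have hfd := mem_D10.1 hf
  rw [← (hβ f hf hf1).2 z hz, V_eq hfd hf1 ((AL_W hfd).mo_im_pos hz), jE]
  ring

end LevelTen

namespace LevelTen

/-! ### The hauptmodul of the Fricke group -/

/-- Exponents of the eta quotient `t`. -/
def texp : ℕ → ℤ := r4 4 (-4) 4 (-4)

lemma adm_texp : Adm texp (r4 (-1) 1 (-1) 1) := ⟨by decide, by decide⟩

/-- The hauptmodul of the Fricke group. -/
noncomputable def jS (z : ℂ) : ℂ := etaQ texp z + 4 + 16 / etaQ texp z

lemma jnStar_ten (z : ℂ) : jnStar 10 z = jS z := by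
  have h : etaQ texp z =
      (dedekindEta z * dedekindEta (5 * z) / (dedekindEta (2 * z) * dedekindEta (10 * z))) ^ 4 := by
    simp [etaQ, D10_eq, texp, r4]
    rw [div_eq_mul_inv, mul_pow, inv_pow, mul_pow, mul_pow, mul_inv]
    ring
  simp only [jnStar]
  norm_num
  rw [jS, h]
  simp only [div_pow]
  rw [div_div_eq_mul_div]
  norm_num
  ring

lemma differentiableAt_jS {z : ℂ} (hz : 0 < z.im) : DifferentiableAt ℂ jS z :=
  ((differentiableAt_etaQ _ hz).add_const 4).add
    ((differentiableAt_const _).div (differentiableAt_etaQ _ hz) (etaQ_ne_zero _ hz))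

lemma conj_lg (q : ℂ) : lg (starRingEnd ℂ q) = starRingEnd ℂ (lg q) := by
  rw [lg, lg, Complex.conj_tsum]
  refine tsum_congr fun k => ?_
  simp [sg]

/-- Invariance under the Fricke group. -/
def InvS (g : ℂ → ℂ) : Prop := ∀ e A, AL e A → ∀ z : ℂ, 0 < z.im → g (mo A z) = g z

lemma InvS.inv {g : ℂ → ℂ} (h : InvS g) : Inv g := fun A hA => h 1 A hA

lemma inv_etaQ_texp : Inv (etaQ texp) := fun _ hA _ hz => adm_texp.invariant hA hz

lemma etaQ_texp_five {A : M2} (hA : AL 5 A) {z : ℂ} (hz : 0 < z.im) :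
    etaQ texp (mo A z) = etaQ texp z := by
  have hB : AL 5 !![5, -3; 10, -5] :=
    AL.of (by norm_num) (by norm_num) (by norm_num) (by norm_num) (by norm_num)
  obtain ⟨χ, -, hχ⟩ := etaQ_mo adm_texp.weight hB
  have hperm : etaQ (fun d => texp (star d 5)) = etaQ texp := etaQ_congr (by decide)
  rw [hperm] at hχ
  have h0 : 0 < ((5 + Real.sqrt 5 * I) / 10 : ℂ).im := by simp
  have hfix : mo !![5, -3; 10, -5] ((5 + Real.sqrt 5 * I) / 10 : ℂ) = (5 + Real.sqrt 5 * I) / 10 := by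
    have hs : ((Real.sqrt 5 : ℝ) : ℂ) ^ 2 = 5 := by
      rw [← Complex.ofReal_pow, Real.sq_sqrt (by norm_num)]; norm_num
    have hs0 : ((Real.sqrt 5 : ℝ) : ℂ) ≠ 0 := by
      intro h; rw [h] at hs; norm_num at hs
    have : I ^ 2 = -1 := Complex.I_sq
    have hI := Complex.I_ne_zero
    simp [mo, jf]
    field_simp
    linear_combination (-5 : ℂ) * this - I ^ 2 * hs
  have h1 := hχ _ h0
  rw [hfix] at h1
  have hχ1 : χ = 1 := by
    apply mul_right_cancel₀ (etaQ_ne_zero texp h0)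
    rw [one_mul, ← h1]
  rw [inv_etaQ_texp.of_AL hA hz, ← inv_etaQ_texp.of_AL hB hz, hχ z hz, hχ1, one_mul]

lemma etaQ_texp_neg {z : ℂ} : etaQ (fun d => texp (star d 10)) z = (etaQ texp z)⁻¹ := by
  rw [etaQ, etaQ, ← Finset.prod_inv_distrib]
  refine Finset.prod_congr rfl fun d hd => ?_
  rw [← _root_.zpow_neg]
  congr 1
  rcases dvd_ten_cases (mem_D10.1 hd) with rfl | rfl | rfl | rfl <;> decide

lemma etaQ_texp_ten {A : M2} (hA : AL 10 A) {z : ℂ} (hz : 0 < z.im) :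
    etaQ texp (mo A z) = 16 / etaQ texp z := by
  have hW : AL 10 (W 10) := AL_W (by norm_num)
  obtain ⟨χ, hχ24, hχ⟩ := etaQ_mo adm_texp.weight hW
  have hnorm : ‖χ‖ = 16 := by
    have h24 : ‖χ‖ ^ 24 = 16 ^ 24 := by
      rw [← norm_pow, hχ24, D10_eq]
      simp [texp, r4]
      norm_num
    exact (pow_left_inj₀ (norm_nonneg _) (by norm_num) (by norm_num)).1 h24
  set z₀ : ℂ := ((Real.sqrt 10)⁻¹ : ℝ) * I with hz₀
  have h0 : 0 < z₀.im := by simp [hz₀]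
  have hfix : mo (W 10) z₀ = z₀ := by
    have hs : ((Real.sqrt 10 : ℝ) : ℂ) ^ 2 = 10 := by
      rw [← Complex.ofReal_pow, Real.sq_sqrt (by norm_num)]; norm_num
    have hs0 : ((Real.sqrt 10 : ℝ) : ℂ) ≠ 0 := by
      intro h; rw [h] at hs; norm_num at hs
    have : I ^ 2 = -1 := Complex.I_sq
    have hI := Complex.I_ne_zero
    simp [mo, jf, W, hz₀]
    field_simp
    rw [this]; linear_combination -hs
  have hreal : starRingEnd ℂ (etaQ texp z₀) = etaQ texp z₀ := by
    have hq : starRingEnd ℂ (qc z₀) = qc z₀ := by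
      rw [qc, ← Complex.exp_conj]
      congr 1
      simp [hz₀, Complex.conj_ofNat]
    rw [adm_texp.eq_pe h0, pe]
    rw [map_mul, map_zpow₀, hq, ← Complex.exp_conj]
    congr 2
    rw [map_neg, map_sum]
    congr 1
    refine Finset.sum_congr rfl fun d _ => ?_
    rw [map_mul, ← conj_lg, map_pow, hq]
    simp
  have hsq : χ = etaQ texp z₀ ^ 2 := by
    have := hχ z₀ h0
    rw [hfix, etaQ_texp_neg, eq_mul_inv_iff_mul_eq₀ (etaQ_ne_zero _ h0)] at this
    rw [← this, sq]
  have h16 : χ = 16 := by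
    have : χ = (‖etaQ texp z₀‖ ^ 2 : ℝ) := by
      rw [hsq, sq]
      nth_rewrite 2 [← hreal]
      rw [Complex.mul_conj, Complex.normSq_eq_norm_sq]
    rw [this]
    rw [this, Complex.norm_real, Real.norm_of_nonneg (by positivity)] at hnorm
    rw [hnorm]; norm_num
  rw [inv_etaQ_texp.of_AL hA hz, hχ z hz, h16, etaQ_texp_neg, div_eq_mul_inv]

lemma invS_jS : InvS jS := by
  have h5 : ∀ A, AL 5 A → ∀ z : ℂ, 0 < z.im → jS (mo A z) = jS z := fun A hA z hz => by
    rw [jS, jS, etaQ_texp_five hA hz]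
  have h10 : ∀ A, AL 10 A → ∀ z : ℂ, 0 < z.im → jS (mo A z) = jS z := fun A hA z hz => by
    have := etaQ_ne_zero texp hz
    rw [jS, jS, etaQ_texp_ten hA hz, div_div_eq_mul_div]
    field_simp
    ring
  intro e A hA z hz
  rcases dvd_ten_cases hA.dvd_ten with rfl | rfl | rfl | rfl
  · rw [jS, jS, inv_etaQ_texp A hA z hz]
  · have hW5 := AL_W (show 5 ∣ 10 by norm_num)
    obtain ⟨C, hC, h⟩ := hA.mo_mul hW5.adjugate
    have hw := hW5.mo_im_pos hz
    have h1 := h _ hw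
    rw [mo_adjugate hW5.det_pos hz] at h1
    rw [h1, h10 C hC _ hw, h5 _ hW5 z hz]
  · exact h5 A hA z hz
  · exact h10 A hA z hz

/-- The disc function of `q j*`. -/
noncomputable def jSd (q : ℂ) : ℂ := pe texp q + 4 * q + 16 * q ^ 2 / pe texp q

lemma jS_eq {z : ℂ} (hz : 0 < z.im) : jS z = (qc z)⁻¹ * jSd (qc z) := by
  have := qc_ne_zero z
  have h2 := pe_ne_zero texp (qc z)
  rw [jS, jSd, adm_texp.eq_pe hz]
  simp only [r4]
  norm_num
  field_simp

lemma jSd_zero : jSd 0 = 1 := by simp [jSd, pe_zero]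

lemma differentiableAt_jSd {q : ℂ} (hq : ‖q‖ < 1) : DifferentiableAt ℂ jSd q := by
  have := differentiableAt_pe texp hq
  unfold jSd
  exact (this.add (by fun_prop)).add (DifferentiableAt.div (by fun_prop) this (pe_ne_zero _ _))

lemma InvS.bddAt {g : ℂ → ℂ} (hg : InvS g) {C Y : ℝ}
    (h : ∀ z : ℂ, 0 < z.im → Y < z.im → ‖g z‖ ≤ C) {e : ℕ} (he : e ∈ D10) : BddAt g e :=
  ⟨C, Y, fun z hz hY => by rw [hg e _ (AL_W (mem_D10.1 he)) z hz]; exact h z hz hY⟩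

/-- A modular function for the Fricke group with poles only at the cusp is a polynomial in the
hauptmodul. -/
theorem exists_polynomial (N : ℕ) : ∀ {g : ℂ → ℂ},
    (∀ z : ℂ, 0 < z.im → DifferentiableAt ℂ g z) → InvS g →
    (∃ C Y : ℝ, ∀ z : ℂ, 0 < z.im → Y < z.im → ‖qc z ^ N * g z‖ ≤ C) →
    ∃ Q : Polynomial ℂ, ∀ z : ℂ, 0 < z.im → g z = Q.eval (jS z) := by
  induction N with
  | zero =>
    rintro g hd hg ⟨C, Y, h⟩
    refine ⟨Polynomial.C (g I), fun z hz => ?_⟩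
    rw [Polynomial.eval_C]
    exact liouville hd hg.inv (fun e he => hg.bddAt (C := C) (Y := Y)
      (fun z hz hY => by simpa using h z hz hY) he) hz
  | succ N ih =>
    rintro g hd hg ⟨C, Y, h⟩
    obtain ⟨F, hF, hgF⟩ := exists_disc_function (f := fun z => qc z ^ (N + 1) * g z)
      (fun z hz => ((differentiable_qc z).pow _).mul (hd z hz))
      (fun z hz => by
        have := hg.inv.periodic (one_dvd 10) hz
        rw [W_one, mo_one, mo_one] at this
        have h1 := qc_add_int z 1
        rw [Int.cast_one] at h1
        simp only [this, h1]) h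
    have hdG : DifferentiableAt ℂ (fun q => F q - F 0 * jSd q ^ (N + 1)) 0 :=
      (hF 0 (by simp)).sub (((differentiableAt_jSd (by simp)).pow _).const_mul _)
    obtain ⟨C', hC'⟩ := hdG.isBigO_sub.bound
    obtain ⟨Y', -, hY'⟩ := exists_im_gt hC'
    obtain ⟨Q, hQ⟩ := ih (g := fun z => g z - F 0 * jS z ^ (N + 1))
      (fun z hz => (hd z hz).sub (((differentiableAt_jS hz).pow _).const_mul _))
      (fun e A hA z hz => by simp only [hg e A hA z hz, invS_jS e A hA z hz])
      ⟨C', Y', fun z hz hY => by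
        have h1 := hY' z hY
        have hq := qc_ne_zero z
        simp only [jSd_zero, one_pow, mul_one, sub_self, sub_zero] at h1
        rw [← hgF z hz] at h1
        have h2 : qc z ^ (N + 1) * g z - F 0 * jSd (qc z) ^ (N + 1) =
            qc z * (qc z ^ N * (g z - F 0 * jS z ^ (N + 1))) := by
          rw [jS_eq hz, mul_pow, inv_pow]
          field_simp
          ring
        rw [h2, norm_mul, mul_comm C'] at h1
        exact le_of_mul_le_mul_left h1 (norm_pos_iff.2 hq)⟩
    refine ⟨Q + Polynomial.C (F 0) * Polynomial.X ^ (N + 1), fun z hz => ?_⟩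
    have := hQ z hz
    simp only [Polynomial.eval_add, Polynomial.eval_mul, Polynomial.eval_C, Polynomial.eval_pow,
      Polynomial.eval_X, ← this]
    ring

end LevelTen

namespace LevelTen

/-! ### Proper discontinuity -/

lemma finite_entries_le (N : ℝ) : {A : M2 | ∀ i j, |(A i j : ℝ)| ≤ N}.Finite := by
  have h : (Set.pi Set.univ fun _ : Fin 2 => Set.pi Set.univ fun _ : Fin 2 =>
      Set.Icc (-⌈N⌉) ⌈N⌉).Finite := Set.Finite.pi fun _ => Set.Finite.pi fun _ => Set.finite_Icc _ _
  refine h.subset fun A hA i _ j _ => ?_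
  have h1 := abs_le.1 (hA i j)
  have h2 := Int.le_ceil N
  constructor
  · have : ((-⌈N⌉ : ℤ) : ℝ) ≤ A i j := by push_cast; linarith
    exact_mod_cast this
  · have : (A i j : ℝ) ≤ ((⌈N⌉ : ℤ) : ℝ) := by linarith
    exact_mod_cast this

lemma abs_entries_le {a b : ℤ} {z : ℂ} {y R B : ℝ} (hy : 0 < y) (hzy : y ≤ z.im) (hzR : ‖z‖ ≤ R)
    (h : ‖(a : ℂ) * z + b‖ ≤ B) : |(a : ℝ)| ≤ B / y ∧ |(b : ℝ)| ≤ B + B / y * R := by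
  have h1 : |(a : ℝ)| ≤ B / y := by
    rw [le_div_iff₀ hy]
    have h2 := (Complex.abs_im_le_norm _).trans h
    simp only [Complex.add_im, Complex.mul_im, Complex.intCast_re, Complex.intCast_im, zero_mul,
      add_zero, abs_mul] at h2
    have : y ≤ |z.im| := hzy.trans (le_abs_self _)
    nlinarith [abs_nonneg (a : ℝ)]
  refine ⟨h1, ?_⟩
  have : ‖(b : ℂ)‖ ≤ B + B / y * R := by
    calc ‖(b : ℂ)‖ = ‖(a * z + b) - a * z‖ := by ring_nf
      _ ≤ ‖(a : ℂ) * z + b‖ + ‖(a : ℂ) * z‖ := norm_sub_le _ _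
      _ ≤ B + B / y * R := by
        rw [norm_mul, Complex.norm_intCast]
        gcongr
        exact (abs_nonneg _).trans h1
  rwa [Complex.norm_intCast] at this

/-- Only finitely many integral matrices of bounded determinant carry a point of a compact set to
that set. -/
lemma finite_carry (N : ℤ) (R : ℝ) {y : ℝ} (hy : 0 < y) :
    {A : M2 | 0 < A.det ∧ A.det ≤ N ∧ ∃ z : ℂ, ‖z‖ ≤ R ∧ y ≤ z.im ∧ ‖mo A z‖ ≤ R ∧
      y ≤ (mo A z).im}.Finite := by
  set B := Real.sqrt (N * R / y) with hB
  set M := max (max (B / y) (B + B / y * R)) (max (R * B / y) (R * B + R * B / y * R)) with hM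
  refine (finite_entries_le M).subset ?_
  rintro A ⟨hdet, hN, z, hzR, hzy, hR, hyA⟩
  have hz : 0 < z.im := hy.trans_le hzy
  have hj := jf_ne_zero hdet.ne' hz
  have hjB : ‖jf A z‖ ≤ B := by
    apply Real.le_sqrt_of_sq_le
    have h1 := im_mo A z
    rw [Complex.normSq_eq_norm_sq] at h1
    have hp : 0 < ‖jf A z‖ ^ 2 := by positivity
    rw [h1, le_div_iff₀ hp] at hyA
    rw [le_div_iff₀ hy]
    have hzi : z.im ≤ R := ((le_abs_self _).trans (Complex.abs_im_le_norm z)).trans hzR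
    have hN' : (A.det : ℝ) ≤ N := by exact_mod_cast hN
    have hN0 : (0 : ℝ) ≤ N := le_trans (by exact_mod_cast hdet.le) hN'
    calc ‖jf A z‖ ^ 2 * y = y * ‖jf A z‖ ^ 2 := by ring
      _ ≤ A.det * z.im := hyA
      _ ≤ N * R := by gcongr
  have hnum : ‖(A 0 0 : ℂ) * z + A 0 1‖ ≤ R * B := by
    have : (A 0 0 : ℂ) * z + A 0 1 = mo A z * jf A z := by rw [mo, div_mul_cancel₀ _ hj]
    rw [this, norm_mul]
    gcongr
    exact (norm_nonneg _).trans hR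
  have h1 := abs_entries_le hy hzy hzR hjB
  have h2 := abs_entries_le hy hzy hzR hnum
  intro i j
  fin_cases i <;> fin_cases j
  · exact h2.1.trans ((le_max_left _ _).trans (le_max_right _ _))
  · exact h2.2.trans ((le_max_right _ _).trans (le_max_right _ _))
  · exact h1.1.trans ((le_max_left _ _).trans (le_max_left _ _))
  · exact h1.2.trans ((le_max_right _ _).trans (le_max_left _ _))

lemma finite_fixers (N : ℤ) {z : ℂ} (hz : 0 < z.im) :
    {A : M2 | 0 < A.det ∧ A.det ≤ N ∧ mo A z = z}.Finite := by
  refine (finite_carry N ‖z‖ hz).subset ?_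
  rintro A ⟨h1, h2, h3⟩
  exact ⟨h1, h2, z, le_rfl, le_rfl, by rw [h3], by rw [h3]⟩

lemma AL.det_le {e : ℕ} {A : M2} (h : AL e A) : A.det ≤ 10 := by
  rw [h.det_eq]; exact_mod_cast Nat.le_of_dvd (by norm_num) h.dvd_ten

lemma eventually_carry {z₀ w₀ : ℂ} (hz : 0 < z₀.im) (hw : 0 < w₀.im) :
    ∀ᶠ p in nhds z₀ ×ˢ nhds w₀, ∀ e A, AL e A → mo A p.1 = p.2 → mo A z₀ = w₀ := by
  set y := min (z₀.im / 2) (w₀.im / 2) with hy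
  have hy0 : 0 < y := by positivity
  set R := max (‖z₀‖ + 1) (‖w₀‖ + 1) with hR
  set Fs := {A : M2 | 0 < A.det ∧ A.det ≤ 10 ∧ ∃ z : ℂ, ‖z‖ ≤ R ∧ y ≤ z.im ∧ ‖mo A z‖ ≤ R ∧
      y ≤ (mo A z).im} with hFs
  have hfin : Fs.Finite := finite_carry 10 R hy0
  have h1 : ∀ᶠ p in nhds z₀ ×ˢ nhds w₀, ∀ A ∈ Fs, mo A p.1 = p.2 → mo A z₀ = w₀ := by
    rw [Filter.eventually_all_finite hfin]
    intro A hA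
    by_cases h : mo A z₀ = w₀
    · exact Filter.Eventually.of_forall fun _ _ => h
    · have hc : Filter.Tendsto (fun p : ℂ × ℂ => (mo A p.1, p.2)) (nhds z₀ ×ˢ nhds w₀)
          (nhds (mo A z₀) ×ˢ nhds w₀) :=
        Filter.Tendsto.prodMk (((differentiableAt_mo hA.1.ne' hz).continuousAt.tendsto).comp
          Filter.tendsto_fst) Filter.tendsto_snd
      have hne : ∀ᶠ p : ℂ × ℂ in nhds (mo A z₀) ×ˢ nhds w₀, p.1 ≠ p.2 := by
        rw [← nhds_prod_eq]
        exact (isOpen_ne_fun continuous_fst continuous_snd).mem_nhds h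
      filter_upwards [hc.eventually hne] with p hp hp'
      exact (hp hp').elim
  have hz1 : ∀ᶠ z in nhds z₀, ‖z‖ ≤ R ∧ y ≤ z.im := by
    refine (continuous_norm.continuousAt.eventually (eventually_lt_nhds (b := R) ?_)).and
      (Complex.continuous_im.continuousAt.eventually (lt_mem_nhds (a := y) ?_)) |>.mono
        fun z h => ⟨h.1.le, h.2.le⟩
    · exact (lt_add_one _).trans_le (le_max_left _ _)
    · exact (min_le_left _ _).trans_lt (by linarith)
  have hw1 : ∀ᶠ z in nhds w₀, ‖z‖ ≤ R ∧ y ≤ z.im := by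
    refine (continuous_norm.continuousAt.eventually (eventually_lt_nhds (b := R) ?_)).and
      (Complex.continuous_im.continuousAt.eventually (lt_mem_nhds (a := y) ?_)) |>.mono
        fun z h => ⟨h.1.le, h.2.le⟩
    · exact (lt_add_one _).trans_le (le_max_right _ _)
    · exact (min_le_right _ _).trans_lt (by linarith)
  filter_upwards [h1, hz1.prod_inl _, hw1.prod_inr _] with p hp hpz hpw e A hA hAp
  exact hp A ⟨hA.det_pos, hA.det_le, p.1, hpz.1, hpz.2, by rw [hAp]; exact hpw.1,
    by rw [hAp]; exact hpw.2⟩ hAp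

end LevelTen

namespace LevelTen

/-! ### Injectivity of hauptmoduln -/

/-- A function with the behaviour of a hauptmodul of the group consisting of the Atkin–Lehner
matrices whose type satisfies `T`. -/
structure Haupt (T : ℕ → Prop) (f Fd : ℂ → ℂ) (G : ℕ → ℂ → ℂ) : Prop where
  one : T 1
  star : ∀ d e, T d → T e → T (star d e)
  diff : ∀ z : ℂ, 0 < z.im → DifferentiableAt ℂ f z
  inv : ∀ e A, T e → AL e A → ∀ z : ℂ, 0 < z.im → f (mo A z) = f z
  eq : ∀ z : ℂ, 0 < z.im → f z = (qc z)⁻¹ * Fd (qc z)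
  diffd : ∀ q : ℂ, ‖q‖ < 1 → DifferentiableAt ℂ Fd q
  zero : Fd 0 = 1
  cusp : ∀ e, e ∣ 10 → ¬ T e →
    ContinuousAt (G e) 0 ∧ ∀ z : ℂ, 0 < z.im → f (mo (W e) z) = G e (qc z)

/-- Equivalence under the Atkin–Lehner matrices whose type satisfies `T`. -/
def Rel (T : ℕ → Prop) (z w : ℂ) : Prop := ∃ e A, T e ∧ AL e A ∧ mo A z = w

/-- Every point is `Γ₀(10)`-equivalent to a Siegel point seen from one of the cusps. -/
lemma exists_reduced {z : ℂ} (hz : 0 < z.im) : ∃ e z₁, e ∣ 10 ∧ |z₁.re| ≤ 1 ∧ 1 / 20 ≤ z₁.im ∧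
    Rel (· = 1) z (mo (W e) z₁) := by
  obtain ⟨e, A, hA, him⟩ := exists_AL_im_ge hz
  set k : ℤ := -⌊(mo A z).re⌋ with hk
  have hT : AL 1 (!![1, k; 0, 1] : M2) := ⟨by norm_num, by simp, by simp, by simp, by simp [det_fin_two]⟩
  have hTm : ∀ w : ℂ, mo !![1, k; 0, 1] w = w + k := by intro w; simp [mo, jf]
  obtain ⟨C, hC, hCm⟩ := hT.mo_mul hA
  have hs : LevelTen.star 1 e = e := by
    rcases dvd_ten_cases hA.dvd_ten with rfl | rfl | rfl | rfl <;> decide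
  rw [hs] at hC
  have hz1 : mo C z = mo A z + k := by rw [← hCm z hz, hTm]
  have him1 : 1 / 20 ≤ (mo C z).im := by rw [hz1]; simpa using him
  refine ⟨e, mo C z, hC.dvd_ten, ?_, him1, ?_⟩
  · rw [hz1, hk]
    have h1 := Int.floor_le (mo A z).re
    have h2 := Int.lt_floor_add_one (mo A z).re
    rw [abs_le]
    simp only [Complex.add_re, Complex.intCast_re]
    push_cast
    constructor <;> linarith
  · obtain ⟨B, hB, hBm⟩ := (AL_W hC.dvd_ten).factor hC.adjugate
    refine ⟨1, B, rfl, hB, ?_⟩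
    have hp : 0 < (mo C z).im := by linarith
    rw [hBm _ hp, mo_adjugate hC.det_pos hz]

namespace Haupt

variable {T : ℕ → Prop} {f Fd : ℂ → ℂ} {G : ℕ → ℂ → ℂ} (h : Haupt T f Fd G)

include h

omit h in
lemma rel_symm {z w : ℂ} (hz : 0 < z.im) (hzw : Rel T z w) : Rel T w z := by
  obtain ⟨e, A, he, hA, rfl⟩ := hzw
  exact ⟨e, A.adjugate, he, hA.adjugate, mo_adjugate hA.det_pos hz⟩

lemma rel_trans {z w v : ℂ} (hz : 0 < z.im) (hzw : Rel T z w) (hwv : Rel T w v) : Rel T z v := by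
  obtain ⟨e, A, he, hA, rfl⟩ := hzw
  obtain ⟨e', A', he', hA', rfl⟩ := hwv
  obtain ⟨C, hC, hCm⟩ := hA'.mo_mul hA
  exact ⟨_, C, h.star _ _ he' he, hC, (hCm z hz).symm⟩

lemma rel_of_one {z w : ℂ} (hzw : Rel (· = 1) z w) : Rel T z w := by
  obtain ⟨e, A, rfl, hA, rfl⟩ := hzw
  exact ⟨1, A, h.one, hA, rfl⟩

lemma eq_of_rel {z w : ℂ} (hz : 0 < z.im) (hzw : Rel T z w) : f w = f z := by
  obtain ⟨e, A, he, hA, rfl⟩ := hzw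
  exact h.inv e A he hA z hz

omit h in
lemma rel_im_pos {z w : ℂ} (hz : 0 < z.im) (hzw : Rel T z w) : 0 < w.im := by
  obtain ⟨e, A, he, hA, rfl⟩ := hzw
  exact hA.mo_im_pos hz

lemma analyticOnNhd : AnalyticOnNhd ℂ f UH :=
  DifferentiableOn.analyticOnNhd (fun z hz => (h.diff z hz).differentiableWithinAt) isOpen_UH

lemma analyticAt {z : ℂ} (hz : 0 < z.im) : AnalyticAt ℂ f z := h.analyticOnNhd z hz

lemma not_const (c : ℂ) : ¬ ∀ z : ℂ, 0 < z.im → f z = c := by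
  intro hc
  have h1 : ∀ᶠ q in nhdsWithin (0 : ℂ) {0}ᶜ, Fd q = q * c := by
    have : ∀ᶠ q in nhdsWithin (0 : ℂ) {0}ᶜ, ‖q‖ < 1 := by
      refine nhdsWithin_le_nhds ?_
      filter_upwards [Metric.ball_mem_nhds (0 : ℂ) one_pos] with q hq
      simpa using hq
    filter_upwards [this, self_mem_nhdsWithin] with q hq hq0
    obtain ⟨z, rfl⟩ := exists_qc_eq hq0
    have hz := im_pos_of_norm_qc_lt_one hq
    rw [← hc z hz, h.eq z hz, mul_inv_cancel_left₀ (qc_ne_zero z)]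
  have h2 : Filter.Tendsto Fd (nhdsWithin (0 : ℂ) {0}ᶜ) (nhds 1) := by
    rw [← h.zero]
    exact (h.diffd 0 (by simp)).continuousAt.tendsto.mono_left nhdsWithin_le_nhds
  have h3 : Filter.Tendsto (fun q : ℂ => q * c) (nhdsWithin (0 : ℂ) {0}ᶜ) (nhds (0 * c)) :=
    ((continuous_id.mul continuous_const).tendsto 0).mono_left nhdsWithin_le_nhds
  have := tendsto_nhds_unique (h2.congr' h1) h3
  simp at this

lemma nhds_le_map {z : ℂ} (hz : 0 < z.im) : nhds (f z) ≤ Filter.map f (nhds z) := by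
  rcases (h.analyticAt hz).eventually_constant_or_nhds_le_map_nhds with hc | hc
  · refine (h.not_const (f z) fun w hw => ?_).elim
    exact h.analyticOnNhd.eqOn_of_preconnected_of_eventuallyEq analyticOnNhd_const
      isPreconnected_UH hz hc hw
  · exact hc

lemma countable_critical : {z ∈ UH | deriv f z = 0}.Countable := by
  have ha : AnalyticOnNhd ℂ (deriv f) UH := h.analyticOnNhd.deriv
  rcases ha.eqOn_zero_or_eventually_ne_zero_of_preconnected isPreconnected_UH with h0 | h0
  · obtain ⟨c, hc⟩ := isOpen_UH.exists_is_const_of_deriv_eq_zero isPreconnected_UH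
      (fun z hz => (h.diff z hz).differentiableWithinAt) h0
    exact (h.not_const c fun z hz => hc z hz).elim
  · have h1 : ({z | deriv f z ≠ 0}ᶜ ∩ UH).Countable :=
      (HereditarilyLindelofSpace.isLindelof _).countable_of_isDiscrete
        (isDiscrete_of_codiscreteWithin (by simpa using! h0))
    refine h1.mono ?_
    rintro z ⟨hz, hz'⟩
    exact ⟨by simpa using hz', hz⟩

lemma exists_bound (x : ℂ) (hx : ∀ e, e ∣ 10 → ¬ T e → x ≠ G e 0) :
    ∃ Y : ℝ, ∀ᶠ y in nhds x, ∀ e, e ∣ 10 → ∀ z : ℂ, 0 < z.im → Y < z.im → f (mo (W e) z) ≠ y := by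
  have key : ∀ e ∈ D10, ∃ Y : ℝ, ∀ᶠ y in nhds x, ∀ z : ℂ, 0 < z.im → Y < z.im →
      f (mo (W e) z) ≠ y := by
    intro e he
    have he' := mem_D10.1 he
    by_cases hT : T e
    · have h1 : ∀ᶠ q in nhds (0 : ℂ), ‖q‖ * (‖x‖ + 1) < ‖Fd q‖ := by
        have hc : ContinuousAt (fun q => ‖Fd q‖ - ‖q‖ * (‖x‖ + 1)) 0 :=
          ((h.diffd 0 (by simp)).continuousAt.norm).sub (by fun_prop)
        have := hc.eventually (lt_mem_nhds (a := 0) (by simp [h.zero]))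
        filter_upwards [this] with q hq
        linarith
      obtain ⟨Y, -, hY⟩ := exists_im_gt h1
      refine ⟨Y, ?_⟩
      filter_upwards [continuous_norm.continuousAt.eventually
        (eventually_lt_nhds (lt_add_one ‖x‖))] with y hy z hz hzY
      rintro rfl
      rw [h.inv e _ hT (AL_W he') z hz, h.eq z hz, norm_mul, norm_inv] at hy
      have hq : 0 < ‖qc z‖ := norm_pos_iff.2 (qc_ne_zero z)
      rw [inv_mul_lt_iff₀ hq] at hy
      exact absurd (hY z hzY) (not_lt.2 hy.le)
    · obtain ⟨hc, hG⟩ := h.cusp e he' hT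
      have h1 : ∀ᶠ p in nhds (0 : ℂ) ×ˢ nhds x, G e p.1 ≠ p.2 := by
        have hc2 : Filter.Tendsto (fun p : ℂ × ℂ => (G e p.1, p.2)) (nhds (0 : ℂ) ×ˢ nhds x)
            (nhds (G e 0) ×ˢ nhds x) :=
          (hc.tendsto.comp Filter.tendsto_fst).prodMk Filter.tendsto_snd
        rw [← nhds_prod_eq (X := ℂ) (x := G e 0)] at hc2
        exact hc2.eventually ((isOpen_ne_fun continuous_fst continuous_snd).mem_nhds
          (hx e he' hT).symm)
      obtain ⟨pa, hpa, pb, hpb, hp⟩ := Filter.eventually_prod_iff.1 h1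
      obtain ⟨Y, -, hY⟩ := exists_im_gt hpa
      refine ⟨Y, hpb.mono fun y hy z hz hzY => ?_⟩
      rw [hG z hz]
      exact hp (hY z hzY) hy
  choose! Y hY using key
  refine ⟨∑ e ∈ D10, |Y e|, ?_⟩
  have := (Filter.eventually_all_finset D10).2 hY
  filter_upwards [this] with y hy e he z hz hzY
  refine hy e (mem_D10.2 he) z hz (lt_of_le_of_lt ?_ hzY)
  exact (le_abs_self _).trans (Finset.single_le_sum (f := fun e => |Y e|) (fun _ _ => abs_nonneg _)
    (mem_D10.2 he))

omit h in
lemma isCompact_siegel (Y : ℝ) :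
    IsCompact (⋃ e ∈ D10, mo (W e) '' {z | |z.re| ≤ 1 ∧ 1 / 20 ≤ z.im ∧ z.im ≤ Y}) ∧
    (⋃ e ∈ D10, mo (W e) '' {z | |z.re| ≤ 1 ∧ 1 / 20 ≤ z.im ∧ z.im ≤ Y}) ⊆ UH := by
  constructor
  · refine D10.isCompact_biUnion fun e he => ?_
    have hbox : IsCompact {z : ℂ | |z.re| ≤ 1 ∧ 1 / 20 ≤ z.im ∧ z.im ≤ Y} := by
      have : {z : ℂ | |z.re| ≤ 1 ∧ 1 / 20 ≤ z.im ∧ z.im ≤ Y} = Set.Icc (-1) 1 ×ℂ Set.Icc (1 / 20) Y := by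
        ext z; simp [Complex.mem_reProdIm, abs_le]
      rw [this]
      exact isCompact_Icc.reProdIm isCompact_Icc
    refine hbox.image_of_continuousOn fun z hz => ?_
    exact (differentiableAt_mo (AL_W (mem_D10.1 he)).det_ne (by linarith [hz.2.1])).continuousAt.continuousWithinAt
  · simp only [Set.iUnion_subset_iff]
    rintro e he _ ⟨z, hz, rfl⟩
    exact (AL_W (mem_D10.1 he)).mo_im_pos (by linarith [hz.2.1])

lemma exists_compact (x : ℂ) (hx : ∀ e, e ∣ 10 → ¬ T e → x ≠ G e 0) :
    ∃ K : Set ℂ, IsCompact K ∧ K ⊆ UH ∧ ∀ᶠ y in nhds x, ∀ z : ℂ, 0 < z.im → f z = y →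
      ∃ z' ∈ K, Rel T z z' := by
  obtain ⟨Y, hY⟩ := h.exists_bound x hx
  refine ⟨_, (isCompact_siegel Y).1, (isCompact_siegel Y).2, hY.mono fun y hy z hz hzy => ?_⟩
  obtain ⟨e, z₁, he, hre, him, hrel⟩ := exists_reduced hz
  refine ⟨_, ?_, h.rel_of_one hrel⟩
  simp only [Set.mem_iUnion]
  refine ⟨e, mem_D10.2 he, z₁, ⟨hre, him, ?_⟩, rfl⟩
  by_contra! hlt
  exact hy e he z₁ (by linarith) hlt ((h.eq_of_rel hz (h.rel_of_one hrel)).trans hzy)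

omit h in
lemma eventually_not_rel {z w : ℂ} (hz : 0 < z.im) (hw : 0 < w.im) (hzw : ¬ Rel T z w) :
    ∀ᶠ p in nhds z ×ˢ nhds w, ¬ Rel T p.1 p.2 := by
  filter_upwards [eventually_carry hz hw] with p hp
  rintro ⟨e, A, he, hA, hAp⟩
  exact hzw ⟨e, A, he, hA, hp e A hA hAp⟩

omit h in
lemma eventually_injective {g : ℂ → ℂ} {w : ℂ} (hg : AnalyticAt ℂ g w) (hd : deriv g w ≠ 0) :
    ∀ᶠ p in nhds w ×ˢ nhds w, g p.1 = g p.2 → p.1 = p.2 := by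
  have hs : HasStrictDerivAt g (deriv g w) w := hg.hasStrictDerivAt
  have h1 := (hs.hasStrictFDerivAt_equiv hd).eventually_left_inverse
  filter_upwards [h1.prod_inl _, h1.prod_inr _] with p h1 h2 h3
  rw [← h1, ← h2, h3]

/-- Values taken at two inequivalent points. -/
def Mult (T : ℕ → Prop) (f : ℂ → ℂ) : Set ℂ :=
  {x | ∃ z w : ℂ, 0 < z.im ∧ 0 < w.im ∧ f z = x ∧ f w = x ∧ ¬ Rel T z w}

lemma isOpen_mult : IsOpen (Mult T f) := by
  rw [isOpen_iff_mem_nhds]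
  rintro x ⟨z, w, hz, hw, hzx, hwx, hr⟩
  obtain ⟨pa, hpa, pb, hpb, hp⟩ := Filter.eventually_prod_iff.1 (eventually_not_rel hz hw hr)
  have h1 : f '' {z' | pa z' ∧ 0 < z'.im} ∈ nhds x := by
    rw [← hzx]; exact h.nhds_le_map hz (Filter.image_mem_map (hpa.and (UH_mem_nhds hz)))
  have h2 : f '' {z' | pb z' ∧ 0 < z'.im} ∈ nhds x := by
    rw [← hwx]; exact h.nhds_le_map hw (Filter.image_mem_map (hpb.and (UH_mem_nhds hw)))
  filter_upwards [h1, h2]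
  rintro y ⟨z', hz', hzy⟩ ⟨w', hw', hwy⟩
  exact ⟨z', w', hz'.2, hw'.2, hzy, hwy, hp hz'.1 hw'.1⟩

lemma closure_mult {x : ℂ} (hx : x ∈ closure (Mult T f)) (hG : ∀ e, e ∣ 10 → ¬ T e → x ≠ G e 0)
    (hcrit : ∀ z : ℂ, 0 < z.im → f z = x → deriv f z ≠ 0) : x ∈ Mult T f := by
  obtain ⟨K, hK, hKU, hKx⟩ := h.exists_compact x hG
  set Z : Set (ℂ × ℂ) := {p | p.1 ∈ K ∧ p.2 ∈ K ∧ f p.1 = f p.2 ∧ ¬ Rel T p.1 p.2} with hZ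
  have hZK : closure Z ⊆ K ×ˢ K :=
    closure_minimal (fun p hp => ⟨hp.1, hp.2.1⟩) (hK.prod hK).isClosed
  have hcl : IsClosed ((fun p : ℂ × ℂ => f p.1) '' closure Z) := by
    refine (IsCompact.image_of_continuousOn ((hK.prod hK).of_isClosed_subset isClosed_closure hZK)
      fun p hp => ?_).isClosed
    exact ContinuousAt.continuousWithinAt
      ((h.diff p.1 (hKU (hZK hp).1)).continuousAt.comp continuous_fst.continuousAt)
  have hxZ : x ∈ (fun p : ℂ × ℂ => f p.1) '' closure Z := by
    rw [← hcl.closure_eq]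
    rw [mem_closure_iff_frequently] at hx ⊢
    refine (hx.and_eventually hKx).mono ?_
    rintro y ⟨⟨z, w, hz, hw, hzy, hwy, hr⟩, hy⟩
    obtain ⟨z', hz', hzr⟩ := hy z hz hzy
    obtain ⟨w', hw', hwr⟩ := hy w hw hwy
    have e1 : f z' = y := (h.eq_of_rel hz hzr).trans hzy
    have e2 : f w' = y := (h.eq_of_rel hw hwr).trans hwy
    refine ⟨(z', w'), subset_closure ⟨hz', hw', e1.trans e2.symm, fun hr' => hr ?_⟩, e1⟩
    exact h.rel_trans hz (h.rel_trans hz hzr hr') (rel_symm hw hwr)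
  obtain ⟨⟨z, w⟩, hp, hzx⟩ := hxZ
  have hz : 0 < z.im := hKU (hZK hp).1
  have hw : 0 < w.im := hKU (hZK hp).2
  have hzx : f z = x := hzx
  rw [mem_closure_iff_frequently] at hp
  have hfz := (h.diff z hz).continuousAt
  have hfw := (h.diff w hw).continuousAt
  have hwx : f w = x := by
    by_contra hne
    have hc : ContinuousAt (fun p : ℂ × ℂ => (f p.1, f p.2)) (z, w) :=
      (ContinuousAt.comp (x := (z, w)) hfz continuous_fst.continuousAt).prodMk
        (ContinuousAt.comp (x := (z, w)) hfw continuous_snd.continuousAt)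
    have := hc.eventually ((isOpen_ne_fun continuous_fst continuous_snd).mem_nhds
      (show f z ≠ f w by rw [hzx]; exact fun h => hne h.symm))
    obtain ⟨p, hp1, hp2⟩ := (hp.and_eventually this).exists
    exact hp2 hp1.2.2.1
  refine ⟨z, w, hz, hw, hzx, hwx, ?_⟩
  rintro ⟨e, A, he, hA, hAz⟩
  have hinj := eventually_injective (h.analyticAt hw) (hcrit w hw hwx)
  have hc : Filter.Tendsto (fun p : ℂ × ℂ => (mo A p.1, p.2)) (nhds (z, w)) (nhds w ×ˢ nhds w) := by
    rw [nhds_prod_eq]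
    refine Filter.Tendsto.prodMk ?_ Filter.tendsto_snd
    have := (differentiableAt_mo hA.det_ne hz).continuousAt.tendsto
    rw [hAz] at this
    exact this.comp Filter.tendsto_fst
  obtain ⟨p, hp1, hp2⟩ := (hp.and_eventually (hc.eventually hinj)).exists
  refine hp1.2.2.2 ⟨e, A, he, hA, hp2 ?_⟩
  rw [h.inv e A he hA _ (hKU hp1.1)]
  exact hp1.2.2.1

lemma exists_norm_bound : ∃ M : ℝ, ∀ x ∈ Mult T f, ‖x‖ ≤ M := by
  -- near the cusp `i∞` the function is injective modulo translations
  have hinj : ∃ Y : ℝ, 0 < Y ∧ ∀ z w : ℂ, Y < z.im → Y < w.im → f z = f w → qc z = qc w := by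
    set g : ℂ → ℂ := fun q => q / Fd q with hg
    have hF0 : Fd 0 ≠ 0 := by rw [h.zero]; exact one_ne_zero
    have hda : AnalyticAt ℂ Fd 0 :=
      (DifferentiableOn.analyticOnNhd (fun q hq => (h.diffd q (by simpa using hq)).differentiableWithinAt)
        (Metric.isOpen_ball : IsOpen (Metric.ball (0 : ℂ) 1))) 0 (by simp)
    have hga : AnalyticAt ℂ g 0 := analyticAt_id.div hda hF0
    have hgd : deriv g 0 ≠ 0 := by
      have := (hasDerivAt_id (0 : ℂ)).div hda.differentiableAt.hasDerivAt hF0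
      have := this.deriv
      rw [hg]
      erw [this]
      simp [h.zero]
    obtain ⟨pa, hpa, pb, hpb, hp⟩ := Filter.eventually_prod_iff.1 (eventually_injective hga hgd)
    obtain ⟨Y, hY0, hY⟩ := exists_im_gt (hpa.and hpb)
    refine ⟨Y, hY0, fun z w hz hw hzw => hp (hY z hz).1 (hY w hw).2 ?_⟩
    have hz' := hY0.trans hz
    have hw' := hY0.trans hw
    rw [h.eq z hz', h.eq w hw'] at hzw
    change qc z / Fd (qc z) = qc w / Fd (qc w)
    rw [← inv_div (Fd (qc z)), ← inv_div (Fd (qc w)), div_eq_inv_mul, div_eq_inv_mul, hzw]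
  obtain ⟨Y, hY0, hYinj⟩ := hinj
  have hb : ∀ e ∈ D10, ∃ C Y' : ℝ, ¬ T e → ∀ z : ℂ, Y' < z.im → 0 < z.im → ‖f (mo (W e) z)‖ ≤ C := by
    intro e he
    by_cases hT : T e
    · exact ⟨0, 0, fun h => (h hT).elim⟩
    · obtain ⟨hc, hG⟩ := h.cusp e (mem_D10.1 he) hT
      have h1 := hc.norm.eventually (eventually_lt_nhds (lt_add_one ‖G e 0‖))
      obtain ⟨Y', -, hY'⟩ := exists_im_gt h1
      exact ⟨_, Y', fun _ z hz hz0 => by rw [hG z hz0]; exact (hY' z hz).le⟩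
  choose! C Y' hC using hb
  set Y₁ := Y + ∑ e ∈ D10, |Y' e| with hY₁
  obtain ⟨hKc, hKU⟩ := isCompact_siegel Y₁
  set K := (⋃ e ∈ D10, mo (W e) '' {z | |z.re| ≤ 1 ∧ 1 / 20 ≤ z.im ∧ z.im ≤ Y₁}) with hK
  obtain ⟨M₀, hM₀⟩ := hKc.exists_bound_of_continuousOn (f := f)
    fun z hz => (h.diff z (hKU hz)).continuousAt.continuousWithinAt
  have hle : ∀ (g : ℕ → ℝ) {e}, e ∈ D10 → g e ≤ ∑ e ∈ D10, |g e| := fun g e he =>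
    (le_abs_self _).trans (Finset.single_le_sum (f := fun e => |g e|) (fun _ _ => abs_nonneg _) he)
  have hnn : ∀ g : ℕ → ℝ, 0 ≤ ∑ e ∈ D10, |g e| := fun g => Finset.sum_nonneg fun _ _ => abs_nonneg _
  set M := |M₀| + ∑ e ∈ D10, |C e| with hM
  have hred : ∀ z : ℂ, 0 < z.im → M < ‖f z‖ → ∃ z₁ : ℂ, Y < z₁.im ∧ Rel T z z₁ := by
    intro z hz hlt
    obtain ⟨e, z₁, he, hre, him, hrel⟩ := exists_reduced hz
    have he' := mem_D10.2 he
    have hrel := h.rel_of_one hrel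
    have hz1 : 0 < z₁.im := by linarith
    have hfe := h.eq_of_rel hz hrel
    have hgt : Y₁ < z₁.im := by
      by_contra! hle'
      have := hM₀ (mo (W e) z₁) (by
        simp only [hK, Set.mem_iUnion]; exact ⟨e, he', z₁, ⟨hre, him, hle'⟩, rfl⟩)
      rw [hfe] at this
      linarith [le_abs_self M₀, hnn C]
    by_cases hT : T e
    · exact ⟨z₁, by linarith [hnn Y'], h.rel_trans hz hrel
        (rel_symm hz1 ⟨e, _, hT, AL_W he, rfl⟩)⟩
    · have := hC e he' hT z₁ (by linarith [hle Y' he']) hz1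
      rw [hfe] at this
      linarith [hle C he', abs_nonneg M₀]
  refine ⟨M, ?_⟩
  rintro x ⟨z, w, hz, hw, hzx, hwx, hr⟩
  by_contra! hlt
  obtain ⟨z₁, hz₁, hzr⟩ := hred z hz (by rwa [hzx])
  obtain ⟨w₁, hw₁, hwr⟩ := hred w hw (by rwa [hwx])
  have heq := hYinj z₁ w₁ hz₁ hw₁
    (by rw [h.eq_of_rel hz hzr, h.eq_of_rel hw hwr, hzx, hwx])
  obtain ⟨n, hn⟩ := qc_eq_iff.1 heq.symm
  have hzw1 : Rel T z₁ w₁ := by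
    refine ⟨1, !![1, n; 0, 1], h.one,
      ⟨by norm_num, by simp, by simp, by simp, by simp [det_fin_two]⟩, ?_⟩
    simp [mo, jf, hn]
  exact hr (h.rel_trans hz (h.rel_trans hz hzr hzw1) (rel_symm hw hwr))

/-- A hauptmodul separates inequivalent points. -/
theorem rel_of_eq {z w : ℂ} (hz : 0 < z.im) (hw : 0 < w.im) (hzw : f z = f w) : Rel T z w := by
  set R : Set ℂ := f '' {z ∈ UH | deriv f z = 0} ∪ (fun e => G e 0) '' (D10 : Set ℕ) with hR
  have hRc : R.Countable :=
    (h.countable_critical.image f).union ((D10.finite_toSet.countable).image _)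
  have hconn : IsPreconnected Rᶜ :=
    (hRc.isConnected_compl_of_one_lt_rank (by rw [Complex.rank_real_complex]; norm_num)).isPreconnected
  have hdense : Dense Rᶜ := hRc.dense_compl ℝ
  obtain ⟨M, hM⟩ := h.exists_norm_bound
  have hcl : closure (Mult T f) ∩ Rᶜ ⊆ Mult T f := by
    rintro x ⟨hx, hxR⟩
    refine h.closure_mult hx (fun e he _ hxe => hxR (Or.inr ⟨e, mem_D10.2 he, hxe.symm⟩))
      fun z hz hzx hd => hxR (Or.inl ⟨z, ⟨hz, hd⟩, hzx⟩)
  have hempty : ¬ (Rᶜ ∩ Mult T f).Nonempty := by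
    intro hne
    have hsub := hconn.subset_of_closure_inter_subset h.isOpen_mult hne hcl
    have hopen : IsOpen {x : ℂ | M < ‖x‖} := isOpen_lt continuous_const continuous_norm
    obtain ⟨x, hx1, hx2⟩ := hdense.inter_open_nonempty _ hopen ⟨((|M| + 1 : ℝ) : ℂ), by
      rw [Set.mem_ofPred_eq, Complex.norm_real, Real.norm_eq_abs, abs_of_nonneg (by positivity)]
      linarith [le_abs_self M]⟩
    exact absurd (hM x (hsub hx2)) (not_le.2 hx1)
  by_contra hr
  obtain ⟨x, hx1, hx2⟩ := hdense.inter_open_nonempty _ h.isOpen_mult ⟨f w, z, w, hz, hw, hzw, rfl, hr⟩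
  exact hempty ⟨x, hx2, hx1⟩

/-- A hauptmodul of the full Atkin–Lehner group is surjective. -/
theorem surjective (hT : ∀ e, e ∣ 10 → T e) (x : ℂ) : ∃ z : ℂ, 0 < z.im ∧ f z = x := by
  have hG : ∀ x e, e ∣ 10 → ¬ T e → x ≠ G e 0 := fun _ e he hne => (hne (hT e he)).elim
  have ho : IsOpen (f '' UH) := by
    rw [isOpen_iff_mem_nhds]
    rintro _ ⟨z, hz, rfl⟩
    exact h.nhds_le_map hz (Filter.image_mem_map (UH_mem_nhds hz))
  have hc : IsClosed (f '' UH) := by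
    rw [← closure_subset_iff_isClosed]
    intro x hx
    obtain ⟨K, hK, hKU, hKx⟩ := h.exists_compact x (hG x)
    have hcl : IsClosed (f '' K) := (hK.image_of_continuousOn fun z hz =>
      (h.diff z (hKU hz)).continuousAt.continuousWithinAt).isClosed
    have : x ∈ f '' K := by
      rw [← hcl.closure_eq]
      rw [mem_closure_iff_frequently] at hx ⊢
      refine (hx.and_eventually hKx).mono ?_
      rintro y ⟨⟨z, hz, hzy⟩, hy⟩
      obtain ⟨z', hz', hr⟩ := hy z hz hzy
      exact ⟨z', hz', (h.eq_of_rel hz hr).trans hzy⟩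
    exact Set.image_mono hKU this
  have := IsClopen.eq_univ ⟨hc, ho⟩ ⟨f I, I, by simp [UH], rfl⟩
  obtain ⟨z, hz, hzx⟩ := this.symm ▸ Set.mem_univ x
  exact ⟨z, hz, hzx⟩

end Haupt

lemma haupt_jS : Haupt (fun _ => True) jS jSd (fun _ _ => 0) where
  one := trivial
  star _ _ _ _ := trivial
  diff _ hz := differentiableAt_jS hz
  inv e A _ hA := invS_jS e A hA
  eq _ hz := jS_eq hz
  diffd _ hq := differentiableAt_jSd hq
  zero := jSd_zero
  cusp _ _ h := (h trivial).elim

lemma exists_haupt_jj : ∃ Fd G, Haupt (· = 1) jj Fd G := by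
  obtain ⟨β, hβ⟩ := exists_beta
  refine ⟨fun q => pe (vexp 2) q - q, fun e q => β e * q / pe (vexp e) q - kc e, rfl, ?_,
    fun _ hz => differentiableAt_jj hz, ?_, ?_, ?_, by simp [pe_zero], ?_⟩
  · rintro d e rfl rfl; rfl
  · rintro e A rfl hA z hz; exact inv_jj A hA z hz
  · intro z hz
    rw [jj, V_eq_pe (by norm_num) (by norm_num) hz, mul_sub, inv_mul_cancel₀ (qc_ne_zero z)]
  · exact fun q hq => (differentiableAt_pe _ hq).sub differentiableAt_id
  · intro e he he1
    refine ⟨?_, fun z hz => ?_⟩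
    · have := (differentiableAt_pe (vexp e) (q := 0) (by simp)).continuousAt
      have h0 := pe_ne_zero (vexp e) 0
      fun_prop (disch := assumption)
    · obtain ⟨-, h2⟩ := hβ e (mem_D10.2 he) he1
      rw [← jE, (h2 z hz).2, V_eq_pe he he1 hz, div_mul_eq_div_div, div_inv_eq_mul]

end LevelTen

namespace LevelTen

/-! ### Vanishing orders -/

/-- `f` is analytic at `w` and vanishes there to order exactly `n`. -/
def OrdAt (f : ℂ → ℂ) (w : ℂ) (n : ℕ) : Prop := AnalyticAt ℂ f w ∧ analyticOrderAt f w = n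

lemma ordAt_iff {f : ℂ → ℂ} {w : ℂ} {n : ℕ} : OrdAt f w n ↔
    ∃ u, AnalyticAt ℂ u w ∧ u w ≠ 0 ∧ ∀ᶠ z in nhds w, f z = (z - w) ^ n * u z := by
  constructor
  · rintro ⟨hf, hn⟩
    exact hf.analyticOrderAt_eq_natCast.1 hn
  · rintro ⟨u, hu, hu0, he⟩
    have hf : AnalyticAt ℂ f w := by
      refine AnalyticAt.congr (f := fun z => (z - w) ^ n * u z) (by fun_prop) ?_
      exact he.mono fun z hz => hz.symm
    exact ⟨hf, hf.analyticOrderAt_eq_natCast.2 ⟨u, hu, hu0, he⟩⟩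

lemma OrdAt.unique {f : ℂ → ℂ} {w : ℂ} {m n : ℕ} (hm : OrdAt f w m) (hn : OrdAt f w n) : m = n := by
  have := hm.2.symm.trans hn.2
  exact_mod_cast this

lemma OrdAt.mul {f g : ℂ → ℂ} {w : ℂ} {m n : ℕ} (hf : OrdAt f w m) (hg : OrdAt g w n) :
    OrdAt (fun z => f z * g z) w (m + n) := by
  refine ⟨hf.1.mul hg.1, ?_⟩
  have := analyticOrderAt_mul hf.1 hg.1
  rw [hf.2, hg.2] at this
  exact_mod_cast this

lemma OrdAt.of_ne {f : ℂ → ℂ} {w : ℂ} (hf : AnalyticAt ℂ f w) (h : f w ≠ 0) : OrdAt f w 0 :=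
  ordAt_iff.2 ⟨f, hf, h, by simp⟩

lemma OrdAt.pow {f : ℂ → ℂ} {w : ℂ} {m : ℕ} (hf : OrdAt f w m) (k : ℕ) :
    OrdAt (fun z => f z ^ k) w (k * m) := by
  induction k with
  | zero => simpa using OrdAt.of_ne (f := fun _ => (1 : ℂ)) analyticAt_const one_ne_zero
  | succ k ih =>
    have := ih.mul hf
    rw [Nat.succ_mul]
    exact this

lemma OrdAt.prod {ι : Type*} (s : Finset ι) {f : ι → ℂ → ℂ} {w : ℂ} {m : ι → ℕ}
    (hf : ∀ i ∈ s, OrdAt (f i) w (m i)) : OrdAt (fun z => ∏ i ∈ s, f i z) w (∑ i ∈ s, m i) := by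
  classical
  induction s using Finset.induction_on with
  | empty => simpa using OrdAt.of_ne (f := fun _ => (1 : ℂ)) analyticAt_const one_ne_zero
  | insert a s ha ih =>
    simp only [Finset.prod_insert ha, Finset.sum_insert ha]
    exact (hf a (by simp)).mul (ih fun i hi => hf i (by simp [hi]))

lemma OrdAt.congr {f g : ℂ → ℂ} {w : ℂ} {m : ℕ} (hf : OrdAt f w m)
    (h : ∀ᶠ z in nhds w, g z = f z) : OrdAt g w m := by
  obtain ⟨u, hu, hu0, he⟩ := ordAt_iff.1 hf
  exact ordAt_iff.2 ⟨u, hu, hu0, by filter_upwards [h, he] with z h1 h2; rw [h1, h2]⟩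

/-! ### Ramification of hauptmoduln -/

/-- Two matrices fixing a point with the same multiplier are proportional. -/
lemma proportional {A B : M2} (hA : 0 < A.det) (hB : 0 < B.det) {w : ℂ} (hw : 0 < w.im)
    (hAw : mo A w = w) (hBw : mo B w = w) (hm : A.det / jf A w ^ 2 = B.det / jf B w ^ 2) :
    ∃ k : ℤ, B.det • A = k • B ∧ k ^ 2 = A.det * B.det := by
  set C := A * B.adjugate with hC
  have hjA := jf_ne_zero hA.ne' hw
  have hjB := jf_ne_zero hB.ne' hw
  have hB' : 0 < B.adjugate.det := by rwa [det_adjugate_two]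
  have hjB' := jf_ne_zero hB'.ne' hw
  have hBw' : mo B.adjugate w = w := by
    conv_lhs => rw [← hBw]
    exact mo_adjugate hB hw
  have hdet : C.det = A.det * B.det := by rw [hC, det_mul, det_adjugate_two]
  have hjj : jf B.adjugate w * jf B w = B.det := by
    have h1 := jf_mul B.adjugate B hjB
    rw [adjugate_mul, hBw, jf_smul, jf_one, mul_one] at h1
    exact h1.symm
  have hjC : jf C w = jf A w * jf B.adjugate w := by rw [hC, jf_mul A _ hjB', hBw']
  have hC2 : jf C w ^ 2 = C.det := by
    rw [hdet, hjC]
    have h3 : jf B.adjugate w = B.det / jf B w := by rw [← hjj, mul_div_cancel_right₀ _ hjB]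
    have hdB : (B.det : ℂ) ≠ 0 := by exact_mod_cast hB.ne'
    rw [h3, Int.cast_mul]
    field_simp at hm ⊢
    linear_combination -hm
  have hCdet : 0 < C.det := by rw [hdet]; positivity
  have hCw : mo C w = w := by rw [hC, mo_mul A _ hjB', hBw', hAw]
  have him : (jf C w).im = 0 := by
    have h1 := congrArg Complex.im hC2
    have h2 := congrArg Complex.re hC2
    rw [sq] at h1 h2
    simp only [Complex.mul_im, Complex.mul_re, Complex.intCast_im, Complex.intCast_re] at h1 h2
    by_contra hne
    have hre : (jf C w).re = 0 := by
      have : (jf C w).re * (jf C w).im = 0 := by linarith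
      exact (mul_eq_zero.1 this).resolve_right hne
    rw [hre] at h2
    have : (0 : ℝ) < C.det := by exact_mod_cast hCdet
    nlinarith [mul_self_nonneg (jf C w).im]
  have h10 : C 1 0 = 0 := by
    simp only [jf, Complex.add_im, Complex.mul_im, Complex.intCast_re, Complex.intCast_im, zero_mul,
      add_zero] at him
    have := (mul_eq_zero.1 him).resolve_right hw.ne'
    exact_mod_cast this
  have hjf : jf C w = C 1 1 := by simp [jf, h10]
  have hlin : (C 0 0 : ℂ) * w + C 0 1 = C 1 1 * w := by
    have : jf C w ≠ 0 := jf_ne_zero hCdet.ne' hw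
    have h2 := hCw
    rw [mo, div_eq_iff this, hjf] at h2
    rw [h2]; ring
  have h00 : C 0 0 = C 1 1 := by
    have h1 := congrArg Complex.im hlin
    simp only [Complex.add_im, Complex.mul_im, Complex.intCast_re, Complex.intCast_im, zero_mul,
      add_zero] at h1
    exact_mod_cast mul_right_cancel₀ hw.ne' h1
  have h01 : C 0 1 = 0 := by
    rw [h00] at hlin
    have : (C 0 1 : ℂ) = 0 := by linear_combination hlin
    exact_mod_cast this
  have hCs : C = C 1 1 • 1 := by
    ext i j
    fin_cases i <;> fin_cases j <;> simp [h10, h00, h01]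
  refine ⟨C 1 1, ?_, ?_⟩
  · have : C * B = B.det • A := by rw [hC, Matrix.mul_assoc, adjugate_mul, Matrix.mul_smul, Matrix.mul_one]
    rw [← this, hCs]
    simp
  · rw [← hdet, det_fin_two, h00, h10]; ring

lemma AL.eq_or_eq_neg {e f : ℕ} {A B : M2} (hA : AL e A) (hB : AL f B) {w : ℂ} (hw : 0 < w.im)
    (hAw : mo A w = w) (hBw : mo B w = w) (hm : A.det / jf A w ^ 2 = B.det / jf B w ^ 2) :
    A = B ∨ A = -B := by
  obtain ⟨k, hk1, hk2⟩ := proportional hA.det_pos hB.det_pos hw hAw hBw hm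
  have hBd := hB.det_ne
  rw [hA.det_eq, hB.det_eq] at hk2
  have hef : e = f := by
    have : ∃ k : ℕ, k ^ 2 = e * f := ⟨k.natAbs, by zify; rw [sq_abs]; exact hk2⟩
    obtain ⟨m, hm⟩ := this
    have hm10 : m ≤ 10 := by
      have := Nat.le_of_dvd (by norm_num) hA.dvd_ten
      have := Nat.le_of_dvd (by norm_num) hB.dvd_ten
      nlinarith
    rcases dvd_ten_cases hA.dvd_ten with rfl | rfl | rfl | rfl <;>
    rcases dvd_ten_cases hB.dvd_ten with rfl | rfl | rfl | rfl <;>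
    first
    | rfl
    | (exfalso; interval_cases m <;> omega)
  subst hef
  have hk : k = e ∨ k = -e := sq_eq_sq_iff_eq_or_eq_neg.1 (by rw [hk2]; ring)
  rw [hB.det_eq] at hk1 hBd
  rcases hk with rfl | rfl
  · left; exact smul_right_injective _ hBd hk1
  · right; rw [neg_smul, ← smul_neg] at hk1; exact smul_right_injective _ hBd hk1

namespace Haupt

variable {T : ℕ → Prop} {f Fd : ℂ → ℂ} {G : ℕ → ℂ → ℂ} (h : Haupt T f Fd G)

include h

lemma exists_ordAt {w : ℂ} (hw : 0 < w.im) : ∃ n, n ≠ 0 ∧ OrdAt (fun z => f z - f w) w n := by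
  have ha : AnalyticAt ℂ (fun z => f z - f w) w := (h.analyticAt hw).sub analyticAt_const
  have hne : ¬ ∀ᶠ z in nhds w, f z - f w = 0 := by
    intro hev
    refine h.not_const (f w) fun z hz => ?_
    exact h.analyticOnNhd.eqOn_of_preconnected_of_eventuallyEq analyticOnNhd_const
      isPreconnected_UH hw (hev.mono fun z hz => sub_eq_zero.1 hz) hz
  obtain ⟨n, u, hu, hu0, he⟩ := ha.exists_eventuallyEq_pow_smul_nonzero_iff.2 hne
  refine ⟨n, ?_, ordAt_iff.2 ⟨u, hu, hu0, he⟩⟩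
  rintro rfl
  have := he.self_of_nhds
  simp at this
  exact hu0 this.symm

lemma multiplier_pow {w : ℂ} (hw : 0 < w.im) {n : ℕ} (ho : OrdAt (fun z => f z - f w) w n)
    {e : ℕ} {A : M2} (he : T e) (hA : AL e A) (hAw : mo A w = w) :
    (A.det / jf A w ^ 2) ^ n = 1 := by
  obtain ⟨u, hu, hu0, hev⟩ := ordAt_iff.1 ho
  have hd := hasDerivAt_mo A (jf_ne_zero hA.det_ne hw)
  have hc : Filter.Tendsto (mo A) (nhds w) (nhds w) := by
    have := hd.continuousAt.tendsto
    rwa [hAw] at this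
  have hs := hd.tendsto_slope
  have h1 : Filter.Tendsto (fun z => slope (mo A) w z ^ n * u (mo A z)) (nhdsWithin w {w}ᶜ)
      (nhds ((A.det / jf A w ^ 2) ^ n * u w)) :=
    (hs.pow n).mul ((hu.continuousAt.tendsto.comp hc).mono_left nhdsWithin_le_nhds)
  have h2 : Filter.Tendsto u (nhdsWithin w {w}ᶜ) (nhds (u w)) :=
    hu.continuousAt.tendsto.mono_left nhdsWithin_le_nhds
  have h3 : ∀ᶠ z in nhdsWithin w {w}ᶜ, slope (mo A) w z ^ n * u (mo A z) = u z := by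
    filter_upwards [nhdsWithin_le_nhds hev, nhdsWithin_le_nhds (hc.eventually hev),
      nhdsWithin_le_nhds (UH_mem_nhds hw), self_mem_nhdsWithin] with z hz1 hz2 hz3 hz4
    rw [h.inv e A he hA z hz3, hz1] at hz2
    have hzw : (z - w) ≠ 0 := sub_ne_zero.2 hz4
    rw [slope_def_field, hAw, div_pow, div_mul_eq_mul_div, ← hz2, mul_div_cancel_left₀ _ (pow_ne_zero _ hzw)]
  have := tendsto_nhds_unique (h1.congr' h3) h2
  exact mul_right_cancel₀ hu0 (this.trans (one_mul _).symm)

lemma exists_multiplier {w : ℂ} (hw : 0 < w.im) {n : ℕ} (hn : n ≠ 0)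
    (ho : OrdAt (fun z => f z - f w) w n) {ζ : ℂ} (hζ : ζ ^ n = 1) :
    ∃ e A, T e ∧ AL e A ∧ mo A w = w ∧ A.det / jf A w ^ 2 = ζ := by
  obtain ⟨u, hu, hu0, hev⟩ := ordAt_iff.1 ho
  have hn' : (n : ℂ) ≠ 0 := by exact_mod_cast hn
  -- a local coordinate whose `n`-th power is `f - f w` up to a constant
  set g : ℂ → ℂ := fun z => (z - w) * exp (log (u z / u w) / n) with hg
  have hga : AnalyticAt ℂ g w := by
    have h1 : AnalyticAt ℂ (fun z => log (u z / u w)) w :=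
      (hu.div analyticAt_const hu0).clog (by rw [Pi.div_apply, div_self hu0]; exact Complex.one_mem_slitPlane)
    exact (analyticAt_id.sub analyticAt_const).mul ((h1.div analyticAt_const hn').cexp)
  have hg0 : g w = 0 := by simp [hg]
  have hgd : HasDerivAt g 1 w := by
    have h1 : HasDerivAt (fun z : ℂ => z - w) 1 w := (hasDerivAt_id w).sub_const w
    have h2 : DifferentiableAt ℂ (fun z => exp (log (u z / u w) / n)) w := by
      have h1 : AnalyticAt ℂ (fun z => log (u z / u w)) w :=
        (hu.div analyticAt_const hu0).clog (by rw [Pi.div_apply, div_self hu0]; exact Complex.one_mem_slitPlane)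
      exact ((h1.div analyticAt_const hn').cexp).differentiableAt
    have := h1.mul h2.hasDerivAt
    simpa [div_self hu0] using! this
  have hgs : HasStrictDerivAt g 1 w := by
    have := hga.hasStrictDerivAt; rwa [hgd.deriv] at this
  have hgf : ∀ᶠ z in nhds w, f z - f w = u w * g z ^ n := by
    have hune : ∀ᶠ z in nhds w, u z ≠ 0 := hu.continuousAt.eventually_ne hu0
    filter_upwards [hev, hune] with z hz hz0
    rw [hz, hg]
    simp only
    rw [mul_pow, ← Complex.exp_nat_mul, mul_div_cancel₀ _ hn', Complex.exp_log (div_ne_zero hz0 hu0)]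
    field_simp
  set φ : ℂ → ℂ := hgs.localInverse g 1 w one_ne_zero with hφ
  have hφd : HasDerivAt φ 1 0 := by
    have := (hgs.to_localInverse one_ne_zero).hasDerivAt
    rwa [hg0, inv_one] at this
  have hφ0 : φ 0 = w := by
    have := (hgs.hasStrictFDerivAt_equiv one_ne_zero).localInverse_apply_image
    rwa [hg0] at this
  have hφr : ∀ᶠ t in nhds (0 : ℂ), g (φ t) = t := by
    have := (hgs.hasStrictFDerivAt_equiv one_ne_zero).eventually_right_inverse
    rwa [hg0] at this
  have hφt : Filter.Tendsto φ (nhds 0) (nhds w) := by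
    have := hφd.continuousAt.tendsto; rwa [hφ0] at this
  have hζt : Filter.Tendsto (fun t : ℂ => ζ * t) (nhds 0) (nhds 0) := by
    have : Continuous fun t : ℂ => ζ * t := by fun_prop
    simpa using this.tendsto 0
  have hψd : HasDerivAt (fun t => φ (ζ * t)) ζ 0 := by
    have h1 : HasDerivAt (fun t : ℂ => ζ * t) ζ 0 := by simpa using (hasDerivAt_id (0 : ℂ)).const_mul ζ
    have h2 : HasDerivAt φ 1 (ζ * 0) := by simpa using hφd
    simpa using! h2.comp 0 h1
  set Φ := {A : M2 | 0 < A.det ∧ A.det ≤ 10 ∧ mo A w = w} with hΦ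
  have hΦf : Φ.Finite := finite_fixers 10 hw
  have hsep : ∀ᶠ t in nhdsWithin (0 : ℂ) {0}ᶜ, ∀ A ∈ Φ, A.det / jf A w ^ 2 ≠ ζ →
      mo A (φ t) ≠ φ (ζ * t) := by
    rw [Filter.eventually_all_finite hΦf]
    intro A hA
    by_cases hm : A.det / jf A w ^ 2 = ζ
    · exact Filter.Eventually.of_forall fun t h => (h hm).elim
    · have h1 : HasDerivAt (mo A) (A.det / jf A w ^ 2) (φ 0) := by
        rw [hφ0]; exact hasDerivAt_mo A (jf_ne_zero hA.1.ne' hw)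
      have h2 := (h1.comp 0 hφd).sub hψd
      rw [mul_one] at h2
      filter_upwards [h2.eventually_ne (c := 0) (sub_ne_zero.2 hm)] with t ht _ heq
      exact ht (sub_eq_zero.2 heq)
  have hcar : ∀ᶠ t in nhds (0 : ℂ), ∀ e A, AL e A → mo A (φ t) = φ (ζ * t) → mo A w = w :=
    (hφt.prodMk (hφt.comp hζt)).eventually (eventually_carry hw hw)
  obtain ⟨t, ht1, ht2, ht3, ht4, ht5, ht6, ht7, ht8⟩ := (hsep.and (nhdsWithin_le_nhds
    (hcar.and (hφr.and ((hζt.eventually hφr).and ((hφt.eventually hgf).and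
      ((hζt.eventually (hφt.eventually hgf)).and ((hφt.eventually (UH_mem_nhds hw)).and
        (hζt.eventually (hφt.eventually (UH_mem_nhds hw))))))))))).exists
  have heq : f (φ t) = f (φ (ζ * t)) := by
    rw [ht3] at ht5
    rw [ht4, mul_pow, hζ, one_mul] at ht6
    rw [← ht6] at ht5
    exact sub_left_injective ht5
  obtain ⟨e, A, he, hA, hAt⟩ := h.rel_of_eq ht7 ht8 heq
  have hAw := ht2 e A hA hAt
  refine ⟨e, A, he, hA, hAw, ?_⟩
  by_contra hne
  exact ht1 A ⟨hA.det_pos, hA.det_le, hAw⟩ hne hAt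

/-- The stabilizer of a point has twice as many elements as the ramification order. -/
theorem ncard_stabilizer {w : ℂ} (hw : 0 < w.im) {n : ℕ} (hn : n ≠ 0)
    (ho : OrdAt (fun z => f z - f w) w n) :
    {A : M2 | ∃ e, T e ∧ AL e A ∧ mo A w = w}.ncard = 2 * n := by
  classical
  have hfin : {A : M2 | ∃ e, T e ∧ AL e A ∧ mo A w = w}.Finite :=
    (finite_fixers 10 hw).subset fun A ⟨e, _, hA, hAw⟩ => ⟨hA.det_pos, hA.det_le, hAw⟩
  rw [Set.ncard_eq_toFinset_card _ hfin]
  have hcard : (Polynomial.nthRootsFinset n (1 : ℂ)).card = n :=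
    (Complex.isPrimitiveRoot_exp n hn).card_nthRootsFinset
  rw [Finset.card_eq_sum_card_fiberwise (f := fun A : M2 => (A.det : ℂ) / jf A w ^ 2)
    (t := Polynomial.nthRootsFinset n (1 : ℂ))]
  · rw [Finset.sum_const_nat (m := 2), hcard, mul_comm]
    intro ζ hζ
    rw [Polynomial.mem_nthRootsFinset (Nat.pos_of_ne_zero hn)] at hζ
    obtain ⟨e, A, he, hA, hAw, hm⟩ := h.exists_multiplier hw hn ho hζ
    have hnegw : mo (-A) w = w := by rw [mo_neg, hAw]
    have hnegm : ((-A).det : ℂ) / jf (-A) w ^ 2 = ζ := by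
      have h1 : jf (-A) w = - jf A w := by simp [jf]; ring
      have h2 : (-A).det = A.det := by simp [det_fin_two]
      rw [h1, h2, neg_sq, hm]
    rw [Finset.card_eq_two]
    refine ⟨A, -A, ?_, ?_⟩
    · intro hc
      have := congrArg Matrix.det hc
      have hA0 : A = 0 := by
        ext i j
        have := congrFun (congrFun hc i) j
        simp only [Matrix.neg_apply, Matrix.zero_apply] at this ⊢
        omega
      exact hA.det_ne (by simp [hA0])
    · ext B
      simp only [Finset.mem_filter, Set.Finite.mem_toFinset, Finset.mem_insert, Finset.mem_singleton]
      constructor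
      · rintro ⟨⟨e', he', hB, hBw⟩, hBm⟩
        exact hB.eq_or_eq_neg hA hw hBw hAw (hBm.trans hm.symm)
      · rintro (rfl | rfl)
        · exact ⟨⟨e, he, hA, hAw⟩, hm⟩
        · exact ⟨⟨e, he, hA.neg, hnegw⟩, hnegm⟩
  · intro A hA
    obtain ⟨e, he, hA, hAw⟩ := hfin.mem_toFinset.1 hA
    exact (Polynomial.mem_nthRootsFinset (Nat.pos_of_ne_zero hn) 1).2 (h.multiplier_pow hw ho he hA hAw)

end Haupt

end LevelTen

namespace LevelTen

/-- Integral matrices of determinant `n` whose lower left entry is divisible by `10`. -/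
structure Hk (n : ℕ) (A : M2) : Prop where
  det_eq : A.det = n
  dvd_c : (10 : ℤ) ∣ A 1 0

/-- Representatives of the left `Γ₀(10)`-classes: `f • rep f a b d = W f * [[f a, b], [0, f d]]`. -/
def rep (f a b d : ℕ) : M2 :=
  if f = 2 then !![2 * (a : ℤ), b + d; 10 * a, 5 * b + 6 * d]
  else if f = 5 then !![5 * (a : ℤ), b + 2 * d; 10 * a, 2 * b + 5 * d]
  else if f = 10 then !![0, -(d : ℤ); 10 * a, b] else !![(a : ℤ), b; 0, d]

lemma smul_rep {f : ℕ} (hf : f ∣ 10) (a b d : ℕ) :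
    (f : ℤ) • rep f a b d = W f * !![(f * a : ℤ), b; 0, f * d] := by
  rcases dvd_ten_cases hf with rfl | rfl | rfl | rfl <;>
  · ext i j
    fin_cases i <;> fin_cases j <;> simp [rep, W, Matrix.mul_apply, Fin.sum_univ_two] <;> ring

lemma Hk_rep {f : ℕ} (hf : f ∣ 10) (a b d : ℕ) : Hk (f * a * d) (rep f a b d) := by
  rcases dvd_ten_cases hf with rfl | rfl | rfl | rfl <;>
  · constructor
    · simp [rep, Matrix.det_fin_two]; try ring
    · simp [rep]

lemma mo_rep {f : ℕ} (hf : f ∣ 10) {a b d : ℕ} (ha : 0 < a) (hd : 0 < d) {z : ℂ} (hz : 0 < z.im) :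
    mo (rep f a b d) z = mo (W f) ((f * a * z + b) / (f * d)) := by
  have hf0 : 0 < f := Nat.pos_of_dvd_of_pos hf (by norm_num)
  have hdet : (!![(f * a : ℤ), b; 0, f * d] : M2).det ≠ 0 := by
    simp [Matrix.det_fin_two]; omega
  rw [← mo_smul (k := (f : ℤ)) (by omega), smul_rep hf, mo_mul _ _ (jf_ne_zero hdet hz)]
  simp [mo, jf]

lemma AL.eq_mul_W {f : ℕ} {A : M2} (hA : AL f A) : ∃ C, AL 1 C ∧ A = C * W f := by
  obtain ⟨C, h, hC⟩ := hA.mul (AL_W hA.dvd_ten).adjugate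
  rw [star_self hA.dvd_ten] at hC
  refine ⟨C, hC, ?_⟩
  have h1 := congrArg (· * W f) h
  simp only [Matrix.mul_assoc, Matrix.adjugate_mul, (AL_W hA.dvd_ten).det_eq, Nat.gcd_self,
    Matrix.smul_mul, Matrix.mul_smul, Matrix.mul_one] at h1
  exact smul_right_injective _ (by have := hA.pos; omega : (f : ℤ) ≠ 0) h1

lemma Hk.exists_rep {n : ℕ} (hn : 0 < n) {A : M2} (hA : Hk n A) :
    ∃ f a b d : ℕ, f ∣ 10 ∧ f * a * d = n ∧ b < f * d ∧ ∃ C, AL 1 C ∧ A = C * rep f a b d := by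
  obtain ⟨γ, hγ⟩ := hA.dvd_c
  have hdet := hA.det_eq
  rw [Matrix.det_fin_two, hγ] at hdet
  set α := A 0 0 with hα
  set β := A 0 1 with hβ
  set δ := A 1 1 with hδ
  have hne : ¬(α = 0 ∧ γ = 0) := by
    rintro ⟨h1, h2⟩
    rw [h1, h2] at hdet; simp at hdet; omega
  set g := Int.gcd α γ with hg
  have hg0 : 0 < g := Int.gcd_pos_iff.2 (by tauto)
  obtain ⟨d0, hd0⟩ : (g : ℤ) ∣ α := Int.gcd_dvd_left ..
  obtain ⟨c0, hc0⟩ : (g : ℤ) ∣ γ := Int.gcd_dvd_right ..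
  have hcop : IsCoprime d0 c0 := by
    have h1 : (g : ℤ) = α * Int.gcdA α γ + γ * Int.gcdB α γ := Int.gcd_eq_gcd_ab ..
    refine ⟨Int.gcdA α γ, Int.gcdB α γ, ?_⟩
    have : (g : ℤ) * (Int.gcdA α γ * d0 + Int.gcdB α γ * c0) = g * 1 := by
      linear_combination -h1 - Int.gcdA α γ * hd0 - Int.gcdB α γ * hc0
    exact mul_left_cancel₀ (by omega) this
  set f := Int.gcd d0 10 with hf
  have hf10 : f ∣ 10 := by
    have : (f : ℤ) ∣ 10 := Int.gcd_dvd_right ..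
    exact_mod_cast this
  have hfd0 : (f : ℤ) ∣ d0 := Int.gcd_dvd_left ..
  obtain ⟨f', hf'⟩ := hf10
  have hf'Z : (10 : ℤ) = f * f' := by exact_mod_cast hf'
  have hcop2 : IsCoprime d0 (f' : ℤ) := by
    rw [Int.isCoprime_iff_gcd_eq_one]
    have h1 : Int.gcd d0 f' ∣ f := by
      rw [hf]
      refine Nat.dvd_gcd (Int.natCast_dvd.1 (Int.gcd_dvd_left d0 f')) ?_
      have : (Int.gcd d0 f' : ℤ) ∣ (f' : ℤ) := Int.gcd_dvd_right ..
      have h3 : Int.gcd d0 f' ∣ f' := by exact_mod_cast this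
      simpa using h3.trans (Dvd.intro_left f hf'.symm)
    have h2 : Int.gcd d0 f' ∣ f' := by
      have : (Int.gcd d0 f' : ℤ) ∣ (f' : ℤ) := Int.gcd_dvd_right ..
      exact_mod_cast this
    have h3 : Nat.Coprime f f' := by
      have hh : f ∣ 10 := ⟨f', hf'⟩
      rcases dvd_ten_cases hh with h | h | h | h <;> rw [h] at hf' ⊢
      · simp
      · obtain rfl : f' = 5 := by omega
        decide
      · obtain rfl : f' = 2 := by omega
        decide
      · obtain rfl : f' = 1 := by omega
        decide
    exact Nat.eq_one_of_dvd_coprimes h3 h1 h2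
  obtain ⟨x, y, hxy⟩ := hcop2.mul_right hcop
  have hfpos : 0 < f := Nat.pos_of_ne_zero (by rintro h; rw [h] at hf'; omega)
  -- the triangularising matrix
  obtain ⟨e, he⟩ : (f : ℤ) ∣ (-(10 * c0) * β + d0 * δ) :=
    dvd_add ((Dvd.intro _ hf'Z.symm).mul_right c0 |>.neg_right.mul_right β) (hfd0.mul_right δ)
  have hend : (f : ℤ) * g * e = n := by
    have : (g : ℤ) * (f * e) = n := by
      rw [← he, ← hdet, hd0, hc0]; ring
    linarith
  have he0 : 0 < e := by
    have : 0 < (f : ℤ) * g * e := by rw [hend]; exact_mod_cast hn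
    exact (pos_iff_pos_of_mul_pos this).1 (by positivity)
  lift e to ℕ using he0.le
  set s := f * x * β + y * δ with hs
  set k := s / (f * e) with hk
  have hmodn : 0 ≤ s % (f * e) := Int.emod_nonneg _ (by positivity)
  have hmodl : s % (f * e) < f * e := Int.emod_lt_of_pos _ (by positivity)
  obtain ⟨b, hb⟩ := Int.eq_ofNat_of_zero_le hmodn
  have hsk : s - k * (f * e) = b := by
    have := Int.emod_add_mul_ediv s (f * e); rw [← hb]; linarith
  set D : M2 := !![f * x - k * (-(10 * c0)), y - k * d0; -(10 * c0), d0] with hD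
  have hALD : AL f D := by
    refine AL.of ⟨f', hf'⟩ ?_ hfd0 ?_ ?_
    · rw [hf'Z]; exact ⟨x + k * (f' * c0), by ring⟩
    · exact ⟨-c0, by ring⟩
    · linear_combination (f : ℤ) * hxy + y * c0 * hf'Z
  have hDA : D * A = !![(f * g : ℤ), b; 0, f * e] := by
    ext i j
    fin_cases i <;> fin_cases j <;>
      simp only [hD, Matrix.mul_apply, Fin.sum_univ_two, Fin.zero_eta, Fin.mk_one, Fin.isValue,
        Matrix.of_apply, Matrix.cons_val', Matrix.cons_val_zero, Matrix.cons_val_fin_one,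
        Matrix.cons_val_one, ← hα, ← hβ, ← hδ, hγ]
    · rw [hd0, hc0]; linear_combination (f : ℤ) * g * hxy + y * c0 * g * hf'Z
    · rw [← hsk, hs]; linear_combination -k * he
    · rw [hd0, hc0]; ring
    · exact he
  obtain ⟨C, hC, hCe⟩ := hALD.adjugate.eq_mul_W
  refine ⟨f, g, b, e, ⟨f', hf'⟩, by exact_mod_cast hend, by omega, C, hC, ?_⟩
  have h1 : (f : ℤ) • A = (f : ℤ) • (C * rep f g b e) := by
    rw [← Matrix.mul_smul, smul_rep ⟨f', hf'⟩, ← Matrix.mul_assoc, ← hCe, ← hDA,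
      ← Matrix.mul_assoc, Matrix.adjugate_mul, hALD.det_eq]
    simp
  exact smul_right_injective _ (by omega : (f : ℤ) ≠ 0) h1

lemma rep_unique {f a b d f' a' b' d' : ℕ} (hf : f ∣ 10) (hf' : f' ∣ 10) (ha : 0 < a) (hd : 0 < d)
    (ha' : 0 < a') (hdd : f * a * d = f' * a' * d') (hb : b < f * d) (hb' : b' < f' * d')
    {C : M2} (hC : AL 1 C) (h : rep f' a' b' d' = C * rep f a b d) :
    f = f' ∧ a = a' ∧ b = b' := by
  have hf0 : 0 < f := Nat.pos_of_dvd_of_pos hf (by norm_num)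
  have hf0' : 0 < f' := Nat.pos_of_dvd_of_pos hf' (by norm_num)
  obtain ⟨X, hX, hXA⟩ := (AL_W hf').adjugate.mul hC
  rw [star_one] at hXA
  obtain ⟨E, hE, hEA⟩ := hXA.mul (AL_W hf)
  simp only [Nat.gcd_one_right, Nat.cast_one, one_smul] at hX
  set g := Nat.gcd f' f with hg
  have hg0 : 0 < g := Nat.gcd_pos_of_pos_left _ hf0'
  have key : ((f : ℤ) * f') • !![(f' * a' : ℤ), b'; 0, f' * d'] =
      ((f' : ℤ) * g) • (E * !![(f * a : ℤ), b; 0, f * d]) := by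
    have h1 := smul_rep hf' a' b' d'
    have h2 := smul_rep hf a b d
    have h3 := congrArg (fun Y => (f : ℤ) • ((W f').adjugate * Y)) h1
    simp only [← Matrix.mul_assoc, Matrix.adjugate_mul, (AL_W hf').det_eq] at h3
    rw [h] at h3
    rw [mul_smul, mul_smul, ← Matrix.smul_mul, ← hE, ← hX, Matrix.mul_assoc, ← h2]
    rw [Matrix.smul_mul, Matrix.one_mul] at h3
    rw [← h3]
    simp only [Matrix.mul_smul, Matrix.mul_assoc]
    rw [smul_comm]
  have k00 := congrFun₂ key 0 0
  have k10 := congrFun₂ key 1 0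
  have k01 := congrFun₂ key 0 1
  simp [Matrix.mul_apply, Fin.sum_univ_two, hf0.ne', hf0'.ne', hg0.ne', ha.ne'] at k00 k10 k01
  have hE00 : 0 < E 0 0 := by
    have h5 : 0 < ((f' : ℤ) * g * (f * a)) * E 0 0 := by
      have : 0 < (f : ℤ) * f' * (f' * a') := by positivity
      nlinarith
    exact (pos_iff_pos_of_mul_pos h5).1 (by positivity)
  have hdet := hEA.det_eq
  rw [Matrix.det_fin_two, k10, mul_zero, sub_zero] at hdet
  have he1 : star f' f = 1 := by
    have h6 : ((star f' f : ℕ) : ℤ) * star f' f ∣ star f' f := by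
      conv_rhs => rw [← hdet]
      exact mul_dvd_mul hEA.dvd_a hEA.dvd_d
    have h7 : star f' f * star f' f ∣ star f' f := by exact_mod_cast h6
    have h8 := Nat.le_of_dvd hEA.pos h7
    have := hEA.pos
    nlinarith
  have hff : f = f' := by
    have := star_star hf' hf
    rw [he1, star_comm, star_one] at this
    exact this
  subst hff
  rw [he1] at hdet
  have hE00' : E 0 0 = 1 := Int.eq_one_of_mul_eq_one_right hE00.le (by simpa using hdet)
  rw [show g = f by simp [hg]] at k00 k01
  have hfz : (f : ℤ) ≠ 0 := by omega
  rw [hE00'] at k00 k01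
  have haa : a = a' := by
    have : (f : ℤ) * f * f * a = f * f * f * a' := by linarith
    exact_mod_cast mul_left_cancel₀ (by positivity) this
  subst haa
  refine ⟨rfl, rfl, ?_⟩
  have hdd' : d = d' := Nat.eq_of_mul_eq_mul_left (by positivity) hdd
  subst hdd'
  have hbb : (b' : ℤ) = b + E 0 1 * (f * d) := by
    have : (f : ℤ) * f * b' = f * f * (b + E 0 1 * (f * d)) := by linarith
    exact mul_left_cancel₀ (by positivity) this
  have hlt : (b : ℤ) < f * d := by exact_mod_cast hb
  have hlt' : (b' : ℤ) < f * d := by exact_mod_cast hb'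
  have hE01 : E 0 1 = 0 := by
    have hp : 0 < (f * d : ℤ) := by positivity
    by_contra hne
    rcases lt_or_gt_of_ne hne with h | h <;> nlinarith
  rw [hE01] at hbb
  omega

/-- The index set of the left `Γ₀(10)`-classes in `Hk n`. -/
def idx (n : ℕ) : Finset (Σ _ : ℕ, Σ _ : ℕ, ℕ) :=
  D10.sigma fun f => ((Nat.divisors n).filter fun a => f * a ∣ n).sigma fun a => Finset.range (n / a)

/-- The representative attached to an index. -/
def repI (n : ℕ) (i : Σ _ : ℕ, Σ _ : ℕ, ℕ) : M2 := rep i.1 i.2.1 i.2.2 (n / (i.1 * i.2.1))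

lemma mem_idx {n : ℕ} (hn : 0 < n) {i : Σ _ : ℕ, Σ _ : ℕ, ℕ} :
    i ∈ idx n ↔ i.1 ∣ 10 ∧ i.1 * i.2.1 ∣ n ∧ i.2.2 < n / i.2.1 := by
  simp only [idx, Finset.mem_sigma, Finset.mem_filter, Nat.mem_divisors, Finset.mem_range]
  constructor
  · tauto
  · rintro ⟨h1, h2, h3⟩
    exact ⟨⟨h1, by norm_num⟩, ⟨⟨(Dvd.intro_left _ rfl).trans h2, hn.ne'⟩, h2⟩, h3⟩

lemma idx_data {n : ℕ} (hn : 0 < n) {i : Σ _ : ℕ, Σ _ : ℕ, ℕ} (hi : i ∈ idx n) :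
    i.1 ∣ 10 ∧ 0 < i.2.1 ∧ 0 < n / (i.1 * i.2.1) ∧ i.1 * i.2.1 * (n / (i.1 * i.2.1)) = n ∧
      i.2.2 < i.1 * (n / (i.1 * i.2.1)) := by
  obtain ⟨h1, ⟨d, hd⟩, h3⟩ := (mem_idx hn).1 hi
  have hpos : 0 < i.1 * i.2.1 := Nat.pos_of_ne_zero (by rintro h; rw [h] at hd; omega)
  have ha : 0 < i.2.1 := Nat.pos_of_mul_pos_left hpos
  have hdiv : n / (i.1 * i.2.1) = d := by rw [hd, Nat.mul_div_cancel_left _ hpos]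
  rw [hdiv]
  refine ⟨h1, ha, Nat.pos_of_ne_zero (by rintro rfl; omega), hd.symm, ?_⟩
  have : n / i.2.1 = i.1 * d := by
    rw [hd, show i.1 * i.2.1 * d = i.2.1 * (i.1 * d) by ring, Nat.mul_div_cancel_left _ ha]
  omega

lemma Hk_repI {n : ℕ} (hn : 0 < n) {i : Σ _ : ℕ, Σ _ : ℕ, ℕ} (hi : i ∈ idx n) : Hk n (repI n i) := by
  obtain ⟨h1, -, -, h4, -⟩ := idx_data hn hi
  have := Hk_rep h1 i.2.1 i.2.2 (n / (i.1 * i.2.1))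
  rwa [h4] at this

lemma exists_idx {n : ℕ} (hn : 0 < n) {A : M2} (hA : Hk n A) :
    ∃ i ∈ idx n, ∃ C, AL 1 C ∧ A = C * repI n i := by
  obtain ⟨f, a, b, d, hf, hfad, hb, C, hC, hAC⟩ := hA.exists_rep hn
  have hpos : 0 < f * a := Nat.pos_of_ne_zero (by rintro h; rw [h] at hfad; omega)
  have hdiv : n / (f * a) = d := by rw [← hfad, Nat.mul_div_cancel_left _ hpos]
  refine ⟨⟨f, a, b⟩, (mem_idx hn).2 ⟨hf, ⟨d, hfad.symm⟩, ?_⟩, C, hC, by simpa [repI, hdiv] using hAC⟩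
  have ha : 0 < a := Nat.pos_of_mul_pos_left hpos
  simp only
  rw [← hfad, show f * a * d = a * (f * d) by ring, Nat.mul_div_cancel_left _ ha]
  exact hb

lemma idx_unique {n : ℕ} (hn : 0 < n) {i j : Σ _ : ℕ, Σ _ : ℕ, ℕ} (hi : i ∈ idx n) (hj : j ∈ idx n)
    {C : M2} (hC : AL 1 C) (h : repI n j = C * repI n i) : i = j := by
  obtain ⟨h1, h2, h3, h4, h5⟩ := idx_data hn hi
  obtain ⟨k1, k2, k3, k4, k5⟩ := idx_data hn hj
  obtain ⟨e1, e2, e3⟩ := rep_unique h1 k1 h2 h3 k2 (h4.trans k4.symm) h5 k5 hC h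
  obtain ⟨f, a, b⟩ := i
  obtain ⟨f', a', b'⟩ := j
  simp only at e1 e2 e3
  subst e1 e2 e3
  rfl

end LevelTen

namespace LevelTen

lemma analyticAt_of_differentiable {f : ℂ → ℂ} (hf : ∀ z : ℂ, 0 < z.im → DifferentiableAt ℂ f z)
    {z : ℂ} (hz : 0 < z.im) : AnalyticAt ℂ f z :=
  DifferentiableOn.analyticAt (s := UH) (fun w hw => (hf w hw).differentiableWithinAt)
    (UH_mem_nhds hz)

/-- The constants comparing differences of `jE e` with differences of `jj`. -/
lemma exists_gamma : ∃ γ : ℕ → ℂ, ∀ f ∈ D10, γ f ≠ 0 ∧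
    (∀ z w : ℂ, 0 < z.im → 0 < w.im → jE f z - jE f w = γ f * (jj z - jj w) / (V f z * V f w)) ∧
    ∀ z : ℂ, 0 < z.im → deriv (jE f) z = γ f * deriv jj z / V f z ^ 2 := by
  obtain ⟨β, hβ⟩ := exists_beta
  refine ⟨fun f => if f = 1 then 1 else -β f, fun f hf => ?_⟩
  by_cases hf1 : f = 1
  · subst hf1
    refine ⟨by simp, fun z w _ _ => by simp [jE_one, V_one], fun z _ => ?_⟩
    rw [show jE 1 = jj from funext jE_one]
    simp [V_one]
  · have hd := mem_D10.1 hf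
    simp only [hf1, if_false]
    obtain ⟨h0, h⟩ := hβ f hf hf1
    have hVne : ∀ z : ℂ, 0 < z.im → V f z ≠ 0 := fun z hz => V_ne_zero f hz
    refine ⟨neg_ne_zero.2 h0, fun z w hz hw => ?_, fun z hz => ?_⟩
    · rw [(h z hz).2, (h w hw).2, show jj z - jj w = V f z - V f w by
        rw [V_eq hd hf1 hz, V_eq hd hf1 hw]; ring]
      have := hVne z hz
      have := hVne w hw
      field_simp
      ring
    · have hev : jE f =ᶠ[nhds z] fun w => β f / (jj w + kc f) - kc f := by
        filter_upwards [UH_mem_nhds hz] with w hw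
        rw [(h w hw).2, V_eq hd hf1 hw]
      rw [hev.deriv_eq]
      have hj := (differentiableAt_jj hz).hasDerivAt
      have hne : jj z + kc f ≠ 0 := by rw [← V_eq hd hf1 hz]; exact hVne z hz
      have := (((hasDerivAt_const z (β f)).div (hj.add_const (kc f)) hne).sub_const (kc f)).deriv
      refine this.trans ?_
      rw [V_eq hd hf1 hz]
      field_simp
      ring

/-- The kernel `∏_e (jE e z - jE e w)`. -/
noncomputable def KK (z w : ℂ) : ℂ := ∏ e ∈ D10, (jE e z - jE e w)

/-- The eta quotient `∏_e V e`. -/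
noncomputable def VV (z : ℂ) : ℂ := ∏ e ∈ D10, V e z

/-- The product of the derivatives of the `jE e`, a form of weight `8`. -/
noncomputable def SS (z : ℂ) : ℂ := ∏ e ∈ D10, deriv (jE e) z

/-- The eta product `η(z)η(2z)η(5z)η(10z)`. -/
noncomputable def hh : ℂ → ℂ := etaQ (fun _ => 1)

lemma card_D10 : D10.card = 4 := by decide

lemma VV_ne_zero {z : ℂ} (hz : 0 < z.im) : VV z ≠ 0 :=
  Finset.prod_ne_zero_iff.2 fun e _ => V_ne_zero e hz

lemma exists_KK : ∃ Γ : ℂ, Γ ≠ 0 ∧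
    (∀ z w : ℂ, 0 < z.im → 0 < w.im → KK z w = Γ * (jj z - jj w) ^ 4 / (VV z * VV w)) ∧
    ∀ z : ℂ, 0 < z.im → SS z = Γ * deriv jj z ^ 4 / VV z ^ 2 := by
  obtain ⟨γ, hγ⟩ := exists_gamma
  refine ⟨∏ f ∈ D10, γ f, Finset.prod_ne_zero_iff.2 fun f hf => (hγ f hf).1, fun z w hz hw => ?_,
    fun z hz => ?_⟩
  · rw [KK, VV, VV, Finset.prod_congr rfl fun f hf => (hγ f hf).2.1 z w hz hw,
      Finset.prod_div_distrib, Finset.prod_mul_distrib, Finset.prod_mul_distrib, Finset.prod_const,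
      card_D10]
  · rw [SS, VV, Finset.prod_congr rfl fun f hf => (hγ f hf).2.2 z hz,
      Finset.prod_div_distrib, Finset.prod_mul_distrib, Finset.prod_const, Finset.prod_pow, card_D10]

lemma KK_mo {e : ℕ} {A : M2} (hA : AL e A) {z w : ℂ} (hz : 0 < z.im) (hw : 0 < w.im) :
    KK (mo A z) (mo A w) = KK z w := by
  rw [KK, KK, ← prod_star hA.dvd_ten (fun e => jE e z - jE e w)]
  exact Finset.prod_congr rfl fun f hf => by
    rw [jE_mo (mem_D10.1 hf) hA hz, jE_mo (mem_D10.1 hf) hA hw]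

lemma KK_mo_right {A : M2} (hA : AL 1 A) (z : ℂ) {w : ℂ} (hw : 0 < w.im) :
    KK z (mo A w) = KK z w := by
  rw [KK, KK]
  exact Finset.prod_congr rfl fun f hf => by
    rw [jE_mo (mem_D10.1 hf) hA hw, star_one]

lemma SS_mo {e : ℕ} {A : M2} (hA : AL e A) {z : ℂ} (hz : 0 < z.im) :
    SS (mo A z) * (e / jf A z ^ 2) ^ 4 = SS z := by
  rw [SS, SS, ← prod_star hA.dvd_ten (fun e => deriv (jE e) z), ← card_D10, ← Finset.prod_const,
    ← Finset.prod_mul_distrib]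
  refine Finset.prod_congr rfl fun f hf => ?_
  have hfd := mem_D10.1 hf
  have h1 : (jE f ∘ mo A) =ᶠ[nhds z] jE (star f e) := by
    filter_upwards [UH_mem_nhds hz] with w hw using jE_mo hfd hA hw
  rw [← h1.deriv_eq]
  have h2 := hasDerivAt_mo A (jf_ne_zero hA.det_ne hz)
  rw [((differentiableAt_jE hfd (hA.mo_im_pos hz)).hasDerivAt.comp z h2).deriv, hA.det_eq]
  simp

lemma hh_mo {e : ℕ} {A : M2} (hA : AL e A) {z : ℂ} (hz : 0 < z.im) :
    hh (mo A z) ^ 24 * (e / jf A z ^ 2) ^ 24 = hh z ^ 24 := by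
  have hj := jf_ne_zero hA.det_ne hz
  have h := etaQ_pow_mo (fun _ => 1) hA hz
  rw [← hh] at h
  rw [h, Finset.sum_const, card_D10]
  have hp : (∏ d ∈ D10, ((Nat.gcd d e : ℕ) : ℂ) ^ (-12 * (1 : ℤ))) = ((e : ℂ) ^ 24)⁻¹ := by
    rw [D10_eq]
    rcases dvd_ten_cases hA.dvd_ten with rfl | rfl | rfl | rfl <;> norm_num
  rw [hp]
  have he : (e : ℂ) ≠ 0 := by exact_mod_cast hA.pos.ne'
  have : jf A z ^ (12 * ((4 : ℕ) • (1 : ℤ))) = jf A z ^ 48 := by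
    rw [← zpow_natCast]; norm_num
  rw [this]
  field_simp

/-- The matrix lies in the class of a scalar. -/
def Sc (B : M2) : Prop := ∃ (k : ℤ) (C : M2), AL 1 C ∧ B = k • C

open Classical in
/-- The factor attached to a class in `Γ₀(10) \ Hk n`. -/
noncomputable def Fc (B : M2) (z : ℂ) : ℂ :=
  if Sc B then SS z ^ 6 / hh z ^ 24 else KK z (mo B z) ^ 6

lemma AL.one_inv {C : M2} (hC : AL 1 C) : C.adjugate * C = 1 ∧ C * C.adjugate = 1 := by
  rw [Matrix.adjugate_mul, Matrix.mul_adjugate, hC.det_eq]; simp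

lemma Sc.mul {C B : M2} (hC : AL 1 C) (h : Sc B) : Sc (C * B) := by
  obtain ⟨k, D, hD, rfl⟩ := h
  exact ⟨k, C * D, hC.mul_one_type hD, by rw [Matrix.mul_smul]⟩

lemma Sc_mul_iff {C B : M2} (hC : AL 1 C) : Sc (C * B) ↔ Sc B := by
  refine ⟨fun h => ?_, Sc.mul hC⟩
  have := h.mul hC.adjugate
  rwa [← Matrix.mul_assoc, hC.one_inv.1, Matrix.one_mul] at this

lemma Fc_mul {C B : M2} (hC : AL 1 C) (hB : 0 < B.det) {z : ℂ} (hz : 0 < z.im) :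
    Fc (C * B) z = Fc B z := by
  unfold Fc
  rw [Sc_mul_iff hC, mo_mul _ _ (jf_ne_zero hB.ne' hz), KK_mo_right hC z (mo_im_pos hB hz)]

/-- Conjugation of Hecke matrices by Atkin–Lehner matrices. -/
lemma Hk.conj {n e : ℕ} {A B : M2} (hB : Hk n B) (hA : AL e A) :
    ∃ B', Hk n B' ∧ A.adjugate * B * A = (e : ℤ) • B' := by
  obtain ⟨⟨k, hk⟩, ⟨a, ha⟩, ⟨d, hd⟩, ⟨c, hc⟩, hdet⟩ := hA
  obtain ⟨hBd, ⟨γ, hγ⟩⟩ := hB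
  have hk' : (10 : ℤ) = e * k := by exact_mod_cast hk
  have he : (e : ℤ) ≠ 0 := by rintro h; rw [h] at hk'; omega
  rw [Matrix.det_fin_two, ha, hd, hc] at hdet
  have key : A.adjugate * B * A = (e : ℤ) • !![(e * d * B 0 0 - A 0 1 * (10 * γ)) * a
        + (e * d * B 0 1 - A 0 1 * B 1 1) * (k * c),
      (d * B 0 0 - k * A 0 1 * γ) * A 0 1 + (e * d * B 0 1 - A 0 1 * B 1 1) * d;
      10 * (a * (-c * B 0 0 + e * a * γ) - k * c ^ 2 * B 0 1 + c * a * B 1 1),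
      (-(k * c) * B 0 0 + a * (10 * γ)) * A 0 1 + (-(10 * c) * B 0 1 + e * a * B 1 1) * d] := by
    ext i j
    fin_cases i <;> fin_cases j <;>
      simp [Matrix.adjugate_fin_two, Matrix.mul_apply, Matrix.vecMul, dotProduct,
        Fin.sum_univ_two, ha, hd, hc, hγ]
    · linear_combination (e * d * B 0 1 - A 0 1 * B 1 1) * c * hk'
    · linear_combination -(A 0 1 * γ * A 0 1) * hk'
    · linear_combination -(10 * c ^ 2 * B 0 1) * hk'
    · linear_combination -(c * B 0 0 * A 0 1) * hk'
  refine ⟨_, ⟨?_, ?_⟩, key⟩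
  · have h2 := congrArg Matrix.det key
    rw [det_mul, det_mul, det_adjugate_two, hBd, Matrix.det_smul, Fintype.card_fin] at h2
    have h3 : A.det = e := by rw [Matrix.det_fin_two, ha, hd, hc]; exact hdet
    rw [h3] at h2
    have : (e : ℤ) ^ 2 * n = e ^ 2 * _ := (by ring : (e : ℤ) ^ 2 * n = e * n * e).trans h2
    exact (mul_left_cancel₀ (by positivity) this).symm
  · exact ⟨_, rfl⟩

lemma conj_symm {e : ℕ} {A B B' : M2} (hA : AL e A) (h : A.adjugate * B * A = (e : ℤ) • B') :
    A * B' * A.adjugate = (e : ℤ) • B := by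
  have he : (e : ℤ) ≠ 0 := by have := hA.pos; omega
  refine smul_right_injective _ he ?_
  calc (e : ℤ) • (A * B' * A.adjugate) = A * ((e : ℤ) • B') * A.adjugate := by
        rw [Matrix.mul_smul, Matrix.smul_mul]
    _ = (A * A.adjugate) * B * (A * A.adjugate) := by rw [← h]; simp only [Matrix.mul_assoc]
    _ = (e : ℤ) • ((e : ℤ) • B) := by
        rw [Matrix.mul_adjugate, hA.det_eq, Matrix.smul_mul, Matrix.one_mul, Matrix.mul_smul,
          Matrix.mul_one]

lemma AL.conj_one {e : ℕ} {A C : M2} (hA : AL e A) (hC : AL 1 C) :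
    ∃ C', AL 1 C' ∧ A * C * A.adjugate = (e : ℤ) • C' := by
  obtain ⟨X, hX, hXA⟩ := hA.mul hC
  rw [star_one] at hXA
  obtain ⟨E, hE, hEA⟩ := hXA.mul hA.adjugate
  rw [star_self hA.dvd_ten] at hEA
  exact ⟨E, hEA, by rw [hX]; simpa using hE⟩

lemma Sc.conj {e : ℕ} {A B B' : M2} (hA : AL e A) (h : A * B' * A.adjugate = (e : ℤ) • B)
    (hB : Sc B') : Sc B := by
  obtain ⟨k, C, hC, rfl⟩ := hB
  obtain ⟨C', hC', h'⟩ := hA.conj_one hC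
  refine ⟨k, C', hC', ?_⟩
  have he : (e : ℤ) ≠ 0 := by have := hA.pos; omega
  refine smul_right_injective _ he ?_
  simp only
  rw [← h, Matrix.mul_smul, Matrix.smul_mul, h', smul_comm]

lemma adjugate_adjugate_two (A : M2) : A.adjugate.adjugate = A := by
  ext i j; fin_cases i <;> fin_cases j <;> simp [Matrix.adjugate_fin_two]

lemma Fc_mo {n e : ℕ} (hn : 0 < n) {A B B' : M2} (hA : AL e A) (hB : Hk n B) (hB' : Hk n B')
    (h : A.adjugate * B * A = (e : ℤ) • B') {z : ℂ} (hz : 0 < z.im) : Fc B (mo A z) = Fc B' z := by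
  have h' := conj_symm hA h
  have hsc : Sc B ↔ Sc B' := by
    refine ⟨fun hs => ?_, fun hs => hs.conj hA h'⟩
    exact hs.conj hA.adjugate (by rwa [adjugate_adjugate_two])
  have hBd : 0 < B.det := by rw [hB.det_eq]; exact_mod_cast hn
  have hBd' : 0 < B'.det := by rw [hB'.det_eq]; exact_mod_cast hn
  have hAz := hA.mo_im_pos hz
  unfold Fc
  rw [hsc]
  split_ifs
  · have h1 := SS_mo hA hz
    have h2 := hh_mo hA hz
    have hj := jf_ne_zero hA.det_ne hz
    have he : (e : ℂ) ≠ 0 := by exact_mod_cast hA.pos.ne'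
    have hq : (e / jf A z ^ 2 : ℂ) ≠ 0 := div_ne_zero he (pow_ne_zero _ hj)
    have h3 : hh (mo A z) ≠ 0 := etaQ_ne_zero _ hAz
    rw [← h1, ← h2, mul_pow, ← pow_mul, mul_div_mul_right _ _ (pow_ne_zero _ hq)]
  · have h1 : mo B (mo A z) = mo A (mo B' z) := by
      have he : (e : ℤ) ≠ 0 := by have := hA.pos; omega
      have h2 : (e : ℤ) • (B * A) = (e : ℤ) • (A * B') := by
        rw [← Matrix.mul_smul A, ← h, ← Matrix.mul_assoc, ← Matrix.mul_assoc, Matrix.mul_adjugate,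
          hA.det_eq, Matrix.smul_mul, Matrix.one_mul, Matrix.smul_mul]
      rw [← mo_mul _ _ (jf_ne_zero hA.det_ne hz), ← mo_mul _ _ (jf_ne_zero hBd'.ne' hz),
        smul_right_injective _ he h2]
    rw [h1, KK_mo hA hz (mo_im_pos hBd' hz)]

/-- The product of all the class factors. -/
noncomputable def HH (n : ℕ) (z : ℂ) : ℂ := ∏ i ∈ idx n, Fc (repI n i) z

lemma Hk.det_pos {n : ℕ} (hn : 0 < n) {B : M2} (hB : Hk n B) : 0 < B.det := by
  rw [hB.det_eq]; exact_mod_cast hn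

lemma invS_HH {n : ℕ} (hn : 0 < n) : InvS (HH n) := by
  intro e A hA z hz
  have he : (e : ℤ) ≠ 0 := by have := hA.pos; omega
  have hex : ∀ i ∈ idx n, ∃ j ∈ idx n, ∃ C, AL 1 C ∧
      A.adjugate * repI n i * A = (e : ℤ) • (C * repI n j) := by
    intro i hi
    obtain ⟨B', hB', h⟩ := (Hk_repI hn hi).conj hA
    obtain ⟨j, hj, C, hC, rfl⟩ := exists_idx hn hB'
    exact ⟨j, hj, C, hC, h⟩
  choose! σ hσ C hC hCe using hex
  have hHk : ∀ i ∈ idx n, Hk n (C i * repI n (σ i)) := by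
    intro i hi
    obtain ⟨B', hB', h⟩ := (Hk_repI hn hi).conj hA
    rwa [← smul_right_injective _ he ((hCe i hi).symm.trans h)] at hB'
  have hinj : Set.InjOn σ (idx n) := by
    intro i hi j hj hij
    have h1 := conj_symm hA (hCe i hi)
    have h2 := conj_symm hA (hCe j hj)
    obtain ⟨Y, hY, hYe⟩ := hA.conj_one ((hC i hi).mul_one_type (hC j hj).adjugate)
    refine (idx_unique hn hj hi hY ?_).symm
    refine smul_right_injective _ he (smul_right_injective _ he ?_)
    simp only
    calc (e : ℤ) • (e : ℤ) • repI n i = (e : ℤ) • (A * (C i * repI n (σ i)) * A.adjugate) := by rw [h1]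
      _ = A * (C i * (C j).adjugate) * ((e : ℤ) • 1) * ((C j) * repI n (σ j)) * A.adjugate := by
        rw [hij, Matrix.mul_smul, Matrix.mul_one, Matrix.smul_mul, Matrix.smul_mul]
        congr 1
        simp only [Matrix.mul_assoc]
        rw [← Matrix.mul_assoc (C j).adjugate, (hC j hj).one_inv.1, Matrix.one_mul]
      _ = (A * (C i * (C j).adjugate) * A.adjugate) * (A * ((C j) * repI n (σ j)) * A.adjugate) := by
        rw [← hA.det_eq, ← Matrix.adjugate_mul]; simp only [Matrix.mul_assoc]
      _ = _ := by
        rw [h2, hYe, Matrix.smul_mul, Matrix.mul_smul]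
  have hsurj : Set.SurjOn σ (idx n) (idx n) :=
    Finset.surjOn_of_injOn_of_card_le σ (fun i hi => hσ i hi) hinj le_rfl
  refine Finset.prod_nbij σ hσ hinj hsurj fun i hi => ?_
  rw [Fc_mo hn hA (Hk_repI hn hi) (hHk i hi) (hCe i hi) hz,
    Fc_mul (hC i hi) ((Hk_repI hn (hσ i hi)).det_pos hn) hz]

lemma differentiableAt_KK {B : M2} (hB : 0 < B.det) {z : ℂ} (hz : 0 < z.im) :
    DifferentiableAt ℂ (fun z => KK z (mo B z)) z := by
  unfold KK
  refine DifferentiableAt.fun_finsetProd fun e he => ?_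
  exact (differentiableAt_jE (mem_D10.1 he) hz).sub
    ((differentiableAt_jE (mem_D10.1 he) (mo_im_pos hB hz)).comp z (differentiableAt_mo hB.ne' hz))

lemma differentiableAt_SS {z : ℂ} (hz : 0 < z.im) : DifferentiableAt ℂ SS z := by
  unfold SS
  refine DifferentiableAt.fun_finsetProd fun e he => ?_
  exact (analyticAt_of_differentiable (fun w hw => differentiableAt_jE (mem_D10.1 he) hw)
    hz).deriv.differentiableAt

lemma differentiableAt_hh {z : ℂ} (hz : 0 < z.im) : DifferentiableAt ℂ hh z := differentiableAt_etaQ _ hz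

lemma hh_ne_zero {z : ℂ} (hz : 0 < z.im) : hh z ≠ 0 := etaQ_ne_zero _ hz

lemma differentiableAt_Fc {B : M2} (hB : 0 < B.det) {z : ℂ} (hz : 0 < z.im) :
    DifferentiableAt ℂ (Fc B) z := by
  by_cases h : Sc B
  · rw [show Fc B = fun z => SS z ^ 6 / hh z ^ 24 from funext fun z => by rw [Fc, if_pos h]]
    exact ((differentiableAt_SS hz).pow 6).div ((differentiableAt_hh hz).pow 24)
      (pow_ne_zero _ (hh_ne_zero hz))
  · rw [show Fc B = fun z => KK z (mo B z) ^ 6 from funext fun z => by rw [Fc, if_neg h]]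
    exact (differentiableAt_KK hB hz).pow 6

lemma differentiableAt_HH {n : ℕ} (hn : 0 < n) {z : ℂ} (hz : 0 < z.im) :
    DifferentiableAt ℂ (HH n) z := by
  unfold HH
  exact DifferentiableAt.fun_finsetProd fun i hi =>
    differentiableAt_Fc ((Hk_repI hn hi).det_pos hn) hz

end LevelTen

namespace LevelTen

lemma eq_smul_one_of_fix {B : M2} (hB : 0 < B.det) {w : ℂ} (hw : 0 < w.im) (hBw : mo B w = w)
    (h10 : B 1 0 = 0) : ∃ k : ℤ, B = k • (1 : M2) := by
  have hjf : jf B w = B 1 1 := by simp [jf, h10]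
  have hlin : (B 0 0 : ℂ) * w + B 0 1 = B 1 1 * w := by
    have : jf B w ≠ 0 := jf_ne_zero hB.ne' hw
    have h2 := hBw
    rw [mo, div_eq_iff this, hjf] at h2
    rw [h2]; ring
  have h00 : B 0 0 = B 1 1 := by
    have h1 := congrArg Complex.im hlin
    simp only [Complex.add_im, Complex.mul_im, Complex.intCast_re, Complex.intCast_im, zero_mul,
      add_zero] at h1
    exact_mod_cast mul_right_cancel₀ hw.ne' h1
  have h01 : B 0 1 = 0 := by
    rw [h00] at hlin
    have : (B 0 1 : ℂ) = 0 := by linear_combination hlin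
    exact_mod_cast this
  refine ⟨B 1 1, ?_⟩
  ext i j
  fin_cases i <;> fin_cases j <;> simp [h10, h00, h01]

lemma mo_sub_mo {B : M2} {z w : ℂ} (hz : jf B z ≠ 0) (hw : jf B w ≠ 0) :
    mo B z - mo B w = (z - w) * (B.det / (jf B z * jf B w)) := by
  rw [mo, mo, Matrix.det_fin_two]
  field_simp
  simp only [jf]
  push_cast
  ring

lemma analyticAt_mo {B : M2} (hB : B.det ≠ 0) {z : ℂ} (hz : 0 < z.im) : AnalyticAt ℂ (mo B) z :=
  analyticAt_of_differentiable (fun _ hw => differentiableAt_mo hB hw) hz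

lemma ordAt_sub_comp {f : ℂ → ℂ} {B : M2} (hB : 0 < B.det) {w : ℂ} (hw : 0 < w.im)
    (hBw : mo B w = w) {s : ℕ} (ho : OrdAt (fun z => f z - f w) w s)
    (hμ : (B.det / jf B w ^ 2) ^ s ≠ 1) : OrdAt (fun z => f z - f (mo B z)) w s := by
  obtain ⟨u, hu, hu0, hev⟩ := ordAt_iff.1 ho
  have hma := analyticAt_mo hB.ne' hw
  have hc : Filter.Tendsto (mo B) (nhds w) (nhds w) := by
    have := hma.continuousAt.tendsto
    rwa [hBw] at this
  have hj := jf_ne_zero hB.ne' hw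
  have hja : AnalyticAt ℂ (jf B) w := by unfold jf; fun_prop
  have hub : AnalyticAt ℂ (fun z => u (mo B z)) w := AnalyticAt.fun_comp (by rwa [hBw]) hma
  have hv : AnalyticAt ℂ (fun z => (B.det : ℂ) / (jf B z * jf B w)) w :=
    analyticAt_const.div (hja.mul analyticAt_const) (mul_ne_zero hj hj)
  refine ordAt_iff.2 ⟨fun z => u z - (B.det / (jf B z * jf B w)) ^ s * u (mo B z),
    hu.sub ((hv.pow s).mul hub), ?_, ?_⟩
  · simp only [hBw]
    rw [← sq]
    have : u w * (1 - (B.det / jf B w ^ 2 : ℂ) ^ s) ≠ 0 := mul_ne_zero hu0 (sub_ne_zero.2 hμ.symm)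
    convert this using 1
    ring
  · filter_upwards [hev, hc.eventually hev, UH_mem_nhds hw] with z h1 h2 hz
    have h3 := mo_sub_mo (jf_ne_zero hB.ne' hz) hj
    rw [hBw] at h3
    rw [h3, mul_pow] at h2
    linear_combination h1 - h2

lemma OrdAt.deriv {f : ℂ → ℂ} {w : ℂ} {s : ℕ} (hs : s ≠ 0) (ho : OrdAt (fun z => f z - f w) w s) :
    OrdAt (deriv f) w (s - 1) := by
  obtain ⟨u, hu, hu0, hev⟩ := ordAt_iff.1 ho
  obtain ⟨s, rfl⟩ : ∃ t, s = t + 1 := ⟨s - 1, by omega⟩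
  refine ordAt_iff.2 ⟨fun z => (s + 1) * u z + (z - w) * _root_.deriv u z,
    (analyticAt_const.mul hu).add ((analyticAt_id.sub analyticAt_const).mul hu.deriv), ?_, ?_⟩
  · simp only [sub_self, zero_mul, add_zero]
    exact mul_ne_zero (by exact_mod_cast s.succ_ne_zero) hu0
  · filter_upwards [hev.eventually_nhds, hu.eventually_analyticAt] with z h1 h2
    have h3 : f =ᶠ[nhds z] fun z => (z - w) ^ (s + 1) * u z + f w := by
      filter_upwards [h1] with y hy
      linear_combination hy
    rw [h3.deriv_eq]
    have h4 := (((((hasDerivAt_id z).sub_const w).fun_pow (s + 1)).fun_mul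
      h2.differentiableAt.hasDerivAt).add_const (f w)).deriv
    simp only [id, Nat.add_sub_cancel] at h4 ⊢
    rw [h4]
    push_cast
    ring

lemma OrdAt.mul_ne {f g : ℂ → ℂ} {w : ℂ} {m : ℕ} (hf : OrdAt f w m) (hg : AnalyticAt ℂ g w)
    (h0 : g w ≠ 0) : OrdAt (fun z => f z * g z) w m := hf.mul (OrdAt.of_ne hg h0)

lemma analyticAt_VV {w : ℂ} (hw : 0 < w.im) : AnalyticAt ℂ VV w := by
  refine analyticAt_of_differentiable (fun z hz => ?_) hw
  unfold VV
  exact DifferentiableAt.fun_finsetProd fun e _ => differentiableAt_V e hz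

lemma analyticAt_hh {w : ℂ} (hw : 0 < w.im) : AnalyticAt ℂ hh w :=
  analyticAt_of_differentiable (fun _ h => differentiableAt_hh h) hw

/-- The stabilizer of a point in `Γ₀(10)`. -/
def stab (w : ℂ) : Set M2 := {A | AL 1 A ∧ mo A w = w}

lemma exists_ord_jj {w : ℂ} (hw : 0 < w.im) : ∃ s, s ≠ 0 ∧ OrdAt (fun z => jj z - jj w) w s ∧
    (stab w).ncard = 2 * s ∧ ∀ ζ : ℂ, ζ ^ s = 1 → ∃ A ∈ stab w, A.det / jf A w ^ 2 = ζ := by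
  obtain ⟨Fd, G, h⟩ := exists_haupt_jj
  obtain ⟨s, hs, ho⟩ := h.exists_ordAt hw
  refine ⟨s, hs, ho, ?_, fun ζ hζ => ?_⟩
  · rw [← h.ncard_stabilizer hw hs ho]
    congr 1
    ext A
    simp [stab]
  · obtain ⟨e, A, rfl, hA, hAw, hm⟩ := h.exists_multiplier hw hs ho hζ
    exact ⟨A, ⟨hA, hAw⟩, hm⟩

lemma exists_of_jj_eq {z w : ℂ} (hz : 0 < z.im) (hw : 0 < w.im) (h : jj z = jj w) :
    ∃ A, AL 1 A ∧ mo A z = w := by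
  obtain ⟨Fd, G, hH⟩ := exists_haupt_jj
  obtain ⟨e, A, rfl, hA, hAw⟩ := hH.rel_of_eq hz hw h
  exact ⟨A, hA, hAw⟩

/-- Non-scalar members of a class fixing a point. -/
def classFix (B₀ : M2) (w : ℂ) : Set M2 := {B | (∃ C, AL 1 C ∧ B = C * B₀) ∧ B 1 0 ≠ 0 ∧ mo B w = w}

lemma ordAt_Fc_of_Sc {B₀ : M2} (hB₀ : 0 < B₀.det) (hS : Sc B₀) {w : ℂ} (hw : 0 < w.im) :
    OrdAt (Fc B₀) w (12 * (classFix B₀ w).ncard) := by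
  obtain ⟨s, hs, ho, hcard, -⟩ := exists_ord_jj hw
  have hset : (classFix B₀ w).ncard = 2 * s - 2 := by
    obtain ⟨k, C₀, hC₀, rfl⟩ := hS
    have hk : k ≠ 0 := by rintro rfl; simp at hB₀
    have him : classFix (k • C₀) w = (fun A : M2 => k • A) '' (stab w \ {1, -1}) := by
      ext B
      constructor
      · rintro ⟨⟨C, hC, rfl⟩, h10, hfix⟩
        rw [Matrix.mul_smul] at h10 hfix ⊢
        rw [mo_smul hk] at hfix
        refine ⟨C * C₀, ⟨⟨hC.mul_one_type hC₀, hfix⟩, ?_⟩, rfl⟩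
        rintro (h | h) <;> rw [h] at h10 <;> simp at h10
      · rintro ⟨A, ⟨⟨hA, hfix⟩, hne⟩, rfl⟩
        refine ⟨⟨A * C₀.adjugate, hA.mul_one_type hC₀.adjugate, ?_⟩, ?_, ?_⟩
        · rw [Matrix.mul_smul, Matrix.mul_assoc, hC₀.one_inv.1, Matrix.mul_one]
        · intro h10
          have h10' : A 1 0 = 0 := by simpa [hk] using h10
          obtain ⟨l, rfl⟩ := eq_smul_one_of_fix hA.det_pos hw hfix h10'
          have hd := hA.det_eq
          simp only [Matrix.det_smul, Fintype.card_fin, det_one, mul_one, Nat.cast_one] at hd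
          rcases sq_eq_one_iff.1 hd with h | h <;> simp [h] at hne
        · simp only; rw [mo_smul hk, hfix]
    rw [him, Set.ncard_image_of_injective _ (smul_right_injective _ hk),
      Set.ncard_sdiff, hcard, Set.ncard_pair]
    · intro h
      have := congrFun₂ h 0 0
      simp at this
    · rintro A (rfl | rfl)
      · exact ⟨AL.one, mo_one w⟩
      · exact ⟨AL.one.neg, by rw [mo_neg, mo_one]⟩
  obtain ⟨Γ, hΓ, -, hSS⟩ := exists_KK
  have h1 := ((ho.deriv hs).pow 4).pow 6
  have h2 : AnalyticAt ℂ (fun z => (Γ / VV z ^ 2) ^ 6 / hh z ^ 24) w :=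
    ((analyticAt_const.div ((analyticAt_VV hw).pow 2) (pow_ne_zero _ (VV_ne_zero hw))).pow 6).div
      ((analyticAt_hh hw).pow 24) (pow_ne_zero _ (hh_ne_zero hw))
  have h3 := (h1.mul_ne h2 (div_ne_zero (pow_ne_zero _ (div_ne_zero hΓ
    (pow_ne_zero _ (VV_ne_zero hw)))) (pow_ne_zero _ (hh_ne_zero hw)))).congr (g := Fc B₀) (by
      filter_upwards [UH_mem_nhds hw] with z hz
      rw [Fc, if_pos hS, hSS z hz]
      ring)
  convert h3 using 1
  rw [hset]
  omega

lemma ordAt_Fc_of_not_Sc {B₀ : M2} (hB₀ : 0 < B₀.det) (hS : ¬ Sc B₀) {w : ℂ} (hw : 0 < w.im) :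
    OrdAt (Fc B₀) w (12 * (classFix B₀ w).ncard) := by
  obtain ⟨Γ, hΓ, hKK, -⟩ := exists_KK
  have hB₀w := mo_im_pos hB₀ hw
  by_cases hfix : ∃ C, AL 1 C ∧ mo (C * B₀) w = w
  · obtain ⟨C₁, hC₁, hfix⟩ := hfix
    set B := C₁ * B₀ with hB
    have hBS : ¬ Sc B := by rwa [hB, Sc_mul_iff hC₁]
    have hBd : 0 < B.det := by rw [hB, det_mul, hC₁.det_eq]; simpa using hB₀
    obtain ⟨s, hs, ho, hcard, hmult⟩ := exists_ord_jj hw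
    have hset : (classFix B₀ w).ncard = 2 * s := by
      have him : classFix B₀ w = (fun A : M2 => A * B) '' stab w := by
        ext D
        constructor
        · rintro ⟨⟨C, hC, rfl⟩, h10, hf⟩
          refine ⟨C * C₁.adjugate, ⟨hC.mul_one_type hC₁.adjugate, ?_⟩, ?_⟩
          · have h1 : C * C₁.adjugate * B = C * B₀ := by
              rw [hB, Matrix.mul_assoc, ← Matrix.mul_assoc C₁.adjugate, hC₁.one_inv.1, Matrix.one_mul]
            rw [← h1, mo_mul _ _ (jf_ne_zero hBd.ne' hw), hfix] at hf
            exact hf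
          · simp only
            rw [hB, Matrix.mul_assoc, ← Matrix.mul_assoc C₁.adjugate, hC₁.one_inv.1, Matrix.one_mul]
        · rintro ⟨A, ⟨hA, hAw⟩, rfl⟩
          have hABw : mo (A * B) w = w := by rw [mo_mul _ _ (jf_ne_zero hBd.ne' hw), hfix, hAw]
          refine ⟨⟨A * C₁, hA.mul_one_type hC₁, by simp only [hB, Matrix.mul_assoc]⟩, ?_, hABw⟩
          intro h10
          obtain ⟨k, hk⟩ := eq_smul_one_of_fix (by rw [det_mul, hA.det_eq]; simpa using hBd) hw hABw h10
          exact hBS ((Sc_mul_iff hA).1 ⟨k, 1, AL.one, hk⟩)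
      rw [him, Set.ncard_image_of_injective, hcard]
      intro A A' h
      have h1 := congrArg (· * B.adjugate) h
      simp only [Matrix.mul_assoc, Matrix.mul_adjugate, Matrix.mul_smul, Matrix.mul_one] at h1
      exact smul_right_injective _ hBd.ne' h1
    have hμ : (B.det / jf B w ^ 2 : ℂ) ^ s ≠ 1 := by
      intro h
      obtain ⟨A, ⟨hA, hAw⟩, hm⟩ := hmult _ h
      obtain ⟨k, hk, -⟩ := proportional hBd hA.det_pos hw hfix hAw hm.symm
      rw [hA.det_eq] at hk
      exact hBS ⟨k, A, hA, by simpa using hk⟩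
    have hma := analyticAt_mo hBd.ne' hw
    have h1 := ((ordAt_sub_comp hBd hw hfix ho hμ).pow 4).pow 6
    have hVB : AnalyticAt ℂ (fun z => VV (mo B z)) w :=
      AnalyticAt.fun_comp (by rw [hfix]; exact analyticAt_VV hw) hma
    have hne : VV w * VV (mo B w) ≠ 0 := by rw [hfix]; exact mul_ne_zero (VV_ne_zero hw) (VV_ne_zero hw)
    have h2 : AnalyticAt ℂ (fun z => (Γ / (VV z * VV (mo B z))) ^ 6) w :=
      (analyticAt_const.div ((analyticAt_VV hw).mul hVB) hne).pow 6
    have h3 := (h1.mul_ne h2 (pow_ne_zero _ (div_ne_zero hΓ hne))).congr (g := Fc B₀) (by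
      filter_upwards [UH_mem_nhds hw] with z hz
      rw [← Fc_mul hC₁ hB₀ hz, ← hB, Fc, if_neg hBS, hKK z _ hz (mo_im_pos hBd hz)]
      ring)
    convert h3 using 1
    rw [hset]
    omega
  · have hset : classFix B₀ w = ∅ := by
      refine Set.eq_empty_iff_forall_notMem.2 ?_
      rintro B ⟨⟨C, hC, rfl⟩, -, hf⟩
      exact hfix ⟨C, hC, hf⟩
    rw [hset, Set.ncard_empty]
    refine OrdAt.of_ne (analyticAt_of_differentiable (fun z hz => differentiableAt_Fc hB₀ hz) hw) ?_
    rw [Fc, if_neg hS, hKK w _ hw hB₀w]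
    refine pow_ne_zero _ (div_ne_zero (mul_ne_zero hΓ (pow_ne_zero _ (sub_ne_zero.2 fun h => ?_)))
      (mul_ne_zero (VV_ne_zero hw) (VV_ne_zero hB₀w)))
    obtain ⟨A, hA, hAw⟩ := exists_of_jj_eq hB₀w hw h.symm
    exact hfix ⟨A, hA, by rw [mo_mul _ _ (jf_ne_zero hB₀.ne' hw), hAw]⟩

/-- Non-scalar Hecke matrices fixing a point. -/
def fixers (n : ℕ) (w : ℂ) : Set M2 := {B | Hk n B ∧ B 1 0 ≠ 0 ∧ mo B w = w}

lemma finite_fixers_Hk {n : ℕ} (hn : 0 < n) {w : ℂ} (hw : 0 < w.im) : (fixers n w).Finite :=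
  (finite_fixers n hw).subset fun _ ⟨hB, _, hBw⟩ => ⟨hB.det_pos hn, hB.det_eq.le, hBw⟩

theorem ordAt_HH {n : ℕ} (hn : 0 < n) {w : ℂ} (hw : 0 < w.im) :
    OrdAt (HH n) w (12 * (fixers n w).ncard) := by
  classical
  have h1 : OrdAt (HH n) w (∑ i ∈ idx n, 12 * (classFix (repI n i) w).ncard) :=
    OrdAt.prod _ fun i hi => by
      have hd := (Hk_repI hn hi).det_pos hn
      by_cases hS : Sc (repI n i)
      · exact ordAt_Fc_of_Sc hd hS hw
      · exact ordAt_Fc_of_not_Sc hd hS hw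
  convert h1 using 1
  rw [← Finset.mul_sum]
  congr 1
  have hex : ∀ B ∈ fixers n w, ∃ i ∈ idx n, ∃ C, AL 1 C ∧ B = C * repI n i :=
    fun B hB => exists_idx hn hB.1
  choose! ι hι C hC hCe using hex
  rw [Set.ncard_eq_toFinset_card _ (finite_fixers_Hk hn hw),
    Finset.card_eq_sum_card_fiberwise (f := ι) (t := idx n) (by
      intro B hB
      exact hι B (by simpa using hB))]
  refine Finset.sum_congr rfl fun i hi => ?_
  rw [← Set.ncard_coe_finset]
  congr 1
  ext B
  simp only [Finset.coe_filter, Set.Finite.mem_toFinset, Set.mem_ofPred_eq]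
  constructor
  · rintro ⟨hB, rfl⟩
    exact ⟨⟨C B, hC B hB, hCe B hB⟩, hB.2⟩
  · rintro ⟨⟨D, hD, rfl⟩, hB⟩
    have hHk : Hk n (D * repI n i) := by
      have hr := Hk_repI hn hi
      refine ⟨by rw [det_mul, hD.det_eq, hr.det_eq]; simp, ?_⟩
      rw [Matrix.mul_apply, Fin.sum_univ_two]
      exact dvd_add (hD.dvd_c.mul_right _) (hr.dvd_c.mul_left _)
    have hmem : D * repI n i ∈ fixers n w := ⟨hHk, hB⟩
    refine ⟨hmem, ?_⟩
    have h2 := hCe _ hmem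
    refine (idx_unique hn hi (hι _ hmem) ((hC _ hmem).adjugate.mul_one_type hD) ?_).symm
    have h3 := congrArg (fun X => (C (D * repI n i)).adjugate * X) h2
    simp only [← Matrix.mul_assoc, (hC _ hmem).one_inv.1, Matrix.one_mul] at h3
    exact h3.symm

end LevelTen

namespace LevelTen

/-! ### The Fricke group -/

/-- The normalization of an integral matrix of determinant `e`. -/
noncomputable def nrm (e : ℕ) (A : M2) : Matrix (Fin 2) (Fin 2) ℝ :=
  (Real.sqrt e)⁻¹ • A.map (Int.cast : ℤ → ℝ)

lemma det_map_cast (A : M2) : (A.map (Int.cast : ℤ → ℝ)).det = A.det := by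
  simp [Matrix.det_fin_two]

lemma AL.sqrt_pos {e : ℕ} {A : M2} (h : AL e A) : 0 < Real.sqrt e :=
  Real.sqrt_pos.2 (by exact_mod_cast h.pos)

lemma AL.det_nrm {e : ℕ} {A : M2} (h : AL e A) : (nrm e A).det = 1 := by
  have h1 := h.sqrt_pos
  have h2 := Real.sq_sqrt (Nat.cast_nonneg (α := ℝ) e)
  rw [nrm, det_smul, det_map_cast, h.det_eq]
  simp only [Fintype.card_fin, inv_pow, h2, Int.cast_natCast]
  exact inv_mul_cancel₀ (by exact_mod_cast h.pos.ne')

lemma map_cast_mul (A B : M2) : (A * B).map (Int.cast : ℤ → ℝ) =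
    A.map (Int.cast : ℤ → ℝ) * B.map (Int.cast : ℤ → ℝ) := by
  ext i j
  simp [Matrix.mul_apply]

lemma nrm_mul {e f : ℕ} {A B C : M2} (he : e ∣ 10) (hf : f ∣ 10)
    (hC : A * B = ((Nat.gcd e f : ℕ) : ℤ) • C) : nrm e A * nrm f B = nrm (star e f) C := by
  obtain ⟨g, d₁, e₁, m, hd', he', h10, hs, hg⟩ := star_data he hf
  have hg0 : g ≠ 0 := by rintro rfl; simp at h10
  rw [nrm, nrm, nrm, Matrix.smul_mul, Matrix.mul_smul, ← map_cast_mul, hC, hg, hs, smul_smul]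
  have h1 : (((g : ℕ) : ℤ) • C).map (Int.cast : ℤ → ℝ) = (g : ℝ) • C.map (Int.cast : ℤ → ℝ) := by
    ext i j; simp only [Matrix.map_apply, Matrix.smul_apply, smul_eq_mul, Int.cast_mul, Int.cast_natCast]
  rw [h1, smul_smul]
  congr 1
  rw [hd', he']
  push_cast
  have hgr : (g : ℝ) ≠ 0 := by exact_mod_cast hg0
  rw [Real.sqrt_mul (Nat.cast_nonneg _), Real.sqrt_mul (Nat.cast_nonneg _),
    Real.sqrt_mul (Nat.cast_nonneg _)]
  have hsg : Real.sqrt g * Real.sqrt g = g := Real.mul_self_sqrt (Nat.cast_nonneg _)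
  have hsg0 : Real.sqrt g ≠ 0 := fun h => hgr (by rw [← hsg, h, zero_mul])
  simp only [mul_inv]
  rw [show (Real.sqrt g)⁻¹ * (Real.sqrt d₁)⁻¹ * ((Real.sqrt g)⁻¹ * (Real.sqrt e₁)⁻¹) * g =
    (Real.sqrt d₁)⁻¹ * (Real.sqrt e₁)⁻¹ * ((Real.sqrt g * Real.sqrt g)⁻¹ * g) by rw [mul_inv]; ring,
    hsg, inv_mul_cancel₀ hgr, mul_one]

lemma mem_fricke_iff {g : SL2R} : g ∈ FrickeGroup 10 ↔ ∃ e A, AL e A ∧ g.1 = nrm e A := by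
  constructor
  · intro hg
    rw [FrickeGroup] at hg
    induction hg using Subgroup.closure_induction with
    | mem g hg =>
      rcases hg with hg | hg
      · obtain ⟨A, hA, rfl⟩ := hg
        refine ⟨1, A.1, ⟨by norm_num, by simp, by simp, ?_, by simp⟩, ?_⟩
        · have := CongruenceSubgroup.Gamma0_mem.1 hA
          exact (ZMod.intCast_zmod_eq_zero_iff_dvd _ 10).1 (by exact_mod_cast this)
        · ext i j
          simp [nrm]
      · simp only [Set.mem_iUnion] at hg
        obtain ⟨e, ⟨he, -⟩, x, y, z, w, hg⟩ := hg
        have he0 : 0 < e := Nat.pos_of_dvd_of_pos he (by norm_num)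
        have hgA : g.1 = nrm e !![x * e, y; z * 10, w * e] := by
          rw [hg, nrm]
          congr 1
          ext i j
          fin_cases i <;> fin_cases j <;> simp
        refine ⟨e, _, ⟨he, by simp, by simp, by simp, ?_⟩, hgA⟩
        have hd := g.2
        rw [hgA, nrm, det_smul, det_map_cast, Fintype.card_fin, inv_pow,
          Real.sq_sqrt (Nat.cast_nonneg _), inv_mul_eq_one₀ (by exact_mod_cast he0.ne')] at hd
        exact_mod_cast hd.symm
    | one => exact ⟨1, 1, AL.one, by ext i j; simp [nrm, Matrix.one_apply]⟩
    | mul g h _ _ hg hh =>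
      obtain ⟨e, A, hA, h1⟩ := hg
      obtain ⟨f, B, hB, h2⟩ := hh
      obtain ⟨C, hC, hCA⟩ := hA.mul hB
      exact ⟨_, C, hCA, by
        rw [← nrm_mul hA.dvd_ten hB.dvd_ten hC, ← h1, ← h2]; rfl⟩
    | inv g _ hg =>
      obtain ⟨e, A, hA, h1⟩ := hg
      refine ⟨e, A.adjugate, hA.adjugate, ?_⟩
      rw [Matrix.SpecialLinearGroup.coe_inv, h1]
      ext i j
      fin_cases i <;> fin_cases j <;> simp [nrm, Matrix.adjugate_fin_two]
  · rintro ⟨e, A, hA, hg⟩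
    refine Subgroup.subset_closure (Or.inr ?_)
    simp only [Set.mem_iUnion]
    refine ⟨e, ⟨hA.dvd_ten, ?_⟩, ?_⟩
    · rcases dvd_ten_cases hA.dvd_ten with rfl | rfl | rfl | rfl <;> decide
    obtain ⟨x, hx⟩ := hA.dvd_a
    obtain ⟨w, hw⟩ := hA.dvd_d
    obtain ⟨z, hz⟩ := hA.dvd_c
    refine ⟨x, A 0 1, z, w, ?_⟩
    rw [hg, nrm]
    congr 1
    ext i j
    fin_cases i <;> fin_cases j <;> simp [hx, hw, hz, mul_comm]

/-! ### Quadratic forms -/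

lemma im_cmPoint {a b c d : ℤ} (ha : 0 < a) (hd : b ^ 2 - 4 * a * c = -d) (hd0 : 0 < d) :
    0 < (cmPointC (formMat a b c)).im ∧
      (a : ℂ) * cmPointC (formMat a b c) ^ 2 + b * cmPointC (formMat a b c) + c = 0 := by
  have hdet : (formMat a b c).det = (d : ℝ) / 4 := by
    rw [Matrix.det_fin_two]
    simp only [formMat, of_apply, cons_val', cons_val_zero, cons_val_one, cons_val_fin_one]
    have : (b : ℝ) ^ 2 - 4 * a * c = -d := by exact_mod_cast hd
    linear_combination -this / 4
  have hs : 0 < Real.sqrt ((d : ℝ) / 4) := Real.sqrt_pos.2 (by positivity)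
  have hs2 : ((Real.sqrt ((d : ℝ) / 4) : ℝ) : ℂ) ^ 2 = (d : ℂ) / 4 := by
    rw [← Complex.ofReal_pow, Real.sq_sqrt (by positivity)]
    push_cast; ring
  have ha' : (0 : ℝ) < a := by exact_mod_cast ha
  have hac : (a : ℂ) ≠ 0 := by exact_mod_cast ha.ne'
  have hz : cmPointC (formMat a b c) =
      (-(b : ℂ) / 2 + Complex.I * Real.sqrt ((d : ℝ) / 4)) / (a : ℂ) := by
    rw [cmPointC, hdet]
    simp [formMat]
    ring
  constructor
  · rw [hz, show (a : ℂ) = ((a : ℝ) : ℂ) by simp, Complex.div_ofReal_im]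
    refine div_pos ?_ ha'
    have : (-(b : ℂ) / 2 + Complex.I * Real.sqrt ((d : ℝ) / 4)).im = Real.sqrt ((d : ℝ) / 4) := by
      rw [show -(b : ℂ) / 2 = ((-(b : ℝ) / 2 : ℝ) : ℂ) by push_cast; ring]
      simp
    rw [this]; exact hs
  · rw [hz]
    have hdc : (b : ℂ) ^ 2 - 4 * a * c = -d := by exact_mod_cast hd
    field_simp
    linear_combination 4 * Complex.I ^ 2 * hs2 + d * Complex.I_sq - hdc

lemma root_unique {a b c : ℝ} (ha : 0 < a) {z w : ℂ} (hz : 0 < z.im) (hw : 0 < w.im)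
    (h1 : (a : ℂ) * z ^ 2 + b * z + c = 0) (h2 : (a : ℂ) * w ^ 2 + b * w + c = 0) : z = w := by
  have h : (z - w) * (a * (z + w) + b) = 0 := by linear_combination h1 - h2
  rcases mul_eq_zero.1 h with h | h
  · exact sub_eq_zero.1 h
  · have := congrArg Complex.im h
    simp at this
    rcases this with h | h
    · exact absurd h ha.ne'
    · linarith

lemma cmPoint_eq_iff {a b c d : ℤ} (ha : 0 < a) (hd : b ^ 2 - 4 * a * c = -d) (hd0 : 0 < d) {z : ℂ}
    (hz : 0 < z.im) : cmPointC (formMat a b c) = z ↔ (a : ℂ) * z ^ 2 + b * z + c = 0 := by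
  obtain ⟨h1, h2⟩ := im_cmPoint ha hd hd0
  constructor
  · rintro rfl; exact h2
  · intro h
    refine root_unique (a := a) (b := b) (c := c) (by exact_mod_cast ha) h1 hz ?_ ?_
    · exact_mod_cast h2
    · exact_mod_cast h

/-- Positive definite forms with the same discriminant and the same root agree. -/
lemma form_unique {a b c a' b' c' : ℤ} (ha : 0 < a) (ha' : 0 < a')
    (hd : b ^ 2 - 4 * a * c = b' ^ 2 - 4 * a' * c') (hneg : b ^ 2 - 4 * a * c < 0) {z : ℂ}
    (hz : 0 < z.im) (h : (a : ℂ) * z ^ 2 + b * z + c = 0) (h' : (a' : ℂ) * z ^ 2 + b' * z + c' = 0) :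
    a = a' ∧ b = b' ∧ c = c' := by
  have e1 : ((a * b' - a' * b : ℤ) : ℂ) * z + ((a * c' - a' * c : ℤ) : ℂ) = 0 := by
    push_cast; linear_combination a * h' - a' * h
  have e2 : a * b' - a' * b = 0 := by
    have := congrArg Complex.im e1
    simp only [Complex.add_im, Complex.mul_im, Complex.intCast_re, Complex.intCast_im, zero_mul,
      add_zero, Complex.zero_im] at this
    have := (mul_eq_zero.1 this).resolve_right hz.ne'
    exact_mod_cast this
  have e3 : a * c' - a' * c = 0 := by
    rw [e2] at e1
    simp only [Int.cast_zero, zero_mul, zero_add] at e1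
    exact_mod_cast e1
  have e4 : (a ^ 2 - a' ^ 2) * (b ^ 2 - 4 * a * c) = 0 := by
    have hb : a * b' = a' * b := by linarith
    linear_combination a ^ 2 * hd + (a * b' + a' * b) * e2 - 4 * a * a' * e3
  have e5 : a = a' := by
    have := (mul_eq_zero.1 e4).resolve_right hneg.ne
    have : (a - a') * (a + a') = 0 := by linear_combination this
    rcases mul_eq_zero.1 this with h | h <;> linarith
  subst e5
  refine ⟨rfl, ?_, ?_⟩
  · have : a * (b' - b) = 0 := by linear_combination e2
    have := (mul_eq_zero.1 this).resolve_left ha.ne'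
    linarith
  · have : a * (c' - c) = 0 := by linear_combination e3
    have := (mul_eq_zero.1 this).resolve_left ha.ne'
    linarith

/-- The action of Atkin–Lehner matrices on forms. -/
lemma form_transform {e : ℕ} {A : M2} (hA : AL e A) {a b c d : ℤ} (ha : 0 < a)
    (hd : b ^ 2 - 4 * a * c = -d) (hd0 : 0 < d) (h10 : (10 : ℤ) ∣ a) {z : ℂ} (hz : 0 < z.im)
    (hw : (a : ℂ) * mo A z ^ 2 + b * mo A z + c = 0) :
    ∃ a' b' c' : ℤ, (nrm e A)ᵀ * formMat a b c * nrm e A = formMat a' b' c' ∧ 0 < a' ∧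
      b' ^ 2 - 4 * a' * c' = -d ∧ (10 : ℤ) ∣ a' ∧ (a' : ℂ) * z ^ 2 + b' * z + c' = 0 := by
  obtain ⟨α, hα⟩ := hA.dvd_a
  obtain ⟨δ, hδ⟩ := hA.dvd_d
  obtain ⟨γ, hγ⟩ := hA.dvd_c
  set β := A 0 1 with hβ
  obtain ⟨m, hm⟩ := hA.dvd_ten
  obtain ⟨k, rfl⟩ := h10
  have hmz : (10 : ℤ) = e * m := by exact_mod_cast hm
  have he0 : (e : ℤ) ≠ 0 := by exact_mod_cast hA.pos.ne'
  have hdet := hA.det_eq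
  rw [Matrix.det_fin_two, hα, hδ, hγ, ← hβ] at hdet
  have hdet' : e * α * δ - m * β * γ = 1 := by
    refine mul_left_cancel₀ he0 ?_
    rw [hmz] at hdet
    linear_combination hdet
  set a' := 10 * k * e * α ^ 2 + 10 * b * α * γ + 10 * m * c * γ ^ 2 with ha'
  set b' := 2 * (10 * k * α * β) + b * (e * α * δ + m * β * γ) + 2 * (10 * c * γ * δ) with hb'
  set c' := m * k * β ^ 2 + b * β * δ + c * e * δ ^ 2 with hc'
  have hd' : b' ^ 2 - 4 * a' * c' = -d := by
    have : b' ^ 2 - 4 * a' * c' = (e * α * δ - m * β * γ) ^ 2 * (b ^ 2 - 4 * (10 * k) * c) := by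
      rw [ha', hb', hc', hmz]; ring
    rw [this, hdet', hd]; ring
  refine ⟨a', b', c', ?_, ?_, hd', ⟨k * e * α ^ 2 + b * α * γ + m * c * γ ^ 2, by rw [ha']; ring⟩, ?_⟩
  · have hs := Real.sq_sqrt (Nat.cast_nonneg (α := ℝ) e)
    have her : (e : ℝ) ≠ 0 := by exact_mod_cast hA.pos.ne'
    have h1 : (nrm e A)ᵀ * formMat (10 * k) b c * nrm e A = (e : ℝ)⁻¹ •
        ((A.map (Int.cast : ℤ → ℝ))ᵀ * formMat (10 * k) b c * A.map (Int.cast : ℤ → ℝ)) := by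
      rw [nrm, Matrix.transpose_smul, Matrix.smul_mul, Matrix.smul_mul, Matrix.mul_smul, smul_smul]
      congr 1
      rw [← mul_inv, ← sq, hs]
    have hmr : (10 : ℝ) = e * m := by exact_mod_cast hmz
    have hαr : (A 0 0 : ℝ) = e * α := by exact_mod_cast hα
    have hδr : (A 1 1 : ℝ) = e * δ := by exact_mod_cast hδ
    have hγr : (A 1 0 : ℝ) = 10 * γ := by exact_mod_cast hγ
    rw [h1, inv_smul_eq_iff₀ her]
    ext i j
    fin_cases i <;> fin_cases j <;>
      simp [Matrix.mul_apply, Fin.sum_univ_two, formMat, hαr, hδr, hγr, ← hβ, ha', hb', hc'] <;>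
      rw [hmr] <;> ring
  · have hne : α ≠ 0 ∨ γ ≠ 0 := by
      by_contra! h
      rw [h.1, h.2] at hdet'
      simp at hdet'
    have h40 : 4 * (10 * k) * (e * a') = (20 * k * (e * α) + b * (10 * γ)) ^ 2 + d * (10 * γ) ^ 2 := by
      rw [ha']
      have : 10 * m * c * γ ^ 2 * e = 10 * c * γ ^ 2 * 10 := by rw [hmz]; ring
      linear_combination (4 * (10 * k)) * this - (10 * γ) ^ 2 * hd
    have hpos : 0 < 4 * (10 * k) * (e * a') := by
      rw [h40]
      rcases eq_or_ne γ 0 with h | h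
      · have hα0 : α ≠ 0 := hne.resolve_right (not_not.2 h)
        have : 20 * k * (e * α) + b * (10 * γ) ≠ 0 := by
          rw [h]
          have : k ≠ 0 := by rintro rfl; simp at ha
          simp [this, hα0, hA.pos.ne']
        positivity
      · positivity
    have h3 : 0 < (e : ℤ) := by exact_mod_cast hA.pos
    have h4 : 0 < e * a' := pos_of_mul_pos_right hpos (by linarith)
    exact pos_of_mul_pos_right h4 h3.le
  · have hj := jf_ne_zero hA.det_ne hz
    have hmo : mo A z * jf A z = (A 0 0 : ℂ) * z + A 0 1 := by rw [mo]; field_simp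
    have hec : (e : ℂ) ≠ 0 := by exact_mod_cast hA.pos.ne'
    have hαc : (A 0 0 : ℂ) = e * α := by exact_mod_cast hα
    have hδc : (A 1 1 : ℂ) = e * δ := by exact_mod_cast hδ
    have hγc : (A 1 0 : ℂ) = 10 * γ := by exact_mod_cast hγ
    have hmc : (10 : ℂ) = e * m := by exact_mod_cast hmz
    have hjf : jf A z = 10 * γ * z + e * δ := by rw [jf, hγc, hδc]
    rw [hαc, ← hβ] at hmo
    refine (mul_eq_zero.1 (?_ : (e : ℂ) * _ = 0)).resolve_left hec
    have h5 : (10 * k : ℂ) * (e * α * z + β) ^ 2 + b * (e * α * z + β) * jf A z + c * jf A z ^ 2 = 0 := by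
      rw [← hmo]
      push_cast at hw
      linear_combination jf A z ^ 2 * hw
    rw [hjf] at h5
    rw [← h5, ha', hb', hc']
    push_cast
    rw [hmc]
    ring

end LevelTen

namespace LevelTen

lemma disc_neg_of_root {a b c : ℤ} (ha : a ≠ 0) {z : ℂ} (hz : 0 < z.im)
    (h : (a : ℂ) * z ^ 2 + b * z + c = 0) : b ^ 2 - 4 * a * c < 0 := by
  have h1 := congrArg Complex.im h
  have h2 := congrArg Complex.re h
  simp [sq] at h1 h2
  have h3 : (b : ℝ) = -2 * a * z.re := by
    have : z.im * (b + 2 * a * z.re) = 0 := by linear_combination h1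
    linarith [(mul_eq_zero.1 this).resolve_left hz.ne']
  have h4 : (b : ℝ) ^ 2 - 4 * a * c = -(4 * a ^ 2 * z.im ^ 2) := by
    rw [h3] at h2 ⊢
    linear_combination -4 * a * h2
  have h5 : (b : ℝ) ^ 2 - 4 * a * c < 0 := by
    rw [h4]
    have : (a : ℝ) ≠ 0 := by exact_mod_cast ha
    have : 0 < 4 * (a : ℝ) ^ 2 * z.im ^ 2 := by positivity
    linarith
  exact_mod_cast h5

lemma fix_iff_root {B : M2} (hB : 0 < B.det) {z : ℂ} (hz : 0 < z.im) :
    mo B z = z ↔ (B 1 0 : ℂ) * z ^ 2 + ((B 1 1 - B 0 0 : ℤ) : ℂ) * z + ((-B 0 1 : ℤ) : ℂ) = 0 := by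
  rw [mo, div_eq_iff (jf_ne_zero hB.ne' hz), jf]
  push_cast
  constructor <;> intro h
  · linear_combination -h
  · linear_combination -h

/-- The traces of the Hecke matrices of determinant `n` fixing `z`. -/
def traces (n : ℕ) (z : ℂ) : Set ℤ :=
  {r | r ^ 2 < 4 * (n : ℤ) ∧ ∃ M ∈ QdN (4 * (n : ℤ) - r ^ 2) 10, cmPointC M = z}

lemma traces_eq_image {n : ℕ} (hn : 0 < n) {z : ℂ} (hz : 0 < z.im) :
    traces n z = (fun B : M2 => B 0 0 + B 1 1) '' {B | B ∈ fixers n z ∧ 0 < B 1 0} := by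
  ext r
  constructor
  · rintro ⟨hr, M, ⟨a, b, c, rfl, ha, hd, h10⟩, hM⟩
    rw [cmPoint_eq_iff ha hd (by linarith) hz] at hM
    obtain ⟨k, hk⟩ : (2 : ℤ) ∣ r - b := by
      have h2 : (2 : ℤ) ∣ (r - b) * (r + b) := ⟨2 * n - 2 * a * c, by linear_combination -hd⟩
      rcases Int.prime_two.dvd_or_dvd h2 with h | h
      · exact h
      · omega
    have hrb : r = b + 2 * k := by linarith
    have hdet : (!![k, -c; a, b + k] : M2).det = n := by
      rw [Matrix.det_fin_two_of]
      have : 4 * (k * (b + k) - -c * a) = 4 * (n : ℤ) := by rw [hrb] at hd; linear_combination -hd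
      linarith
    have hdpos : 0 < (!![k, -c; a, b + k] : M2).det := by rw [hdet]; exact_mod_cast hn
    refine ⟨!![k, -c; a, b + k], ⟨⟨⟨hdet, by simpa using h10⟩, by simpa using ha.ne', ?_⟩,
      by simpa using ha⟩, ?_⟩
    · rw [fix_iff_root hdpos hz]
      simpa using hM
    · simp [hrb]; ring
  · rintro ⟨B, ⟨⟨hB, -, hfix⟩, hpos⟩, rfl⟩
    have hdp := hB.det_pos hn
    have hroot := (fix_iff_root hdp hz).1 hfix
    have hneg := disc_neg_of_root hpos.ne' hz hroot
    have hdet := hB.det_eq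
    rw [Matrix.det_fin_two] at hdet
    have hdisc : (B 1 1 - B 0 0) ^ 2 - 4 * B 1 0 * -B 0 1 = -(4 * (n : ℤ) - (B 0 0 + B 1 1) ^ 2) := by
      linear_combination -4 * hdet
    refine ⟨by simp only; linarith, _, ⟨B 1 0, B 1 1 - B 0 0, -B 0 1, rfl, hpos, hdisc, by
      exact_mod_cast hB.dvd_c⟩, ?_⟩
    rw [cmPoint_eq_iff hpos hdisc (by linarith) hz]
    exact hroot

lemma ncard_fixers {n : ℕ} (hn : 0 < n) {z : ℂ} (hz : 0 < z.im) :
    (fixers n z).ncard = 2 * (traces n z).ncard := by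
  set U : Set M2 := {B | B ∈ fixers n z ∧ 0 < B 1 0} with hU
  have hfin : U.Finite := (finite_fixers_Hk hn hz).subset fun _ h => h.1
  have hadj : ∀ B ∈ fixers n z, B.adjugate ∈ fixers n z := by
    rintro B ⟨hB, h10, hf⟩
    refine ⟨⟨by rw [det_adjugate_two, hB.det_eq], ?_⟩, ?_, ?_⟩
    · rw [Matrix.adjugate_fin_two]; simpa using hB.dvd_c
    · rw [Matrix.adjugate_fin_two]; simpa using h10
    · have := mo_adjugate (hB.det_pos hn) hz
      rwa [hf] at this
  have hun : fixers n z = U ∪ (fun B : M2 => B.adjugate) '' U := by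
    ext B
    constructor
    · intro hB
      rcases lt_or_gt_of_ne hB.2.1 with h | h
      · exact Or.inr ⟨B.adjugate, ⟨hadj B hB, by rw [Matrix.adjugate_fin_two]; simpa using h⟩,
          adjugate_adjugate_two B⟩
      · exact Or.inl ⟨hB, h⟩
    · rintro (h | ⟨B, h, rfl⟩)
      · exact h.1
      · exact hadj B h.1
  have hdisj : Disjoint U ((fun B : M2 => B.adjugate) '' U) := by
    rw [Set.disjoint_left]
    rintro _ h ⟨B, hB, rfl⟩
    have h1 := h.2
    have h2 := hB.2
    simp only [Matrix.adjugate_fin_two, of_apply, cons_val', cons_val_zero, cons_val_one,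
      cons_val_fin_one] at h1
    linarith
  rw [hun, Set.ncard_union_eq hdisj hfin (hfin.image _), Set.ncard_image_of_injective,
    traces_eq_image hn hz, Set.InjOn.ncard_image]
  · ring
  · rintro B ⟨⟨hB, -, hf⟩, hp⟩ B' ⟨⟨hB', -, hf'⟩, hp'⟩ (htr : B 0 0 + B 1 1 = B' 0 0 + B' 1 1)
    have hr := (fix_iff_root (hB.det_pos hn) hz).1 hf
    have hr' := (fix_iff_root (hB'.det_pos hn) hz).1 hf'
    have hd := hB.det_eq
    have hd' := hB'.det_eq
    rw [Matrix.det_fin_two] at hd hd'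
    obtain ⟨h1, h2, h3⟩ := form_unique hp hp' (by
      linear_combination (B 0 0 + B 1 1 + B' 0 0 + B' 1 1) * htr - 4 * hd + 4 * hd')
      (disc_neg_of_root hp.ne' hz hr) hz hr hr'
    ext i j
    fin_cases i <;> fin_cases j <;> simp <;> linarith
  · intro B B' h
    have := congrArg Matrix.adjugate h
    simpa only [adjugate_adjugate_two] using this

lemma finite_traces {n : ℕ} (hn : 0 < n) {z : ℂ} (hz : 0 < z.im) : (traces n z).Finite := by
  rw [traces_eq_image hn hz]
  exact ((finite_fixers_Hk hn hz).subset fun _ h => h.1).image _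

lemma exists_AL_of_jS_eq {z w : ℂ} (hz : 0 < z.im) (hw : 0 < w.im) (h : jS z = jS w) :
    ∃ e A, AL e A ∧ mo A z = w := by
  obtain ⟨e, A, -, hA, hAw⟩ := haupt_jS.rel_of_eq hz hw h
  exact ⟨e, A, hA, hAw⟩

/-- Transport of forms along Atkin–Lehner matrices. -/
lemma QdN_transform {e : ℕ} {A : M2} (hA : AL e A) {d : ℤ} (hd : 0 < d)
    {M : Matrix (Fin 2) (Fin 2) ℝ} (hM : M ∈ QdN d 10) {z : ℂ} (hz : 0 < z.im)
    (hMz : cmPointC M = mo A z) :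
    (nrm e A)ᵀ * M * nrm e A ∈ QdN d 10 ∧ cmPointC ((nrm e A)ᵀ * M * nrm e A) = z := by
  obtain ⟨a, b, c, rfl, ha, hdisc, h10⟩ := hM
  rw [cmPoint_eq_iff ha hdisc hd (hA.mo_im_pos hz)] at hMz
  obtain ⟨a', b', c', h1, h2, h3, h4, h5⟩ := form_transform hA ha hdisc hd (by exact_mod_cast h10) hz hMz
  rw [h1]
  exact ⟨⟨a', b', c', rfl, h2, h3, by exact_mod_cast h4⟩, (cmPoint_eq_iff h2 h3 hd hz).2 h5⟩

lemma QdN_im_pos {d : ℤ} (hd : 0 < d) {M : Matrix (Fin 2) (Fin 2) ℝ} (hM : M ∈ QdN d 10) :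
    0 < (cmPointC M).im := by
  obtain ⟨a, b, c, rfl, ha, hdisc, -⟩ := hM
  exact (im_cmPoint ha hdisc hd).1

lemma QdN_unique {d : ℤ} (hd : 0 < d) {M M' : Matrix (Fin 2) (Fin 2) ℝ} (hM : M ∈ QdN d 10)
    (hM' : M' ∈ QdN d 10) (h : cmPointC M = cmPointC M') : M = M' := by
  have hz := QdN_im_pos hd hM'
  obtain ⟨a, b, c, rfl, ha, hdisc, -⟩ := hM
  obtain ⟨a', b', c', rfl, ha', hdisc', -⟩ := hM'
  have h2 := (im_cmPoint ha' hdisc' hd).2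
  rw [cmPoint_eq_iff ha hdisc hd hz] at h
  obtain ⟨rfl, rfl, rfl⟩ := form_unique ha ha' (hdisc.trans hdisc'.symm) (by linarith) hz h h2
  rfl

lemma traces_subset {n : ℕ} {z w : ℂ} (hz : 0 < z.im) (hw : 0 < w.im) (h : jS z = jS w) :
    traces n w ⊆ traces n z := by
  rintro r ⟨hr, M, hM, hMw⟩
  obtain ⟨e, A, hA, hAw⟩ := exists_AL_of_jS_eq hz hw h
  obtain ⟨h1, h2⟩ := QdN_transform hA (by linarith) hM hz (hMw.trans hAw.symm)
  exact ⟨hr, _, h1, h2⟩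

lemma traces_congr {n : ℕ} {z w : ℂ} (hz : 0 < z.im) (hw : 0 < w.im) (h : jS z = jS w) :
    traces n z = traces n w :=
  (traces_subset hw hz h.symm).antisymm (traces_subset hz hw h)

lemma cmPoint_smul {e : ℕ} {A : M2} (hA : AL e A) {d : ℤ} (hd : 0 < d)
    {M : Matrix (Fin 2) (Fin 2) ℝ} (hM : M ∈ QdN d 10) :
    cmPointC ((nrm e A)ᵀ * M * nrm e A) = mo A.adjugate (cmPointC M) :=
  (QdN_transform hA hd hM (hA.adjugate.mo_im_pos (QdN_im_pos hd hM))
    (mo_mo_adjugate hA.det_pos (QdN_im_pos hd hM)).symm).2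

lemma formRel_iff {d : ℤ} (hd : 0 < d) (M M' : QdN d 10) :
    formRel (FrickeGroup 10) (QdN d 10) M M' ↔ jS (cmPointC M.1) = jS (cmPointC M'.1) := by
  constructor
  · rintro ⟨g, hg, h⟩
    obtain ⟨e, A, hA, hgA⟩ := mem_fricke_iff.1 hg
    rw [h, hgA, cmPoint_smul hA hd M.2]
    exact (invS_jS e _ hA.adjugate _ (QdN_im_pos hd M.2)).symm
  · intro h
    obtain ⟨e, A, hA, hAw⟩ := exists_AL_of_jS_eq (QdN_im_pos hd M'.2) (QdN_im_pos hd M.2) h.symm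
    obtain ⟨h1, h2⟩ := QdN_transform hA hd M.2 (QdN_im_pos hd M'.2) hAw.symm
    exact ⟨⟨nrm e A, hA.det_nrm⟩, mem_fricke_iff.2 ⟨e, A, hA, rfl⟩, QdN_unique hd M'.2 h1 h2.symm⟩

lemma nrm_injOn {w : ℂ} (hw : 0 < w.im) {e f : ℕ} {A B : M2} (hA : AL e A) (hB : AL f B)
    (hAw : mo A w = w) (hBw : mo B w = w) (h : nrm e A = nrm f B) : A = B := by
  have hjA := jf_ne_zero hA.det_ne hw
  have hjB := jf_ne_zero hB.det_ne hw
  have hsA := hA.sqrt_pos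
  have hsB := hB.sqrt_pos
  have hent : ∀ i j, ((Real.sqrt f : ℝ) : ℂ) * A i j = (Real.sqrt e : ℝ) * B i j := by
    intro i j
    have := congrFun₂ h i j
    simp only [nrm, Matrix.smul_apply, Matrix.map_apply, smul_eq_mul] at this
    field_simp at this
    rw [mul_comm]
    exact_mod_cast this
  have hj : ((Real.sqrt f : ℝ) : ℂ) * jf A w = (Real.sqrt e : ℝ) * jf B w := by
    simp only [jf]
    linear_combination w * hent 1 0 + hent 1 1
  have hse : ((Real.sqrt e : ℝ) : ℂ) ^ 2 = e := by
    rw [← Complex.ofReal_pow, Real.sq_sqrt (Nat.cast_nonneg _)]; simp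
  have hsf : ((Real.sqrt f : ℝ) : ℂ) ^ 2 = f := by
    rw [← Complex.ofReal_pow, Real.sq_sqrt (Nat.cast_nonneg _)]; simp
  have hm : (A.det : ℂ) / jf A w ^ 2 = B.det / jf B w ^ 2 := by
    rw [div_eq_div_iff (pow_ne_zero _ hjA) (pow_ne_zero _ hjB), hA.det_eq, hB.det_eq,
      Int.cast_natCast, Int.cast_natCast, ← hse, ← hsf, ← mul_pow, ← mul_pow, hj]
  rcases hA.eq_or_eq_neg hB hw hAw hBw hm with h1 | h1
  · exact h1
  · exfalso
    have hef : e = f := by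
      have h2 := hA.det_eq
      rw [h1, det_neg, hB.det_eq] at h2
      simp at h2
      exact_mod_cast h2.symm
    rw [hef, h1] at hj
    have hs : ((Real.sqrt f : ℝ) : ℂ) ≠ 0 := by exact_mod_cast hsB.ne'
    have h3 := mul_left_cancel₀ hs hj
    have h4 : jf (-B) w = -jf B w := by simp [jf]; ring
    rw [h4] at h3
    exact hjB (self_eq_neg.1 h3.symm)

lemma stabOrder_eq {d : ℤ} (hd : 0 < d) {M : Matrix (Fin 2) (Fin 2) ℝ} (hM : M ∈ QdN d 10) {ν : ℕ}
    (hν : ν ≠ 0) (ho : OrdAt (fun z => jS z - jS (cmPointC M)) (cmPointC M) ν) :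
    stabOrder (FrickeGroup 10) M = ν := by
  have hw := QdN_im_pos hd hM
  have hcard := haupt_jS.ncard_stabilizer hw hν ho
  set S : Set M2 := {A : M2 | ∃ e, True ∧ AL e A ∧ mo A (cmPointC M) = cmPointC M} with hS
  have hfix : ∀ {e A}, AL e A → ((nrm e A)ᵀ * M * nrm e A = M ↔ mo A (cmPointC M) = cmPointC M) := by
    intro e A hA
    constructor
    · intro h
      have h1 := cmPoint_smul hA hd hM
      rw [h] at h1
      have h2 := mo_mo_adjugate hA.det_pos hw
      rwa [← h1] at h2
    · intro h
      obtain ⟨h1, h2⟩ := QdN_transform hA hd hM hw h.symm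
      exact QdN_unique hd h1 hM h2
  have hA : ∀ g : { g : SL2R // g ∈ FrickeGroup 10 ∧ (g.1)ᵀ * M * g.1 = M },
      ∃ A ∈ S, ∃ e, AL e A ∧ g.1.1 = nrm e A := by
    rintro ⟨g, hg, hgM⟩
    obtain ⟨e, A, hA, hgA⟩ := mem_fricke_iff.1 hg
    refine ⟨A, ⟨e, trivial, hA, ?_⟩, e, hA, hgA⟩
    rwa [hgA, hfix hA] at hgM
  choose φ hφS hφ using hA
  have hbij : Function.Bijective (fun g => (⟨φ g, hφS g⟩ : S)) := by
    constructor
    · intro g g' h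
      obtain ⟨e, hA, h1⟩ := hφ g
      obtain ⟨f, hB, h2⟩ := hφ g'
      have h3 : φ g = φ g' := congrArg Subtype.val h
      have h4 : (e : ℤ) = f := by rw [← hA.det_eq, h3, hB.det_eq]
      have h5 : e = f := by exact_mod_cast h4
      exact Subtype.ext (Subtype.ext (by rw [h1, h2, h3, h5]))
    · rintro ⟨A, e, -, hA, hAw⟩
      set g : { g : SL2R // g ∈ FrickeGroup 10 ∧ (g.1)ᵀ * M * g.1 = M } :=
        ⟨⟨nrm e A, hA.det_nrm⟩, mem_fricke_iff.2 ⟨e, A, hA, rfl⟩, (hfix hA).2 hAw⟩ with hg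
      refine ⟨g, Subtype.ext ?_⟩
      obtain ⟨f, hB, h2⟩ := hφ g
      obtain ⟨_, -, -, hBw⟩ := hφS g
      exact nrm_injOn hw hB hA hBw hAw h2.symm
  rw [stabOrder, Nat.card_congr (Equiv.ofBijective _ hbij), Nat.card_coe_set_eq, hcard]
  omega

lemma analyticAt_jS {w : ℂ} (hw : 0 < w.im) : AnalyticAt ℂ jS w :=
  analyticAt_of_differentiable (fun _ h => differentiableAt_jS h) hw

lemma rootMultiplicity_mul {n : ℕ} (hn : 0 < n) {Q : Polynomial ℂ} (hQ0 : Q ≠ 0)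
    (hQ : ∀ z : ℂ, 0 < z.im → HH n z = Q.eval (jS z)) {w : ℂ} (hw : 0 < w.im) {ν : ℕ}
    (ho : OrdAt (fun z => jS z - jS w) w ν) :
    Q.rootMultiplicity (jS w) * ν = 24 * (traces n w).ncard := by
  obtain ⟨R, hR, hR0⟩ := Polynomial.exists_eq_pow_rootMultiplicity_mul_and_not_dvd Q hQ0 (jS w)
  rw [Polynomial.dvd_iff_isRoot, Polynomial.IsRoot] at hR0
  set m := Q.rootMultiplicity (jS w)
  have hRa : AnalyticAt ℂ (fun z => R.eval (jS z)) w := by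
    have := (analyticAt_jS hw).aeval_polynomial R
    simpa using this
  have h1 : OrdAt (HH n) w (m * ν) := ((ho.pow m).mul_ne hRa hR0).congr (by
    filter_upwards [UH_mem_nhds hw] with z hz
    rw [hQ z hz, hR]
    simp)
  rw [h1.unique (ordAt_HH hn hw), ncard_fixers hn hw]
  ring

/-- The range of traces of elliptic Hecke matrices. -/
noncomputable def ellRange (n : ℕ) : Finset ℤ := (Finset.Icc (-(2 * n : ℤ)) (2 * n)).filter fun r => r ^ 2 < 4 * (n : ℤ)

lemma mem_ellRange {n : ℕ} {r : ℤ} : r ∈ ellRange n ↔ r ^ 2 < 4 * (n : ℤ) := by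
  rw [ellRange, Finset.mem_filter, Finset.mem_Icc]
  refine ⟨fun h => h.2, fun h => ⟨?_, h⟩⟩
  have : (0 : ℤ) ≤ n := Int.natCast_nonneg n
  constructor <;> nlinarith

lemma apply_out_mk {α β : Type*} {r : α → α → Prop} {f : α → β} (h : ∀ a b, r a b → f a = f b) (a : α) :
    f (Quot.out (Quot.mk r a)) = f a :=
  congrArg (Quot.lift f h) (Quot.out_eq (Quot.mk r a))

lemma classTrace_eq {d : ℤ} (hd : 0 < d) {f F : ℂ → ℂ} {E : Finset ℂ}
    (hF : ∀ M ∈ QdN d 10, f (cmPointC M) / (stabOrder (FrickeGroup 10) M : ℂ) = F (jS (cmPointC M)))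
    (hE : ∀ x, x ∈ E ↔ ∃ M ∈ QdN d 10, jS (cmPointC M) = x) :
    classTrace (FrickeGroup 10) f (QdN d 10) = ∑ x ∈ E, F x := by
  rw [classTrace]
  set φ : Quot (formRel (FrickeGroup 10) (QdN d 10)) → ℂ :=
    fun O => jS (cmPointC (Quot.out O).1) with hφ
  have hinj : Function.Injective φ := by
    intro O O' h
    rw [← Quot.out_eq O, ← Quot.out_eq O']
    exact Quot.sound ((formRel_iff hd _ _).2 h)
  have hrange : Set.range φ = (E : Set ℂ) := by
    ext x
    rw [Finset.mem_coe, hE]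
    constructor
    · rintro ⟨O, rfl⟩
      exact ⟨_, (Quot.out O).2, rfl⟩
    · rintro ⟨M, hM, rfl⟩
      refine ⟨Quot.mk _ ⟨M, hM⟩, ?_⟩
      exact apply_out_mk (f := fun M : QdN d 10 => jS (cmPointC M.1))
        (fun M M' h => (formRel_iff hd M M').1 h) ⟨M, hM⟩
  rw [finsum_congr fun O => hF _ (Quot.out O).2, ← finsum_mem_coe_finset, ← hrange]
  exact (finsum_mem_range (f := F) hinj).symm

theorem sum_traces {n : ℕ} (hn : 0 < n) {Q : Polynomial ℂ} (hQ0 : Q ≠ 0)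
    (hQ : ∀ z : ℂ, 0 < z.im → HH n z = Q.eval (jS z)) (P : Polynomial ℂ) :
    24 * ∑ r ∈ ellRange n, t2Star 10 P (4 * n - r ^ 2) = (Q.roots.map P.eval).sum := by
  classical
  have hsur : ∀ x, ∃ z : ℂ, 0 < z.im ∧ jS z = x := haupt_jS.surjective fun _ _ => trivial
  choose ζ hζ hζx using hsur
  set T : ℂ → Set ℤ := fun x => traces n (ζ x) with hT
  have hTz : ∀ z : ℂ, 0 < z.im → T (jS z) = traces n z := fun z hz =>
    traces_congr (hζ _) hz (hζx _)
  set m : ℂ → ℕ := fun x => Q.rootMultiplicity x with hm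
  have hmem : ∀ x, x ∈ Q.roots.toFinset ↔ (T x).ncard ≠ 0 := by
    intro x
    obtain ⟨ν, hν, ho⟩ := haupt_jS.exists_ordAt (hζ x)
    have h1 := rootMultiplicity_mul hn hQ0 hQ (hζ x) ho
    rw [hζx] at h1
    rw [Multiset.mem_toFinset, ← Multiset.one_le_count_iff_mem, Polynomial.count_roots]
    constructor
    · intro h h2
      rw [show (traces n (ζ x)).ncard = 0 from h2] at h1
      simp only [mul_zero, mul_eq_zero, hν, or_false] at h1
      omega
    · intro h
      by_contra h2
      rw [show Q.rootMultiplicity x = 0 by omega] at h1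
      simp only [zero_mul] at h1
      exact h (show (traces n (ζ x)).ncard = 0 by omega)
  have hclass : ∀ r ∈ ellRange n, t2Star 10 P (4 * n - r ^ 2) =
      ∑ x ∈ Q.roots.toFinset, if r ∈ T x then P.eval x * m x / (24 * (T x).ncard) else 0 := by
    intro r hr
    have hr' := mem_ellRange.1 hr
    have hd : (0 : ℤ) < 4 * n - r ^ 2 := by linarith
    have hr2 : ∀ M ∈ QdN (4 * n - r ^ 2) 10, r ∈ T (jS (cmPointC M)) ∧ (T (jS (cmPointC M))).ncard ≠ 0 := by
      intro M hM
      have hw := QdN_im_pos hd hM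
      rw [hTz _ hw]
      have : r ∈ traces n (cmPointC M) := ⟨hr', _, hM, rfl⟩
      exact ⟨this, ((Set.ncard_pos (finite_traces hn hw)).2 ⟨r, this⟩).ne'⟩
    rw [t2Star, if_pos hd, ← Finset.sum_filter]
    refine classTrace_eq hd (fun M hM => ?_) fun x => ?_
    · have hw := QdN_im_pos hd hM
      obtain ⟨ν, hν, ho⟩ := haupt_jS.exists_ordAt hw
      have hne := (hr2 M hM).2
      rw [stabOrder_eq hd hM hν ho, jnStar_ten]
      have h2 := rootMultiplicity_mul hn hQ0 hQ hw ho
      rw [← hTz _ hw] at h2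
      have h3 : (m (jS (cmPointC M)) : ℂ) * ν = 24 * (T (jS (cmPointC M))).ncard := by
        exact_mod_cast h2
      rw [← h3]
      have hν' : (ν : ℂ) ≠ 0 := by exact_mod_cast hν
      have hm0 : (m (jS (cmPointC M)) : ℂ) ≠ 0 := by
        intro h0
        rw [h0, zero_mul] at h3
        exact hne (by exact_mod_cast (mul_eq_zero.1 h3.symm).resolve_left (by norm_num))
      rw [mul_comm (P.eval _), mul_div_mul_left _ _ hm0]
    · rw [Finset.mem_filter, hmem]
      constructor
      · rintro ⟨-, -, M, hM, hMx⟩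
        exact ⟨M, hM, by rw [hMx, hζx]⟩
      · rintro ⟨M, hM, rfl⟩
        exact (hr2 M hM).symm
  rw [Finset.sum_congr rfl hclass, Finset.sum_comm, Finset.mul_sum, Finset.sum_multiset_map_count]
  refine Finset.sum_congr rfl fun x hx => ?_
  have hne := (hmem x).1 hx
  rw [← Finset.sum_filter, Finset.sum_const, Polynomial.count_roots]
  have hcard : (ellRange n).filter (fun r => r ∈ T x) = (finite_traces hn (hζ x)).toFinset := by
    ext r
    rw [Finset.mem_filter, Set.Finite.mem_toFinset, mem_ellRange]
    exact ⟨fun h => h.2, fun h => ⟨h.1, h⟩⟩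
  rw [hcard, ← Set.ncard_eq_toFinset_card _ (finite_traces hn (hζ x))]
  have hc : ((T x).ncard : ℂ) ≠ 0 := by exact_mod_cast hne
  simp only [nsmul_eq_mul]
  change 24 * (((T x).ncard : ℂ) * _) = _
  field_simp
  rfl

end LevelTen

namespace LevelTen

/-- The filter of neighbourhoods of the cusp `i∞`. -/
def cusp : Filter ℂ := Filter.comap Complex.im Filter.atTop

lemma eventually_cusp (Y : ℝ) : ∀ᶠ z in cusp, Y < z.im :=
  (Filter.eventually_gt_atTop Y).comap Complex.im

instance cusp_neBot : cusp.NeBot := by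
  refine Filter.comap_neBot fun t ht => ?_
  obtain ⟨y, hy⟩ := Filter.mem_atTop_sets.1 ht
  exact ⟨y * I, by simpa using hy y le_rfl⟩

lemma tendsto_qc : Filter.Tendsto qc cusp (nhds 0) := by
  rw [tendsto_zero_iff_norm_tendsto_zero]
  simp_rw [norm_qc]
  refine Real.tendsto_exp_neg_atTop_nhds_zero.comp ?_
  exact (Filter.tendsto_comap).const_mul_atTop (by positivity : (0 : ℝ) < 2 * Real.pi)

lemma tendsto_mul_add {c : ℝ} (hc : 0 < c) (b : ℂ) :
    Filter.Tendsto (fun z : ℂ => c * z + b) cusp cusp := by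
  rw [cusp, Filter.tendsto_comap_iff]
  have : (Complex.im ∘ fun z : ℂ => c * z + b) = fun z => c * z.im + b.im := by
    ext z; simp
  rw [this]
  exact Filter.tendsto_atTop_add_const_right _ _ (Filter.tendsto_comap.const_mul_atTop hc)

open Asymptotics

/-- `g = C q^D exp(h₁ q + h q² + o(q²))` at the cusp. -/
def Asy (g : ℂ → ℂ) (h : ℂ) : Prop :=
  ∃ (D : ℤ) (C h₁ : ℂ) (φ : ℂ → ℂ), C ≠ 0 ∧ (∀ᶠ z in cusp, g z = C * qc z ^ D * exp (φ z)) ∧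
    (fun z => φ z - h₁ * qc z - h * qc z ^ 2) =o[cusp] fun z => qc z ^ 2

lemma Asy.congr {g g' : ℂ → ℂ} {h : ℂ} (H : Asy g h) (e : ∀ᶠ z in cusp, g' z = g z) : Asy g' h := by
  obtain ⟨D, C, h₁, φ, hC, hg, hφ⟩ := H
  exact ⟨D, C, h₁, φ, hC, by filter_upwards [hg, e] with z h1 h2 using h2.trans h1, hφ⟩

lemma Asy.of_exp {φ : ℂ → ℂ} (D : ℤ) {C : ℂ} (hC : C ≠ 0) {h₁ h : ℂ}
    (hφ : (fun z => φ z - h₁ * qc z - h * qc z ^ 2) =o[cusp] fun z => qc z ^ 2) :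
    Asy (fun z => C * qc z ^ D * exp (φ z)) h :=
  ⟨D, C, h₁, φ, hC, Filter.Eventually.of_forall fun _ => rfl, hφ⟩

lemma Asy.qc_zpow (D : ℤ) {C : ℂ} (hC : C ≠ 0) : Asy (fun z => C * qc z ^ D) 0 := by
  have := Asy.of_exp (φ := fun _ => 0) D hC (h₁ := 0) (h := 0) (by simp)
  simpa using this

lemma Asy.const {C : ℂ} (hC : C ≠ 0) : Asy (fun _ => C) 0 := by
  simpa using Asy.qc_zpow 0 hC

lemma Asy.mul {g g' : ℂ → ℂ} {h h' : ℂ} (H : Asy g h) (H' : Asy g' h') :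
    Asy (fun z => g z * g' z) (h + h') := by
  obtain ⟨D, C, h₁, φ, hC, hg, hφ⟩ := H
  obtain ⟨D', C', h₁', φ', hC', hg', hφ'⟩ := H'
  refine ⟨D + D', C * C', h₁ + h₁', fun z => φ z + φ' z, mul_ne_zero hC hC', ?_, ?_⟩
  · filter_upwards [hg, hg'] with z h1 h2
    rw [h1, h2, zpow_add₀ (qc_ne_zero z), Complex.exp_add]
    ring
  · refine (hφ.add hφ').congr_left fun z => ?_
    ring

lemma Asy.inv {g : ℂ → ℂ} {h : ℂ} (H : Asy g h) : Asy (fun z => (g z)⁻¹) (-h) := by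
  obtain ⟨D, C, h₁, φ, hC, hg, hφ⟩ := H
  refine ⟨-D, C⁻¹, -h₁, fun z => -φ z, inv_ne_zero hC, ?_, ?_⟩
  · filter_upwards [hg] with z h1
    rw [h1, _root_.zpow_neg, Complex.exp_neg, _root_.mul_inv, _root_.mul_inv]
  · refine hφ.neg_left.congr_left fun z => ?_
    ring

lemma Asy.pow {g : ℂ → ℂ} {h : ℂ} (H : Asy g h) (n : ℕ) : Asy (fun z => g z ^ n) (n * h) := by
  induction n with
  | zero => simpa using Asy.const one_ne_zero
  | succ n ih =>
    have := (ih.mul H).congr (Filter.Eventually.of_forall fun z => _root_.pow_succ _ _)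
    rwa [show ((n + 1 : ℕ) : ℂ) * h = n * h + h by push_cast; ring]

lemma Asy.prod {ι : Type*} {s : Finset ι} {g : ι → ℂ → ℂ} {h : ι → ℂ}
    (H : ∀ i ∈ s, Asy (g i) (h i)) : Asy (fun z => ∏ i ∈ s, g i z) (∑ i ∈ s, h i) := by
  classical
  induction s using Finset.induction_on with
  | empty => simpa using Asy.const one_ne_zero
  | insert a s ha ih =>
    simp only [Finset.prod_insert ha, Finset.sum_insert ha]
    exact (H a (Finset.mem_insert_self a s)).mul (ih fun i hi => H i (Finset.mem_insert_of_mem hi))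

lemma Asy.multiset_prod {s : Multiset ℂ} {g : ℂ → ℂ → ℂ} {h : ℂ → ℂ} (H : ∀ x, Asy (g x) (h x)) :
    Asy (fun z => (s.map fun x => g x z).prod) (s.map h).sum := by
  induction s using Multiset.induction_on with
  | empty => simpa using Asy.const one_ne_zero
  | cons a s ih =>
    simp only [Multiset.map_cons, Multiset.prod_cons, Multiset.sum_cons]
    exact (H a).mul ih

lemma isLittleO_pow_succ (n : ℕ) : (fun z => qc z ^ (n + 1)) =o[cusp] fun z => qc z ^ n := by
  have h : (fun z => qc z) =o[cusp] fun _ => (1 : ℂ) := (isLittleO_one_iff ℂ).2 tendsto_qc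
  simpa [_root_.pow_succ] using (isBigO_refl (fun z => qc z ^ n) cusp).mul_isLittleO h

lemma coeff_eq_zero {a b : ℂ} (h : (fun z => a * qc z + b * qc z ^ 2) =o[cusp] fun z => qc z ^ 2) :
    b = 0 := by
  have h1 : (fun z => a * qc z) =o[cusp] qc := by
    have h2 : (fun z => a * qc z + b * qc z ^ 2) =o[cusp] qc := by
      simpa using h.trans (isLittleO_pow_succ 1)
    have h3 : (fun z => b * qc z ^ 2) =o[cusp] qc := by
      simpa using (isLittleO_pow_succ 1).const_mul_left b
    exact (h2.sub h3).congr_left fun z => by ring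
  have ha : a = 0 := by
    have := h1.tendsto_div_nhds_zero
    exact tendsto_nhds_unique (tendsto_const_nhds.congr fun z => by
      field_simp [qc_ne_zero z]) this
  subst ha
  have := h.tendsto_div_nhds_zero
  exact tendsto_nhds_unique (tendsto_const_nhds.congr fun z => by
    field_simp [qc_ne_zero z]; simp) this

lemma tendsto_zero_of_expansion {φ : ℂ → ℂ} {h₁ h : ℂ}
    (hφ : (fun z => φ z - h₁ * qc z - h * qc z ^ 2) =o[cusp] fun z => qc z ^ 2) :
    Filter.Tendsto φ cusp (nhds 0) := by
  have h2 : Filter.Tendsto (fun z => qc z ^ 2) cusp (nhds 0) := by simpa using tendsto_qc.pow 2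
  have := (hφ.trans_tendsto h2).add ((tendsto_qc.const_mul h₁).add (h2.const_mul h))
  simp only [mul_zero, add_zero] at this
  exact this.congr fun z => by ring

lemma Asy.unique {g : ℂ → ℂ} {h h' : ℂ} (H : Asy g h) (H' : Asy g h') : h = h' := by
  obtain ⟨D, C, h₁, φ, hC, hg, hφ⟩ := H
  obtain ⟨D', C', h₁', φ', hC', hg', hφ'⟩ := H'
  have hψ : Filter.Tendsto (fun z => φ' z - φ z) cusp (nhds 0) := by
    simpa using (tendsto_zero_of_expansion hφ').sub (tendsto_zero_of_expansion hφ)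
  have hexp : Filter.Tendsto (fun z => exp (φ' z - φ z)) cusp (nhds 1) := by
    simpa [Function.comp_def] using (Complex.continuous_exp.tendsto 0).comp hψ
  have key : ∀ᶠ z in cusp, qc z ^ (D - D') = C' / C * exp (φ' z - φ z) := by
    filter_upwards [hg, hg'] with z h1 h2
    have h3 := h1.symm.trans h2
    rw [zpow_sub₀ (qc_ne_zero z), Complex.exp_sub, div_eq_iff (zpow_ne_zero _ (qc_ne_zero z))]
    field_simp
    linear_combination h3
  have hlim : Filter.Tendsto (fun z => qc z ^ (D - D')) cusp (nhds (C' / C)) := by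
    have := hexp.const_mul (C' / C)
    rw [mul_one] at this
    exact this.congr' (key.mono fun _ h => h.symm)
  have hD : D - D' = 0 := by
    rcases lt_trichotomy (D - D') 0 with hlt | h0 | hlt
    · obtain ⟨n, hn⟩ := Int.eq_ofNat_of_zero_le (show 0 ≤ -(D - D') by lia)
      have h1 := hlim.inv₀ (div_ne_zero hC' hC)
      have h2 : Filter.Tendsto (fun z => (qc z ^ (D - D'))⁻¹) cusp (nhds 0) := by
        simp_rw [← _root_.zpow_neg, hn, zpow_natCast]
        simpa [show n ≠ 0 by lia] using tendsto_qc.pow n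
      exact absurd (tendsto_nhds_unique h1 h2) (inv_ne_zero (div_ne_zero hC' hC))
    · exact h0
    · obtain ⟨n, hn⟩ := Int.eq_ofNat_of_zero_le (show 0 ≤ D - D' by lia)
      have h2 : Filter.Tendsto (fun z => qc z ^ (D - D')) cusp (nhds 0) := by
        simp_rw [hn, zpow_natCast]
        simpa [show n ≠ 0 by lia] using tendsto_qc.pow n
      exact absurd (tendsto_nhds_unique hlim h2) (div_ne_zero hC' hC)
  have hone : C' / C = 1 := tendsto_nhds_unique hlim (by simp [hD])
  have hzero : ∀ᶠ z in cusp, φ' z - φ z = 0 := by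
    have hsmall : ∀ᶠ z in cusp, ‖φ' z - φ z‖ < Real.pi := by
      have := hψ.norm
      rw [norm_zero] at this
      exact this.eventually (gt_mem_nhds Real.pi_pos)
    filter_upwards [key, hsmall] with z h1 h2
    rw [hD, hone, zpow_zero, one_mul] at h1
    have h3 := Complex.abs_im_le_norm (φ' z - φ z)
    have h4 := abs_lt.1 (h3.trans_lt h2)
    rw [← Complex.log_exp h4.1 h4.2.le, ← h1, Complex.log_one]
  have hfin : (fun z => (h₁ - h₁') * qc z + (h - h') * qc z ^ 2) =o[cusp] fun z => qc z ^ 2 := by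
    refine (hφ'.sub hφ).congr' ?_ Filter.EventuallyEq.rfl
    filter_upwards [hzero] with z h1
    linear_combination h1
  exact sub_eq_zero.1 (coeff_eq_zero hfin)

lemma Asy.eventually_ne_zero {g : ℂ → ℂ} {h : ℂ} (H : Asy g h) : ∀ᶠ z in cusp, g z ≠ 0 := by
  obtain ⟨D, C, h₁, φ, hC, hg, hφ⟩ := H
  filter_upwards [hg] with z h1
  rw [h1]
  exact mul_ne_zero (mul_ne_zero hC (zpow_ne_zero _ (qc_ne_zero z))) (Complex.exp_ne_zero _)

lemma Asy.exists_bound {g : ℂ → ℂ} {h : ℂ} (H : Asy g h) :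
    ∃ N : ℕ, ∃ C Y : ℝ, ∀ z : ℂ, 0 < z.im → Y < z.im → ‖qc z ^ N * g z‖ ≤ C := by
  obtain ⟨D, C, h₁, φ, hC, hg, hφ⟩ := H
  have hexp : Filter.Tendsto (fun z => ‖exp (φ z)‖) cusp (nhds 1) := by
    simpa using ((Complex.continuous_exp.tendsto 0).comp (tendsto_zero_of_expansion hφ)).norm
  have hev : ∀ᶠ z in cusp, 0 < z.im → ‖qc z ^ D.natAbs * g z‖ ≤ ‖C‖ * 2 := by
    filter_upwards [hg, hexp.eventually (gt_mem_nhds one_lt_two)] with z h1 h2 hz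
    obtain ⟨m, hm⟩ : ∃ m : ℕ, (D.natAbs : ℤ) + D = m := Int.eq_ofNat_of_zero_le (by lia)
    have : qc z ^ D.natAbs * g z = C * qc z ^ m * exp (φ z) := by
      rw [h1, ← zpow_natCast (qc z) m, ← hm, zpow_add₀ (qc_ne_zero z), zpow_natCast]
      ring
    rw [this, norm_mul, norm_mul, norm_pow]
    have h3 : ‖qc z‖ ^ m ≤ 1 := pow_le_one₀ (norm_nonneg _) (norm_qc_lt_one hz).le
    calc ‖C‖ * ‖qc z‖ ^ m * ‖exp (φ z)‖ ≤ ‖C‖ * 1 * 2 := by gcongr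
      _ = _ := by ring
  obtain ⟨t, ht, hsub⟩ := Filter.mem_comap.1 hev
  obtain ⟨Y, hY⟩ := Filter.mem_atTop_sets.1 ht
  exact ⟨D.natAbs, ‖C‖ * 2, Y, fun z hz hzY => hsub (hY z.im hzY.le) hz⟩

lemma isBigO_log_one_add {ε : ℂ → ℂ} (hε : Filter.Tendsto ε cusp (nhds 0)) :
    (fun z => log (1 + ε z) - ε z) =O[cusp] fun z => ε z ^ 2 := by
  have hsmall : ∀ᶠ z in cusp, ‖ε z‖ < 1 / 2 := by
    have := hε.norm
    rw [norm_zero] at this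
    exact this.eventually (gt_mem_nhds (by norm_num))
  refine IsBigO.of_bound 1 ?_
  filter_upwards [hsmall] with z hz
  refine (Complex.norm_log_one_add_sub_self_le (by linarith)).trans ?_
  rw [norm_pow, one_mul]
  have : (1 - ‖ε z‖)⁻¹ ≤ 2 := by
    rw [inv_le_comm₀ (by linarith) (by norm_num)]; linarith
  nlinarith [sq_nonneg ‖ε z‖]

lemma eventually_exp_log {ε : ℂ → ℂ} (hε : Filter.Tendsto ε cusp (nhds 0)) :
    ∀ᶠ z in cusp, exp (log (1 + ε z)) = 1 + ε z := by
  have : Filter.Tendsto (fun z => 1 + ε z) cusp (nhds 1) := by simpa using hε.const_add 1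
  filter_upwards [this.eventually_ne one_ne_zero] with z hz using Complex.exp_log hz

lemma isBigO_log_one_add_sq {ε : ℂ → ℂ} (hε : Filter.Tendsto ε cusp (nhds 0)) :
    (fun z => log (1 + ε z) - ε z + ε z ^ 2 / 2) =O[cusp] fun z => ε z ^ 3 := by
  have hsmall : ∀ᶠ z in cusp, ‖ε z‖ < 1 / 2 := by
    have := hε.norm
    rw [norm_zero] at this
    exact this.eventually (gt_mem_nhds (by norm_num))
  refine IsBigO.of_bound 1 ?_
  filter_upwards [hsmall] with z hz
  have h1 := Complex.norm_log_sub_logTaylor_le 2 (z := ε z) (by linarith)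
  have h2 : log (1 + ε z) - ε z + ε z ^ 2 / 2 = log (1 + ε z) - logTaylor (2 + 1) (ε z) := by
    simp [Complex.logTaylor, Finset.sum_range_succ]
    ring
  rw [h2]
  refine h1.trans ?_
  rw [norm_pow, one_mul]
  have : (1 - ‖ε z‖)⁻¹ ≤ 2 := by
    rw [inv_le_comm₀ (by linarith) (by norm_num)]; linarith
  have h3 : 0 ≤ ‖ε z‖ ^ 3 := by positivity
  norm_num
  nlinarith

lemma isBigO_of_expansion {ε : ℂ → ℂ} {α β : ℂ}
    (hε : (fun z => ε z - α * qc z - β * qc z ^ 2) =o[cusp] fun z => qc z ^ 2) :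
    (fun z => ε z - α * qc z) =O[cusp] (fun z => qc z ^ 2) ∧ ε =O[cusp] qc := by
  have h2 : (fun z => qc z ^ 2) =O[cusp] qc := by simpa using (isLittleO_pow_succ 1).isBigO
  have h1 : (fun z => ε z - α * qc z) =O[cusp] (fun z => qc z ^ 2) :=
    (hε.isBigO.add ((isBigO_refl _ _).const_mul_left β)).congr_left fun z => by ring
  exact ⟨h1, ((h1.trans h2).add ((isBigO_refl qc _).const_mul_left α)).congr_left fun z => by ring⟩

lemma Asy.one_add {ε : ℂ → ℂ} {α β : ℂ}
    (hε : (fun z => ε z - α * qc z - β * qc z ^ 2) =o[cusp] fun z => qc z ^ 2) :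
    Asy (fun z => 1 + ε z) (β - α ^ 2 / 2) := by
  have h0 := tendsto_zero_of_expansion hε
  obtain ⟨h1, h2⟩ := isBigO_of_expansion hε
  refine ⟨0, 1, α, fun z => log (1 + ε z), one_ne_zero, ?_, ?_⟩
  · filter_upwards [eventually_exp_log h0] with z hz
    simp [hz]
  · have h3 := ((isBigO_log_one_add_sq h0).trans (h2.pow 3)).trans_isLittleO (isLittleO_pow_succ 2)
    have h4 : (fun z => (ε z - α * qc z) * (ε z + α * qc z)) =o[cusp] fun z => qc z ^ 2 := by
      refine IsBigO.trans_isLittleO ?_ (isLittleO_pow_succ 2)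
      simp only [_root_.pow_succ _ 2]
      exact h1.mul (h2.add ((isBigO_refl qc _).const_mul_left α))
    refine ((h3.add hε).sub (h4.const_mul_left (1 / 2))).congr_left fun z => ?_
    ring

/-- A power series convergent on the unit disc. -/
def Conv (a : ℕ → ℂ) : Prop := ∀ y : ℂ, ‖y‖ < 1 → Summable fun k => a k * y ^ k

lemma Conv.isBigO {a : ℕ → ℂ} (ha : Conv a) (K : ℕ) :
    (fun y : ℂ => ∑' k, a k * y ^ k - ∑ k ∈ Finset.range K, a k * y ^ k) =O[nhds 0]
      fun y => y ^ K := by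
  have hs : Summable fun k => ‖a (k + K) * (1 / 2 : ℂ) ^ k‖ := by
    have h1 := (summable_nat_add_iff K).2 (ha (1 / 2) (by norm_num)).norm
    refine (h1.mul_left (2 ^ K)).congr fun k => ?_
    simp only [norm_mul, norm_pow, _root_.pow_add]
    norm_num
    rw [show ((1 : ℝ) / 2) ^ K = (2 ^ K)⁻¹ by simp]
    field_simp
  refine IsBigO.of_bound (∑' k, ‖a (k + K) * (1 / 2 : ℂ) ^ k‖) ?_
  filter_upwards [Metric.ball_mem_nhds (0 : ℂ) (by norm_num : (0 : ℝ) < 1 / 2)] with y hy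
  have hy' : ‖y‖ < 1 / 2 := by simpa using hy
  have hsum := (ha y (by linarith)).sum_add_tsum_nat_add K
  rw [← hsum, add_sub_cancel_left]
  have : ∀ k, a (k + K) * y ^ (k + K) = a (k + K) * y ^ k * y ^ K := fun k => by
    rw [_root_.pow_add, mul_assoc]
  simp_rw [this]
  rw [tsum_mul_right, norm_mul]
  gcongr
  refine tsum_of_norm_bounded hs.hasSum fun k => ?_
  simp only [norm_mul, norm_pow]
  gcongr
  norm_num
  linarith

lemma sum_qc_pow {N : ℕ} (hN : 0 < N) (A k : ℕ) (z : ℂ) :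
    ∑ b ∈ Finset.range N, qc ((A * z + b) / N) ^ k =
      if N ∣ k then N * qc z ^ (A * (k / N)) else 0 := by
  have hN0 : (N : ℂ) ≠ 0 := by exact_mod_cast hN.ne'
  have h1 : ∀ b : ℕ, qc ((A * z + b) / N) ^ k = qc (k * (A * z) / N) * qc (k / N) ^ b := fun b => by
    rw [← qc_nat_mul, ← qc_nat_mul, ← qc_add]
    congr 1
    ring
  simp_rw [h1, ← Finset.mul_sum]
  split_ifs with h
  · obtain ⟨m, rfl⟩ := h
    rw [show ((N * m : ℕ) : ℂ) / N = ((m : ℤ) : ℂ) by push_cast; field_simp, qc_int,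
      Nat.mul_div_cancel_left _ hN, ← qc_nat_mul]
    simp only [one_pow, Finset.sum_const, Finset.card_range, nsmul_eq_mul, mul_one]
    rw [mul_comm]
    congr 2
    push_cast
    field_simp
  · have hne : qc (k / N) ≠ 1 := fun h0 => by
      rw [← qc_int 0] at h0
      obtain ⟨m, hm⟩ := qc_eq_iff.1 h0
      rw [div_eq_iff hN0] at hm
      push_cast at hm
      have : (k : ℤ) = m * N := by
        have : ((k : ℤ) : ℂ) = ((m * N : ℤ) : ℂ) := by push_cast; rw [hm]; ring
        exact_mod_cast this
      exact h (Int.natCast_dvd_natCast.1 ⟨m, by rw [this, mul_comm]⟩)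
    rw [geom_sum_eq hne, ← qc_nat_mul, show (N : ℂ) * (k / N) = ((k : ℤ) : ℂ) by
      push_cast; field_simp, qc_int]
    simp

lemma norm_qc_frac_lt_one {N A : ℕ} (hN : 0 < N) (hA : 0 < A) (b : ℕ) {z : ℂ} (hz : 0 < z.im) :
    ‖qc ((A * z + b) / N)‖ < 1 := by
  apply norm_qc_lt_one
  rw [Complex.div_natCast_im]
  simp
  positivity

lemma Conv.sum_qc {a : ℕ → ℂ} (ha : Conv a) {N A : ℕ} (hN : 0 < N) (hA : 0 < A) {z : ℂ}
    (hz : 0 < z.im) :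
    ∑ b ∈ Finset.range N, ∑' k, a k * qc ((A * z + b) / N) ^ k =
      ∑' l, N * a (N * l) * (qc z ^ A) ^ l := by
  have h1 : HasSum (fun k => ∑ b ∈ Finset.range N, a k * qc ((A * z + b) / N) ^ k)
      (∑ b ∈ Finset.range N, ∑' k, a k * qc ((A * z + b) / N) ^ k) :=
    hasSum_sum fun b _ => (ha _ (norm_qc_frac_lt_one hN hA b hz)).hasSum
  simp_rw [← Finset.mul_sum, sum_qc_pow hN] at h1
  have hinj : Function.Injective fun l : ℕ => N * l := fun l m h => Nat.eq_of_mul_eq_mul_left hN h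
  rw [← hinj.hasSum_iff] at h1
  · rw [← h1.tsum_eq]
    refine tsum_congr fun l => ?_
    simp only [Function.comp_apply, dvd_mul_right, if_true, Nat.mul_div_cancel_left _ hN,
      ← _root_.pow_mul]
    ring
  · rintro k hk
    rw [if_neg, mul_zero]
    rintro ⟨m, rfl⟩
    exact hk ⟨m, rfl⟩

lemma Conv.subseries {a : ℕ → ℂ} (ha : Conv a) {N : ℕ} (hN : 0 < N) :
    Conv fun l => N * a (N * l) := by
  intro y hy
  obtain ⟨x, hx⟩ := IsAlgClosed.exists_pow_nat_eq y hN
  have hx1 : ‖x‖ < 1 := by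
    rw [← hx, norm_pow] at hy
    exact (pow_lt_one_iff_of_nonneg (norm_nonneg x) hN.ne').1 hy
  have h1 := (ha x hx1).comp_injective
    (i := fun l : ℕ => N * l) fun l m h => Nat.eq_of_mul_eq_mul_left hN h
  refine (h1.mul_left (N : ℂ)).congr fun l => ?_
  simp only [Function.comp_apply, _root_.pow_mul, hx]
  ring

end LevelTen

namespace LevelTen
open Asymptotics

lemma isLittleO_pow {m n : ℕ} (h : n < m) : (fun z => qc z ^ m) =o[cusp] fun z => qc z ^ n := by
  induction m, h using Nat.le_induction with
  | base => exact isLittleO_pow_succ n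
  | succ m _ ih => exact (isLittleO_pow_succ m).trans ih

lemma tendsto_qc_pow {A : ℕ} (hA : 0 < A) : Filter.Tendsto (fun z => qc z ^ A) cusp (nhds 0) := by
  simpa [hA.ne'] using tendsto_qc.pow A

/-- The coefficient of `q²` in `∑ b_l q^{Al}`, where `b₀ = 0`. -/
noncomputable def sqCoeff (A : ℕ) (b : ℕ → ℂ) : ℂ :=
  (if A = 1 then b 2 else 0) + if A = 2 then b 1 else 0

lemma Conv.expansion {b : ℕ → ℂ} (hb : Conv b) (h0 : b 0 = 0) {A : ℕ} (hA : 0 < A) :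
    (fun z => ∑' l, b l * (qc z ^ A) ^ l - (if A = 1 then b 1 else 0) * qc z -
      sqCoeff A b * qc z ^ 2) =o[cusp] fun z => qc z ^ 2 := by
  have h1 := (hb.isBigO 3).comp_tendsto (tendsto_qc_pow hA)
  simp only [Function.comp_def, ← _root_.pow_mul, Finset.sum_range_succ, Finset.sum_range_zero, h0]
    at h1
  have h2 := h1.trans_isLittleO (isLittleO_pow (show 2 < A * 3 by lia))
  simp only [← _root_.pow_mul, sqCoeff]
  rcases (show A = 1 ∨ A = 2 ∨ 3 ≤ A by lia) with rfl | rfl | h3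
  · exact h2.congr_left fun z => by simp; ring
  · have h4 := (isLittleO_pow (show 2 < 4 by lia)).const_mul_left (b 2)
    exact (h2.add h4).congr_left fun z => by simp; ring
  · have h4 := (isLittleO_pow (show 2 < A * 2 by lia)).const_mul_left (b 2)
    have h5 := (isLittleO_pow (show 2 < A by lia)).const_mul_left (b 1)
    have h6 : A ≠ 1 := by lia
    have h7 : A ≠ 2 := by lia
    exact ((h2.add h4).add h5).congr_left fun z => by simp [h6, h7]; ring

lemma Conv.asy_prod {a : ℕ → ℂ} (ha : Conv a) (h0 : a 0 = 0) {N A : ℕ} (hN : 0 < N) (hA : 0 < A) :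
    Asy (fun z => ∏ b ∈ Finset.range N, exp (∑' k, a k * qc ((A * z + b) / N) ^ k))
      (sqCoeff A fun l => N * a (N * l)) := by
  refine (Asy.of_exp 0 one_ne_zero ((ha.subseries hN).expansion (by simp [h0]) hA)).congr ?_
  filter_upwards [eventually_cusp 0] with z hz
  rw [← Complex.exp_sum, ha.sum_qc hN hA hz]
  simp

lemma Conv.asy {a : ℕ → ℂ} (ha : Conv a) (h0 : a 0 = 0) :
    Asy (fun z => exp (∑' k, a k * qc z ^ k)) (a 2) := by
  simpa [sqCoeff] using ha.asy_prod h0 one_pos one_pos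

lemma tendsto_qc_frac {N A : ℕ} (hN : 0 < N) (hA : 0 < A) (b : ℕ) :
    Filter.Tendsto (fun z => qc ((A * z + b) / N)) cusp (nhds 0) := by
  have h := tendsto_qc.comp (tendsto_mul_add (c := A / N) (by positivity) (b / N))
  refine h.congr fun z => ?_
  simp only [Function.comp_apply]
  congr 1
  push_cast
  ring

/-- Products of factors `1 + X g(Y_b) + O(X² Y_b)`. -/
lemma Conv.asy_pair {g : ℕ → ℂ} (hg : Conv g) (h0 : g 0 = 0) {N A : ℕ} (hN : 0 < N) (hA : 0 < A)
    {ε : ℕ → ℂ → ℂ}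
    (hε : ∀ b ∈ Finset.range N,
      (fun z => ε b z - qc z * ∑' k, g k * qc ((A * z + b) / N) ^ k) =O[cusp]
        fun z => qc z ^ 2 * qc ((A * z + b) / N)) :
    Asy (fun z => ∏ b ∈ Finset.range N, (1 + ε b z)) (if A = 1 then N * g N else 0) := by
  have hY : ∀ b : ℕ, (fun z => qc ((A * z + b) / N)) =o[cusp] fun _ => (1 : ℂ) := fun b =>
    (isLittleO_one_iff ℂ).2 (tendsto_qc_frac hN hA b)
  have hX : qc =o[cusp] fun _ => (1 : ℂ) := (isLittleO_one_iff ℂ).2 tendsto_qc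
  have hgY : ∀ b : ℕ, (fun z => ∑' k, g k * qc ((A * z + b) / N) ^ k) =O[cusp]
      fun z => qc ((A * z + b) / N) := fun b => by
    have := (hg.isBigO 1).comp_tendsto (tendsto_qc_frac hN hA b)
    simpa [Function.comp_def, h0] using this
  have hsq : ∀ b : ℕ, (fun z => qc z ^ 2 * qc ((A * z + b) / N)) =o[cusp] fun z => qc z ^ 2 :=
    fun b => by simpa using (isBigO_refl (fun z => qc z ^ 2) cusp).mul_isLittleO (hY b)
  have hεO : ∀ b ∈ Finset.range N, ε b =O[cusp] fun z => qc z * qc ((A * z + b) / N) :=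
    fun b hb => by
      have h1 := (isBigO_refl qc cusp).mul (hgY b)
      have h2 : (fun z => qc z ^ 2 * qc ((A * z + b) / N)) =O[cusp]
          fun z => qc z * qc ((A * z + b) / N) := by
        have := hX.isBigO.mul (isBigO_refl (fun z => qc z * qc ((A * z + b) / N)) cusp)
        exact this.congr (fun z => by ring) fun z => by ring
      exact (((hε b hb).trans h2).add h1).congr_left fun z => by ring
  have hε0 : ∀ b ∈ Finset.range N, Filter.Tendsto (ε b) cusp (nhds 0) := fun b hb =>
    (hεO b hb).trans_tendsto (by simpa using tendsto_qc.mul (tendsto_qc_frac hN hA b))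
  have hlog : ∀ b ∈ Finset.range N,
      (fun z => log (1 + ε b z) - qc z * ∑' k, g k * qc ((A * z + b) / N) ^ k) =o[cusp]
        fun z => qc z ^ 2 := fun b hb => by
    have h1 := (isBigO_log_one_add (hε0 b hb)).trans ((hεO b hb).pow 2)
    have h2 : (fun z => (qc z * qc ((A * z + b) / N)) ^ 2) =o[cusp] fun z => qc z ^ 2 := by
      have := (hsq b).mul_isBigO (hY b).isBigO
      exact this.congr (fun z => by ring) fun z => by ring
    exact ((h1.trans_isLittleO h2).add ((hε b hb).trans_isLittleO (hsq b))).congr_left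
      fun z => by ring
  have hsum := IsLittleO.sum hlog
  have hav : (fun z => qc z * ∑ b ∈ Finset.range N, ∑' k, g k * qc ((A * z + b) / N) ^ k -
      (if A = 1 then N * g N else 0) * qc z ^ 2) =o[cusp] fun z => qc z ^ 2 := by
    have h1 := ((hg.subseries hN).isBigO 2).comp_tendsto (tendsto_qc_pow hA)
    simp only [Function.comp_def, ← _root_.pow_mul, Finset.sum_range_succ, Finset.sum_range_zero]
      at h1
    have h2 := (isBigO_refl qc cusp).mul_isLittleO
      (h1.trans_isLittleO (isLittleO_pow (show 1 < A * 2 by lia)))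
    have h3 : (fun z => qc z * ∑ b ∈ Finset.range N, ∑' k, g k * qc ((A * z + b) / N) ^ k -
        N * g N * qc z ^ (A + 1)) =o[cusp] fun z => qc z ^ 2 := by
      refine h2.congr' ?_ (Filter.Eventually.of_forall fun z => by ring)
      filter_upwards [eventually_cusp 0] with z hz
      rw [hg.sum_qc hN hA hz]
      simp only [← _root_.pow_mul]
      simp only [mul_zero, h0, zero_mul, zero_add, mul_one]
      ring
    split_ifs with h
    · subst h; exact h3
    · have h4 := (isLittleO_pow (show 2 < A + 1 by lia)).const_mul_left (N * g N)
      exact (h3.add h4).congr_left fun z => by ring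
  refine ⟨0, 1, 0, fun z => ∑ b ∈ Finset.range N, log (1 + ε b z), one_ne_zero, ?_, ?_⟩
  · filter_upwards [(Filter.eventually_all_finset _).2 fun b hb => eventually_exp_log (hε0 b hb)]
      with z hz
    rw [Complex.exp_sum, Finset.prod_congr rfl hz]
    simp
  · refine (hsum.add hav).congr_left fun z => ?_
    rw [Finset.sum_apply, Finset.sum_sub_distrib, Finset.mul_sum]
    ring

lemma prod_qc_frac {N : ℕ} (hN : 0 < N) (A : ℕ) : ∃ C : ℂ, C ≠ 0 ∧ ∀ z : ℂ,
    ∏ b ∈ Finset.range N, qc ((A * z + b) / N) = C * qc z ^ A := by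
  refine ⟨∏ b ∈ Finset.range N, qc ((b : ℂ) / N),
    Finset.prod_ne_zero_iff.2 fun b _ => qc_ne_zero _, fun z => ?_⟩
  have hN0 : (N : ℂ) ≠ 0 := by exact_mod_cast hN.ne'
  have h1 : ∀ b ∈ Finset.range N, qc ((A * z + b) / N) = qc ((b : ℂ) / N) * qc (A * z / N) :=
    fun b _ => by rw [← qc_add]; congr 1; ring
  rw [Finset.prod_congr rfl h1, Finset.prod_mul_distrib, Finset.prod_const, Finset.card_range,
    ← qc_nat_mul, ← qc_nat_mul]
  congr 2
  field_simp

/-- The power sums attached to an eta quotient: `pe r q = exp (∑ sr r k / k q^k)`. -/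
noncomputable def sr (r : ℕ → ℤ) (k : ℕ) : ℂ :=
  -∑ d ∈ D10, (r d : ℂ) * if d ∣ k then d * sg (k / d) else 0

lemma hasSum_lg_pow {d : ℕ} (hd : 0 < d) {q : ℂ} (hq : ‖q‖ < 1) :
    HasSum (fun k : ℕ => (if d ∣ k then d * sg (k / d) else 0) / k * q ^ k) (lg (q ^ d)) := by
  have h1 := (summable_sg_div (norm_pow_lt_one hq hd.ne')).hasSum
  have hinj : Function.Injective fun l : ℕ => d * l := fun l m h => Nat.eq_of_mul_eq_mul_left hd h
  rw [← hinj.hasSum_iff]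
  · refine h1.congr_fun fun l => ?_
    simp only [Function.comp_apply, dvd_mul_right, if_true, Nat.mul_div_cancel_left _ hd,
      ← _root_.pow_mul]
    rw [Nat.cast_mul, mul_div_mul_left _ _ (by exact_mod_cast hd.ne')]
  · rintro k hk
    rw [if_neg, zero_div, zero_mul]
    rintro ⟨m, rfl⟩
    exact hk ⟨m, rfl⟩

lemma hasSum_pe (r : ℕ → ℤ) {q : ℂ} (hq : ‖q‖ < 1) :
    HasSum (fun k : ℕ => sr r k / k * q ^ k) (-∑ d ∈ D10, r d * lg (q ^ d)) := by
  have h := (hasSum_sum fun d (hd : d ∈ D10) => (hasSum_lg_pow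
    (Nat.pos_of_ne_zero (ne_zero_of_mem_D10 hd)) hq).mul_left (r d : ℂ)).neg
  refine h.congr_fun fun k => ?_
  simp only [sr, neg_div, neg_mul, Finset.sum_div, Finset.sum_mul]
  exact congrArg _ (Finset.sum_congr rfl fun d _ => by ring)

lemma conv_pe (r : ℕ → ℤ) : Conv fun k => sr r k / k := fun _ hy => (hasSum_pe r hy).summable

lemma pe_eq_exp (r : ℕ → ℤ) {q : ℂ} (hq : ‖q‖ < 1) : pe r q = exp (∑' k : ℕ, sr r k / k * q ^ k) := by
  rw [(hasSum_pe r hq).tsum_eq, pe]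

lemma asy_pe (r : ℕ → ℤ) : Asy (fun z => pe r (qc z)) (sr r 2 / 2) := by
  refine ((conv_pe r).asy (by simp)).congr ?_
  filter_upwards [eventually_cusp 0] with z hz using pe_eq_exp r (norm_qc_lt_one hz)

lemma asy_prod_pe (r : ℕ → ℤ) {N A : ℕ} (hN : 0 < N) (hA : 0 < A) :
    Asy (fun z => ∏ b ∈ Finset.range N, pe r (qc ((A * z + b) / N)))
      ((if A = 1 then sr r (2 * N) / 2 else 0) + if A = 2 then sr r N else 0) := by
  have hN0 : (N : ℂ) ≠ 0 := by exact_mod_cast hN.ne'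
  have h := (conv_pe r).asy_prod (by simp) hN hA
  have e : sqCoeff A (fun l => (N : ℂ) * (sr r (N * l) / (N * l : ℕ))) =
      (if A = 1 then sr r (2 * N) / 2 else 0) + if A = 2 then sr r N else 0 := by
    rw [sqCoeff, mul_comm N 2]
    congr 2
    · push_cast; field_simp
    · push_cast; rw [mul_one]; field_simp
  rw [← e]
  refine h.congr ?_
  filter_upwards [eventually_cusp 0] with z hz
  exact Finset.prod_congr rfl fun b _ => pe_eq_exp r (norm_qc_frac_lt_one hN hA b hz)

end LevelTen

namespace LevelTen
open Asymptotics

/-- The Taylor coefficients at the origin. -/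
noncomputable def tc (f : ℂ → ℂ) (k : ℕ) : ℂ := iteratedDeriv k f 0 / k.factorial

lemma hasSum_tc {f : ℂ → ℂ} (hf : DifferentiableOn ℂ f (Metric.ball 0 1)) {q : ℂ} (hq : ‖q‖ < 1) :
    HasSum (fun k => tc f k * q ^ k) (f q) := by
  have h := Complex.hasSum_taylorSeries_on_ball (r := 1) (by simpa using hf) (z := q)
    (by simpa using hq)
  refine h.congr_fun fun k => ?_
  simp [tc]
  ring

lemma tc_zero (f : ℂ → ℂ) : tc f 0 = f 0 := by simp [tc]

/-- The regular part of `jj`, as a function of `q`. -/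
noncomputable def cF (q : ℂ) : ℂ := dslope (pe (vexp 2)) 0 q - 1

/-- The difference quotient of `cF` at the origin. -/
noncomputable def kF : ℂ → ℂ := dslope cF 0

lemma differentiableOn_cF : DifferentiableOn ℂ cF (Metric.ball 0 1) := by
  have h : DifferentiableOn ℂ (pe (vexp 2)) (Metric.ball 0 1) := fun q hq =>
    (differentiableAt_pe _ (by simpa using hq)).differentiableWithinAt
  exact ((Complex.differentiableOn_dslope (Metric.ball_mem_nhds 0 one_pos)).2 h).sub_const 1

lemma differentiableOn_kF : DifferentiableOn ℂ kF (Metric.ball 0 1) :=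
  (Complex.differentiableOn_dslope (Metric.ball_mem_nhds 0 one_pos)).2 differentiableOn_cF

lemma analyticAt_kF : AnalyticAt ℂ kF 0 :=
  differentiableOn_kF.analyticAt (Metric.ball_mem_nhds 0 one_pos)

lemma cF_eq (q : ℂ) : cF q = cF 0 + q * kF q := by
  have := sub_smul_dslope cF 0 q
  simp only [sub_zero, smul_eq_mul] at this
  rw [kF, this]; ring

lemma jj_eq {z : ℂ} (hz : 0 < z.im) : jj z = (qc z)⁻¹ + cF (qc z) := by
  have h := sub_smul_dslope (pe (vexp 2)) 0 (qc z)
  simp only [sub_zero, smul_eq_mul, pe_zero] at h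
  have h0 := qc_ne_zero z
  rw [jj, V_eq_pe (by norm_num) (by norm_num) hz, cF]
  field_simp
  linear_combination -h

/-- The Fourier coefficients of `jj`. -/
noncomputable def cj : ℕ → ℂ := tc cF

lemma hasSum_cj {q : ℂ} (hq : ‖q‖ < 1) : HasSum (fun k => cj k * q ^ k) (cF q) :=
  hasSum_tc differentiableOn_cF hq

/-- The coefficients of `cF 0 - cF`. -/
noncomputable def cg (k : ℕ) : ℂ := if k = 0 then 0 else -cj k

lemma hasSum_cg {q : ℂ} (hq : ‖q‖ < 1) : HasSum (fun k => cg k * q ^ k) (-(q * kF q)) := by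
  have h1 := (hasSum_cj hq).neg
  have h2 := (hasSum_ite_eq (0 : ℕ) (cF 0)).add h1
  rw [cF_eq q] at h2
  rw [show -(q * kF q) = cF 0 + -(cF 0 + q * kF q) by ring]
  refine h2.congr_fun fun k => ?_
  rcases eq_or_ne k 0 with rfl | hk
  · simp [cg, cj, tc_zero]
  · simp [cg, hk]

lemma conv_cg : Conv cg := fun _ hy => (hasSum_cg hy).summable

lemma jj_sub {z w : ℂ} (hz : 0 < z.im) (hw : 0 < w.im) (hne : qc z ≠ qc w) :
    jj z - jj w = ((qc z)⁻¹ - (qc w)⁻¹) *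
      (1 + -(qc z * qc w * (cF (qc z) - cF (qc w)) / (qc z - qc w))) := by
  have h0 := qc_ne_zero z
  have h1 := qc_ne_zero w
  have h2 := sub_ne_zero.2 hne
  rw [jj_eq hz, jj_eq hw]
  field_simp
  ring

lemma hasDerivAt_qc (z : ℂ) : HasDerivAt qc (2 * Real.pi * I * qc z) z := by
  have h := ((hasDerivAt_id z).const_mul (2 * Real.pi * I)).cexp
  unfold qc
  simpa [mul_comm] using h

lemma deriv_jj {z : ℂ} (hz : 0 < z.im) :
    deriv jj z = -(2 * Real.pi * I) * (qc z)⁻¹ * (1 + -(qc z ^ 2 * deriv cF (qc z))) := by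
  have h0 := qc_ne_zero z
  have hev : jj =ᶠ[nhds z] fun w => (qc w)⁻¹ + cF (qc w) := by
    filter_upwards [UH_mem_nhds hz] with w hw using jj_eq hw
  have hc : DifferentiableAt ℂ cF (qc z) := differentiableOn_cF.differentiableAt
    (Metric.isOpen_ball.mem_nhds (by simpa using norm_qc_lt_one hz))
  rw [hev.deriv_eq]
  have h := ((hasDerivAt_qc z).fun_inv h0).fun_add (hc.hasDerivAt.comp z (hasDerivAt_qc z))
  refine h.deriv.trans ?_
  field_simp
  ring

lemma deriv_cF {q : ℂ} (hq : ‖q‖ < 1) : deriv cF q = kF q + q * deriv kF q := by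
  have hk : DifferentiableAt ℂ kF q := differentiableOn_kF.differentiableAt
    (Metric.isOpen_ball.mem_nhds (by simpa using hq))
  rw [show cF = fun q => cF 0 + q * kF q from funext cF_eq]
  have := ((hasDerivAt_id q).mul hk.hasDerivAt).const_add (cF 0)
  refine this.deriv.trans ?_
  simp

lemma isBigO_pair {N A : ℕ} (hN : 0 < N) (hA : 0 < A) (b : ℕ)
    (hne : ∀ z : ℂ, 0 < z.im → qc z ≠ qc ((A * z + b) / N)) :
    (fun z => -(qc z * qc ((A * z + b) / N) * (cF (qc z) - cF (qc ((A * z + b) / N))) /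
      (qc z - qc ((A * z + b) / N))) - qc z * ∑' k, cg k * qc ((A * z + b) / N) ^ k) =O[cusp]
        fun z => qc z ^ 2 * qc ((A * z + b) / N) := by
  have hlip := analyticAt_kF.hasStrictDerivAt.isBigO_sub.comp_tendsto
    (tendsto_qc.prodMk_nhds (tendsto_qc_frac hN hA b))
  simp only [Function.comp_def] at hlip
  have hq : (fun z => (kF (qc z) - kF (qc ((A * z + b) / N))) / (qc z - qc ((A * z + b) / N)))
      =O[cusp] fun _ => (1 : ℂ) := by
    obtain ⟨C, hC⟩ := hlip.bound
    refine IsBigO.of_bound C ?_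
    filter_upwards [hC, eventually_cusp 0] with z h1 hz
    have h2 : 0 < ‖qc z - qc ((A * z + b) / N)‖ := norm_pos_iff.2 (sub_ne_zero.2 (hne z hz))
    rw [norm_div, div_le_iff₀ h2]
    simpa using h1
  have := ((isBigO_refl (fun z => qc z ^ 2 * qc ((A * z + b) / N)) cusp).mul hq).neg_left
  refine this.congr' ?_ (Filter.Eventually.of_forall fun z => mul_one _)
  filter_upwards [eventually_cusp 0] with z hz
  rw [(hasSum_cg (norm_qc_frac_lt_one hN hA b hz)).tsum_eq, cF_eq (qc z),
    cF_eq (qc ((A * z + b) / N))]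
  have h2 := sub_ne_zero.2 (hne z hz)
  field_simp
  ring

lemma isBigO_diag : (fun z => -(qc z ^ 2 * deriv cF (qc z)) - qc z * ∑' k, cg k * qc z ^ k) =O[cusp]
    fun z => qc z ^ 2 * qc z := by
  have h1 : (fun z => deriv kF (qc z)) =O[cusp] fun _ => (1 : ℂ) :=
    (analyticAt_kF.deriv.continuousAt.tendsto.comp tendsto_qc).isBigO_one ℂ
  have := ((isBigO_refl (fun z => qc z ^ 2 * qc z) cusp).mul h1).neg_left
  refine this.congr' ?_ (Filter.Eventually.of_forall fun z => mul_one _)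
  filter_upwards [eventually_cusp 0] with z hz
  rw [(hasSum_cg (norm_qc_lt_one hz)).tsum_eq, deriv_cF (norm_qc_lt_one hz)]
  ring

lemma qc_ne_qc_frac {a d b : ℕ} (hd : 0 < d) (hb : b < d) (h : ¬(a = d ∧ b = 0)) {z : ℂ}
    (hz : 0 < z.im) : qc z ≠ qc ((a * z + b) / d) := by
  intro he
  obtain ⟨m, hm⟩ := qc_eq_iff.1 he
  have hd0 : (d : ℂ) ≠ 0 := by exact_mod_cast hd.ne'
  have h1 : (d : ℂ) * z = a * z + b + m * d := by
    field_simp at hm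
    linear_combination hm
  have him := congrArg Complex.im h1
  simp at him
  have had : a = d := by
    rcases him with h | h
    · exact h.symm
    · exact absurd h hz.ne'
  subst had
  have h2 : ((b + m * a : ℤ) : ℂ) = 0 := by push_cast; linear_combination -h1
  have h3 : (b + m * a : ℤ) = 0 := by exact_mod_cast h2
  have hb0 : b ≠ 0 := fun hb0 => h ⟨rfl, hb0⟩
  have h4 : (a : ℤ) ∣ b := ⟨-m, by linear_combination h3⟩
  exact absurd (Nat.le_of_dvd (Nat.pos_of_ne_zero hb0) (Int.natCast_dvd_natCast.1 h4)) (by lia)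

end LevelTen

namespace LevelTen
open Asymptotics

lemma asy_one_sub_pow {k : ℕ} (hk : 0 < k) :
    Asy (fun z => 1 - qc z ^ k) (if k = 1 then -1 / 2 else if k = 2 then -1 else 0) := by
  simp only [sub_eq_add_neg]
  rcases (show k = 1 ∨ k = 2 ∨ 2 < k by lia) with rfl | rfl | h
  · have := Asy.one_add (ε := fun z => -qc z ^ 1) (α := -1) (β := 0) (by simp)
    norm_num at this ⊢
    exact this
  · have := Asy.one_add (ε := fun z => -qc z ^ 2) (α := 0) (β := -1) (by simp)
    norm_num at this ⊢
    exact this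
  · have := Asy.one_add (ε := fun z => -qc z ^ k) (α := 0) (β := 0) (by
      simpa using (isLittleO_pow h))
    rw [if_neg (by lia), if_neg (by lia)]
    simpa using this

/-- The coefficient of `q²` in the logarithm of `q^{-d} - q^{-a}`, up to normalisation. -/
noncomputable def uc (a d : ℕ) : ℂ :=
  if a + 1 = d ∨ d + 1 = a then -1 / 2 else if a + 2 = d ∨ d + 2 = a then -1 else 0

lemma asy_zpow_sub {a d : ℕ} (h : a ≠ d) :
    Asy (fun z => (qc z)⁻¹ ^ d - (qc z)⁻¹ ^ a) (uc a d) := by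
  rcases lt_or_gt_of_ne h with hlt | hlt
  · obtain ⟨k, rfl⟩ := Nat.exists_eq_add_of_lt hlt
    have h1 := (Asy.qc_zpow (-((a + k + 1 : ℕ) : ℤ)) one_ne_zero).mul
      (asy_one_sub_pow (Nat.succ_pos k))
    have e : (0 : ℂ) + (if k.succ = 1 then -1 / 2 else if k.succ = 2 then -1 else 0) =
        uc a (a + k + 1) := by
      rw [uc, zero_add]
      congr 1
      · exact propext (by lia)
      · congr 1; exact propext (by lia)
    rw [e] at h1
    refine h1.congr (Filter.Eventually.of_forall fun z => ?_)
    have := qc_ne_zero z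
    simp only [_root_.inv_pow, _root_.zpow_neg, zpow_natCast, Nat.succ_eq_add_one, add_assoc, _root_.pow_add]
    field_simp
  · obtain ⟨k, rfl⟩ := Nat.exists_eq_add_of_lt hlt
    have h1 := (Asy.qc_zpow (-((d + k + 1 : ℕ) : ℤ)) (neg_ne_zero.2 one_ne_zero)).mul
      (asy_one_sub_pow (Nat.succ_pos k))
    have e : (0 : ℂ) + (if k.succ = 1 then -1 / 2 else if k.succ = 2 then -1 else 0) =
        uc (d + k + 1) d := by
      rw [uc, zero_add]
      congr 1
      · exact propext (by lia)
      · congr 1; exact propext (by lia)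
    rw [e] at h1
    refine h1.congr (Filter.Eventually.of_forall fun z => ?_)
    have := qc_ne_zero z
    simp only [_root_.inv_pow, _root_.zpow_neg, zpow_natCast, Nat.succ_eq_add_one, add_assoc, _root_.pow_add]
    field_simp
    ring

lemma isPrimitiveRoot_qc {d : ℕ} (hd : 0 < d) : IsPrimitiveRoot (qc (1 / d))⁻¹ d := by
  have h := (Complex.isPrimitiveRoot_exp d hd.ne').inv
  have e : qc (1 / d) = exp (2 * Real.pi * I / d) := by
    rw [qc]; congr 1; ring
  rwa [e]

lemma prod_inv_sub {a d : ℕ} (hd : 0 < d) (z : ℂ) :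
    ∏ b ∈ Finset.range d, ((qc z)⁻¹ - (qc ((a * z + b) / d))⁻¹) = (qc z)⁻¹ ^ d - (qc z)⁻¹ ^ a := by
  have hd0 : (d : ℂ) ≠ 0 := by exact_mod_cast hd.ne'
  have h1 : ((qc (a * z / d))⁻¹) ^ d = (qc z)⁻¹ ^ a := by
    rw [_root_.inv_pow, _root_.inv_pow, ← qc_nat_mul, ← qc_nat_mul]
    congr 2
    field_simp
  have h2 := congrArg (Polynomial.eval (qc z)⁻¹) (X_pow_sub_C_eq_prod (isPrimitiveRoot_qc hd) hd h1)
  simp only [Polynomial.eval_sub, Polynomial.eval_pow, Polynomial.eval_X, Polynomial.eval_C,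
    Polynomial.eval_prod] at h2
  rw [h2]
  refine Finset.prod_congr rfl fun b _ => ?_
  rw [_root_.inv_pow, ← qc_nat_mul, ← _root_.mul_inv, ← qc_add]
  congr 3
  field_simp
  ring

/-- The difference `jj z - jj w` for `w = (a z + b) / d`, replaced by the derivative when `w = z`. -/
noncomputable def Lb (a d b : ℕ) (z : ℂ) : ℂ :=
  if a = d ∧ b = 0 then deriv jj z else jj z - jj ((a * z + b) / d)

/-- The leading factor of `Lb`. -/
noncomputable def Ub (a d b : ℕ) (z : ℂ) : ℂ :=
  if a = d ∧ b = 0 then -(2 * Real.pi * I) * (qc z)⁻¹ else (qc z)⁻¹ - (qc ((a * z + b) / d))⁻¹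

/-- The relative error of the leading factor of `Lb`. -/
noncomputable def Eb (a d b : ℕ) (z : ℂ) : ℂ :=
  if a = d ∧ b = 0 then -(qc z ^ 2 * deriv cF (qc z)) else
    -(qc z * qc ((a * z + b) / d) * (cF (qc z) - cF (qc ((a * z + b) / d))) /
      (qc z - qc ((a * z + b) / d)))

lemma im_frac_pos {N A : ℕ} (hN : 0 < N) (hA : 0 < A) (b : ℕ) {z : ℂ} (hz : 0 < z.im) :
    0 < ((A * z + b) / N).im := by
  rw [Complex.div_natCast_im]
  simp
  positivity

lemma Lb_eq {a d b : ℕ} (ha : 0 < a) (hb : b < d) {z : ℂ} (hz : 0 < z.im) :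
    Lb a d b z = Ub a d b z * (1 + Eb a d b z) := by
  have hd : 0 < d := by lia
  unfold Lb Ub Eb
  split_ifs with h
  · exact deriv_jj hz
  · exact jj_sub hz (im_frac_pos hd ha b hz) (qc_ne_qc_frac hd hb h hz)

lemma asy_prod_Ub {a d : ℕ} (hd : 0 < d) :
    Asy (fun z => ∏ b ∈ Finset.range d, Ub a d b z) (uc a d) := by
  by_cases h : a = d
  · subst h
    have ha0 : (a : ℂ) ≠ 0 := by exact_mod_cast hd.ne'
    have hb : ∀ b ∈ Finset.range a, Asy (Ub a a b) 0 := fun b hb => by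
      by_cases hb0 : b = 0
      · have := Asy.qc_zpow (-1) (C := -(2 * Real.pi * I)) (by simp)
        refine this.congr (Filter.Eventually.of_forall fun z => ?_)
        simp [Ub, hb0]
      · have hne : 1 - (qc (b / a))⁻¹ ≠ 0 := by
          rw [sub_ne_zero]
          intro h1
          have h2 := qc_ne_qc_frac hd (Finset.mem_range.1 hb) (a := a) (by tauto) (z := I) (by simp)
          apply h2
          rw [show ((a * I + b) / a : ℂ) = I + b / a by field_simp, qc_add,
            ← inv_inv (qc (b / a)), ← h1]
          simp
        have := Asy.qc_zpow (-1) hne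
        refine this.congr (Filter.Eventually.of_forall fun z => ?_)
        rw [Ub, if_neg (by tauto), show ((a * z + b) / a : ℂ) = z + b / a by field_simp, qc_add,
          _root_.zpow_neg_one, _root_.mul_inv]
        ring
    have := Asy.prod hb
    simpa [uc] using this
  · have : ∀ b, Ub a d b = fun z => (qc z)⁻¹ - (qc ((a * z + b) / d))⁻¹ := fun b => by
      ext z; rw [Ub, if_neg (by tauto)]
    simp only [this, prod_inv_sub hd]
    exact asy_zpow_sub h

lemma asy_prod_Lb {a d : ℕ} (ha : 0 < a) (hd : 0 < d) :
    Asy (fun z => ∏ b ∈ Finset.range d, Lb a d b z) (uc a d + if a = 1 then d * cg d else 0) := by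
  have hE : Asy (fun z => ∏ b ∈ Finset.range d, (1 + Eb a d b z)) (if a = 1 then d * cg d else 0) := by
    refine conv_cg.asy_pair (by simp [cg]) hd ha fun b hb => ?_
    by_cases h : a = d ∧ b = 0
    · obtain ⟨rfl, rfl⟩ := h
      have ha0 : (a : ℂ) ≠ 0 := by exact_mod_cast hd.ne'
      simpa [Eb, ha0] using isBigO_diag
    · simp only [Eb, if_neg h]
      exact isBigO_pair hd ha b fun z hz => qc_ne_qc_frac hd (Finset.mem_range.1 hb) h hz
  refine ((asy_prod_Ub hd).mul hE).congr ?_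
  filter_upwards [eventually_cusp 0] with z hz
  rw [← Finset.prod_mul_distrib]
  exact Finset.prod_congr rfl fun b hb => Lb_eq ha (Finset.mem_range.1 hb) hz

end LevelTen

namespace LevelTen
open Asymptotics

/-- Exponents of the eta quotient `VV`. -/
def pexp : ℕ → ℤ := r4 0 4 8 (-12)

lemma adm_pexp : Adm pexp (fun e => if e = 1 then -3 else 1) := ⟨by decide, by decide⟩

lemma VV_eq {z : ℂ} (hz : 0 < z.im) : VV z = etaQ pexp z := by
  simp only [VV, V, etaQ]
  rw [Finset.prod_comm]
  refine Finset.prod_congr rfl fun d hd => ?_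
  have hne : dedekindEta (d * z) ≠ 0 := dedekindEta_ne_zero (by
    have : 0 < d := Nat.pos_of_ne_zero (ne_zero_of_mem_D10 hd)
    simp; positivity)
  rw [D10_eq, Finset.prod_insert (by decide), Finset.prod_insert (by decide),
    Finset.prod_insert (by decide), Finset.prod_singleton, ← zpow_add₀ hne, ← zpow_add₀ hne,
    ← zpow_add₀ hne]
  congr 1
  rcases dvd_ten_cases (mem_D10.1 hd) with rfl | rfl | rfl | rfl <;> decide

lemma asy_VV : Asy VV (sr pexp 2 / 2) := by
  have h := (Asy.qc_zpow (-3) one_ne_zero).mul (asy_pe pexp)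
  rw [zero_add] at h
  refine h.congr ?_
  filter_upwards [eventually_cusp 0] with z hz
  rw [VV_eq hz, adm_pexp.eq_pe hz]
  simp

lemma asy_prod_VV {f : ℕ} (hf : f ∣ 10) {N A : ℕ} (hN : 0 < N) (hA : 0 < A) :
    Asy (fun z => ∏ b ∈ Finset.range N, VV (mo (W f) ((A * z + b) / N)))
      ((if A = 1 then sr (fun d => pexp (star d f)) (2 * N) / 2 else 0) +
        if A = 2 then sr (fun d => pexp (star d f)) N else 0) := by
  obtain ⟨χ, h0, hχ⟩ := adm_pexp.eq_pe_W (mem_D10.2 hf)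
  obtain ⟨C, hC, hY⟩ := prod_qc_frac hN A
  set m : ℤ := if f = 1 then -3 else 1 with hm
  have h := (Asy.qc_zpow (A * m) (C := χ ^ N * C ^ m)
    (mul_ne_zero (pow_ne_zero _ h0) (zpow_ne_zero _ hC))).mul
      (asy_prod_pe (fun d => pexp (star d f)) hN hA)
  rw [zero_add] at h
  refine h.congr ?_
  filter_upwards [eventually_cusp 0] with z hz
  have h1 : ∀ b ∈ Finset.range N, VV (mo (W f) ((A * z + b) / N)) =
      χ * (qc ((A * z + b) / N) ^ m * pe (fun d => pexp (star d f)) (qc ((A * z + b) / N))) :=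
    fun b _ => by
      have hw := im_frac_pos hN hA b hz
      rw [VV_eq ((AL_W hf).mo_im_pos hw), hχ _ hw]
  rw [Finset.prod_congr rfl h1, Finset.prod_mul_distrib, Finset.prod_mul_distrib,
    Finset.prod_const, Finset.card_range, Finset.prod_zpow, hY z, mul_zpow, _root_.zpow_mul,
    zpow_natCast]
  ring

lemma asy_hh : Asy (fun z => hh z ^ 24) (24 * (sr (fun _ => 1) 2 / 2)) := by
  have h := (Asy.qc_zpow 18 one_ne_zero).mul ((asy_pe fun _ => 1).pow 24)
  rw [zero_add] at h
  refine h.congr ?_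
  filter_upwards [eventually_cusp 0] with z hz
  have h1 : hh z ^ 24 = etaQ (fun _ => 24) z := by
    simp only [hh, etaQ, ← Finset.prod_pow]
    exact Finset.prod_congr rfl fun d _ => by rw [zpow_one]; rfl
  rw [h1, etaQ_eq_exp (m := 18) (by decide) hz, pe, ← Complex.exp_nat_mul, one_mul]
  congr 2
  push_cast
  simp only [one_mul, Finset.mul_sum, mul_neg]

lemma Sc_rep_one {a b d : ℕ} (hd : 0 < d) (hb : b < d) :
    Sc (rep 1 a b d) ↔ a = d ∧ b = 0 := by
  constructor
  · rintro ⟨k, C, hC, h⟩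
    have h00 := congrFun (congrFun h 0) 0
    have h01 := congrFun (congrFun h 0) 1
    have h10 := congrFun (congrFun h 1) 0
    have h11 := congrFun (congrFun h 1) 1
    simp only [rep, Matrix.smul_apply, smul_eq_mul] at h00 h01 h10 h11
    norm_num at h00 h01 h10 h11
    have hk : k ≠ 0 := by rintro rfl; simp at h11; lia
    have hdet := hC.det_eq
    rw [Matrix.det_fin_two] at hdet
    have hc : C 1 0 = 0 := by tauto
    rw [hc, mul_zero, sub_zero] at hdet
    have had : C 0 0 = C 1 1 := by
      rcases Int.eq_one_or_neg_one_of_mul_eq_one (by exact_mod_cast hdet) with h1 | h1 <;>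
        rw [h1] at hdet ⊢ <;> push_cast at hdet <;> linarith
    have hda : a = d := by
      have : (a : ℤ) = d := by rw [h00, h11, had]
      exact_mod_cast this
    refine ⟨hda, ?_⟩
    have hdvd : (d : ℤ) ∣ b := by
      rw [h01, h11]
      refine ⟨C 0 0 * C 0 1, ?_⟩
      push_cast at hdet
      linear_combination -k * C 0 1 * hdet
    by_contra h0
    exact absurd (Nat.le_of_dvd (Nat.pos_of_ne_zero h0) (Int.natCast_dvd_natCast.1 hdvd)) (by lia)
  · rintro ⟨rfl, rfl⟩
    refine ⟨a, 1, AL.one, ?_⟩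
    ext i j
    simp only [Matrix.smul_apply, smul_eq_mul]
    fin_cases i <;> fin_cases j <;> simp [rep]

lemma not_Sc_rep {f a b d : ℕ} (hf : f ∣ 10) (hf1 : f ≠ 1) (ha : 0 < a) (hd : 0 < d)
    (hb : b < f * d) : ¬Sc (rep f a b d) := by
  rintro ⟨k, C, hC, h⟩
  have hdet := (Hk_rep hf a b d).det_eq
  have hf0 : 0 < f := Nat.pos_of_dvd_of_pos hf (by norm_num)
  have hk2 : k ^ 2 = f * a * d := by
    rw [h, Matrix.det_smul, hC.det_eq] at hdet
    simpa using hdet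
  obtain ⟨m, hm⟩ : ∃ m : ℕ, k = m ∨ k = -m := ⟨k.natAbs, Int.natAbs_eq k⟩
  have hmm : 1 * m * m = f * a * d := by
    have : (m : ℤ) * m = f * a * d := by rcases hm with rfl | rfl <;> linear_combination hk2
    rw [one_mul]; exact_mod_cast this
  have hm0 : 0 < m := Nat.pos_of_ne_zero (by rintro rfl; simp at hmm; omega)
  have hrep : rep 1 m 0 m = (m : ℤ) • (1 : M2) := by
    ext i j
    simp only [Matrix.smul_apply, smul_eq_mul]
    fin_cases i <;> fin_cases j <;> simp [rep]
  obtain ⟨C', hC', h'⟩ : ∃ C', AL 1 C' ∧ rep f a b d = C' * rep 1 m 0 m := by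
    rcases hm with rfl | rfl
    · exact ⟨C, hC, by rw [hrep, h, Matrix.mul_smul, Matrix.mul_one]⟩
    · exact ⟨-C, hC.neg, by rw [hrep, h, Matrix.mul_smul, Matrix.mul_one]; simp⟩
  exact hf1 (rep_unique (one_dvd _) hf hm0 hm0 ha hmm (by lia) hb hC' h').1.symm

end LevelTen

namespace LevelTen
open Asymptotics

lemma prod_ite_zero {d : ℕ} (hd : 0 < d) (p : Prop) [Decidable p] (x : ℂ) :
    ∏ b ∈ Finset.range d, (if p ∧ b = 0 then x else 1) = if p then x else 1 := by
  by_cases hp : p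
  · simp only [hp, true_and, if_true]
    rw [Finset.prod_ite_eq' (Finset.range d) 0 fun _ => x, if_pos (Finset.mem_range.2 hd)]
  · simp [hp]

/-- The contribution of the classes `[[a, b], [0, d]]`. -/
lemma asy_block_one {a d : ℕ} (ha : 0 < a) (hd : 0 < d) :
    Asy (fun z => ∏ b ∈ Finset.range d, Fc (rep 1 a b d) z)
      (24 * (uc a d + if a = 1 then d * cg d else 0) - 6 * d * (sr pexp 2 / 2) -
        6 * ((if a = 1 then sr pexp (2 * d) / 2 else 0) + if a = 2 then sr pexp d else 0) -
          if a = d then 24 * (sr (fun _ => 1) 2 / 2) else 0) := by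
  obtain ⟨Γ, hΓ, hK, hS⟩ := exists_KK
  have hVVp := asy_prod_VV (one_dvd 10) hd ha
  simp only [W_one, mo_one, star_one] at hVVp
  have hH : Asy (fun z => if a = d then (hh z ^ 24)⁻¹ else 1)
      (-(if a = d then 24 * (sr (fun _ => 1) 2 / 2) else 0)) := by
    split_ifs with h
    · exact asy_hh.inv
    · simpa using Asy.const one_ne_zero
  have h := (((((Asy.const (pow_ne_zero (6 * d) hΓ)).mul ((asy_prod_Lb ha hd).pow 24))).mul
    (asy_VV.pow (6 * d)).inv).mul (hVVp.pow 6).inv).mul hH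
  have e : ∀ x y u v w : ℂ, 0 + (24 : ℕ) * x + -((6 * d : ℕ) * u) + -((6 : ℕ) * v) + -w =
      24 * x - 6 * d * u - 6 * v - w := fun x y u v w => by push_cast; ring
  rw [e _ 0] at h
  refine h.congr ?_
  filter_upwards [eventually_cusp 0] with z hz
  have hV := VV_ne_zero hz
  have h1 : ∀ b ∈ Finset.range d, Fc (rep 1 a b d) z =
      Γ ^ 6 * Lb a d b z ^ 24 * (VV z ^ 6)⁻¹ * (VV ((a * z + b) / d) ^ 6)⁻¹ *
        if a = d ∧ b = 0 then (hh z ^ 24)⁻¹ else 1 := fun b hb => by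
    have hb' := Finset.mem_range.1 hb
    have hw := im_frac_pos hd ha b hz
    have hVw := VV_ne_zero hw
    unfold Fc Lb
    by_cases hs : a = d ∧ b = 0
    · rw [if_pos ((Sc_rep_one hd hb').2 hs), if_pos hs, if_pos hs, hS z hz]
      obtain ⟨rfl, rfl⟩ := hs
      have ha0 : (a : ℂ) ≠ 0 := by exact_mod_cast ha.ne'
      rw [show ((a * z + (0 : ℕ)) / a : ℂ) = z by push_cast; field_simp; simp]
      field_simp
    · rw [if_neg (mt (Sc_rep_one hd hb').1 hs), if_neg hs, if_neg hs, mo_rep (one_dvd _) ha hd hz,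
        W_one, mo_one]
      simp only [Nat.cast_one, one_mul]
      rw [hK z _ hz hw]
      field_simp
  rw [Finset.prod_congr rfl h1]
  simp only [Finset.prod_mul_distrib, prod_ite_zero hd, Finset.prod_const, Finset.card_range,
    Finset.prod_pow, Finset.prod_inv_distrib]
  simp only [_root_.pow_mul, _root_.inv_pow]

/-- The contribution of the classes involving a nontrivial Atkin–Lehner matrix. -/
lemma asy_block {f a d : ℕ} (hf : f ∣ 10) (hf1 : f ≠ 1) (ha : 0 < a) (hd : 0 < d) :
    Asy (fun z => ∏ b ∈ Finset.range (f * d), Fc (rep f a b d) z)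
      (24 * (f * d) * (sr (vexp f) 2 / 2) - 6 * (f * d) * (sr pexp 2 / 2) -
        6 * if f * a = 2 then sr (fun d => pexp (star d f)) (f * d) else 0) := by
  obtain ⟨Γ, hΓ, hK, -⟩ := exists_KK
  obtain ⟨β, hβ⟩ := exists_beta
  obtain ⟨hβ0, hβ⟩ := hβ f (mem_D10.2 hf) hf1
  have hf2 : 2 ≤ f := by
    have := Nat.pos_of_dvd_of_pos hf (by norm_num); lia
  have hN : 0 < f * d := by positivity
  have hA : 0 < f * a := by positivity
  have hA1 : f * a ≠ 1 := by nlinarith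
  have hVVp := asy_prod_VV hf hN hA
  rw [if_neg hA1, zero_add] at hVVp
  set u : ℂ → ℂ := fun q => (pe (vexp f) q)⁻¹ with hu
  have hud : ∀ q : ℂ, ‖q‖ < 1 → DifferentiableAt ℂ u q := fun q hq =>
    (differentiableAt_pe _ hq).fun_inv (pe_ne_zero _ _)
  have hgd : DifferentiableOn ℂ (fun q => -β f * q * u q) (Metric.ball 0 1) := fun q hq =>
    (((differentiableAt_id.const_mul (-β f)).fun_mul
      (hud q (by simpa using hq)))).differentiableWithinAt
  have hg0 : tc (fun q => -β f * q * u q) 0 = 0 := by rw [tc_zero]; simp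
  have hVf : ∀ z : ℂ, 0 < z.im → (V f z)⁻¹ = qc z * u (qc z) := fun z hz => by
    rw [V_eq_pe hf hf1 hz, mul_inv, inv_inv]
  have huX : (fun z => u (qc z) - 1) =O[cusp] qc := by
    have h1 := (hud 0 (by simp)).isBigO_sub.comp_tendsto tendsto_qc
    simpa [Function.comp_def, hu, pe_zero] using h1
  have hu1 : ∀ b : ℕ, (fun z => u (qc (((f * a : ℕ) * z + b) / (f * d : ℕ)))) =O[cusp]
      fun _ => (1 : ℂ) := fun b =>
    (((hud 0 (by simp)).continuousAt.tendsto).comp (tendsto_qc_frac hN hA b)).isBigO_one ℂ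
  have hE : Asy (fun z => ∏ b ∈ Finset.range (f * d),
      (1 + -β f * (qc z * u (qc z)) * (qc (((f * a : ℕ) * z + b) / (f * d : ℕ)) *
        u (qc (((f * a : ℕ) * z + b) / (f * d : ℕ)))))) 0 := by
    have := Conv.asy_pair (fun y hy => (hasSum_tc hgd hy).summable) hg0 hN hA
      (ε := fun b z => -β f * (qc z * u (qc z)) * (qc (((f * a : ℕ) * z + b) / (f * d : ℕ)) *
        u (qc (((f * a : ℕ) * z + b) / (f * d : ℕ))))) fun b _ => by
      have h1 := (((isBigO_refl (fun z => qc z * qc (((f * a : ℕ) * z + b) / (f * d : ℕ))) cusp).mul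
        (huX.mul (hu1 b))).const_mul_left (-β f))
      refine h1.congr' ?_ (Filter.Eventually.of_forall fun z => by ring)
      filter_upwards [eventually_cusp 0] with z hz
      rw [(hasSum_tc hgd (norm_qc_frac_lt_one hN hA b hz)).tsum_eq]
      ring
    rwa [if_neg hA1] at this
  have hVz : Asy (V f) (sr (vexp f) 2 / 2) := by
    have h := (Asy.qc_zpow (-1) one_ne_zero).mul (asy_pe (vexp f))
    rw [zero_add] at h
    refine h.congr ?_
    filter_upwards [eventually_cusp 0] with z hz
    rw [V_eq_pe hf hf1 hz, _root_.zpow_neg_one, one_mul]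
  have h := ((((Asy.const (pow_ne_zero (6 * (f * d)) hΓ)).mul (hVz.pow (24 * (f * d)))).mul
    (hE.pow 24)).mul (asy_VV.pow (6 * (f * d))).inv).mul (hVVp.pow 6).inv
  have e : ∀ x y u v : ℂ, 0 + (24 * (f * d) : ℕ) * x + (24 : ℕ) * 0 + -((6 * (f * d) : ℕ) * u) +
      -((6 : ℕ) * v) = 24 * (f * d) * x - 6 * (f * d) * u - 6 * v := fun x y u v => by
    push_cast; ring
  rw [e _ 0] at h
  refine h.congr ?_
  filter_upwards [eventually_cusp 0] with z hz
  have hV := VV_ne_zero hz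
  have h1 : ∀ b ∈ Finset.range (f * d), Fc (rep f a b d) z =
      Γ ^ 6 * V f z ^ 24 * (1 + -β f * (qc z * u (qc z)) *
        (qc (((f * a : ℕ) * z + b) / (f * d : ℕ)) *
          u (qc (((f * a : ℕ) * z + b) / (f * d : ℕ))))) ^ 24 * (VV z ^ 6)⁻¹ *
            (VV (mo (W f) (((f * a : ℕ) * z + b) / (f * d : ℕ))) ^ 6)⁻¹ := fun b hb => by
    have hw := im_frac_pos hN hA b hz
    have hw' := (AL_W hf).mo_im_pos hw
    have hVw := VV_ne_zero hw'
    have hz0 := V_ne_zero f hz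
    have hw0 := V_ne_zero f hw
    rw [Fc, if_neg (not_Sc_rep hf hf1 ha hd (Finset.mem_range.1 hb)), mo_rep hf ha hd hz,
      ← Nat.cast_mul, ← Nat.cast_mul, hK z _ hz hw', ← hVf z hz, ← hVf _ hw]
    have h2 : jj z - jj (mo (W f) (((f * a : ℕ) * z + b) / (f * d : ℕ))) =
        V f z * (1 + -β f * (V f z)⁻¹ * (V f (((f * a : ℕ) * z + b) / (f * d : ℕ)))⁻¹) := by
      have h3 := (hβ _ hw).2
      rw [jE] at h3
      rw [h3, V_eq hf hf1 hz]
      rw [V_eq hf hf1 hz] at hz0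
      field_simp
      ring
    rw [h2]
    field_simp
  rw [Finset.prod_congr rfl h1]
  simp only [Finset.prod_mul_distrib, Finset.prod_const, Finset.card_range,
    Finset.prod_pow, Finset.prod_inv_distrib]
  simp only [_root_.pow_mul, _root_.inv_pow]

end LevelTen

namespace LevelTen

open Asymptotics

/-! ### The leading coefficients of `jS` and the trace formula -/

/-- Coefficients of `jS` at the cusp: `jS = q⁻¹ + κ 0 + κ 1 q + …`. -/
noncomputable def kap (k : ℕ) : ℂ := tc jSd (k + 1)

lemma hasSum_jSd {q : ℂ} (hq : ‖q‖ < 1) : HasSum (fun k => tc jSd k * q ^ k) (jSd q) :=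
  hasSum_tc (fun w hw => (differentiableAt_jSd (by simpa using hw)).differentiableWithinAt) hq

lemma jSd_expansion : (fun z => jSd (qc z) - 1 - kap 0 * qc z - kap 1 * qc z ^ 2) =O[cusp]
    fun z => qc z ^ 3 := by
  have hc : Conv (tc jSd) := fun y hy => (hasSum_jSd hy).summable
  refine ((hc.isBigO 3).comp_tendsto tendsto_qc).congr' ?_ (by rfl)
  filter_upwards [eventually_cusp 0] with z hz
  simp only [Function.comp]
  rw [(hasSum_jSd (norm_qc_lt_one hz)).tsum_eq]
  simp [Finset.sum_range_succ, tc_zero, jSd_zero, kap]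
  ring

lemma asy_jS_sub (x : ℂ) : Asy (fun z => jS z - x) (kap 1 - (kap 0 - x) ^ 2 / 2) := by
  have h := Asy.one_add (ε := fun z => jSd (qc z) - 1 - x * qc z) (α := kap 0 - x) (β := kap 1)
    ((jSd_expansion.trans_isLittleO (isLittleO_pow_succ 2)).congr_left fun z => by ring)
  have h' := (Asy.qc_zpow (-1) one_ne_zero).mul h
  rw [zero_add] at h'
  refine h'.congr ?_
  filter_upwards [eventually_cusp 0] with z hz
  rw [jS_eq hz, _root_.zpow_neg_one]
  field_simp [qc_ne_zero z]
  ring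

lemma tendsto_norm_jS : Filter.Tendsto (fun z => ‖jS z‖) cusp Filter.atTop := by
  have h1 : Filter.Tendsto (fun z => ‖jSd (qc z)‖) cusp (nhds 1) := by
    have := ((differentiableAt_jSd (q := 0) (by simp)).continuousAt.tendsto.comp tendsto_qc).norm
    simpa [jSd_zero] using this
  have h2 : Filter.Tendsto (fun z => ‖qc z‖⁻¹) cusp Filter.atTop := by
    refine Filter.Tendsto.inv_tendsto_nhdsGT_zero (tendsto_nhdsWithin_iff.2 ⟨?_, ?_⟩)
    · simpa using tendsto_qc.norm
    · exact Filter.Eventually.of_forall fun z => norm_pos_iff.2 (qc_ne_zero z)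
  refine (h2.atTop_mul_pos one_pos h1).congr' ?_
  filter_upwards [eventually_cusp 0] with z hz
  rw [jS_eq hz, norm_mul, norm_inv]

lemma polynomial_eq_zero {R : Polynomial ℂ}
    (h : Filter.Tendsto (fun z => R.eval (jS z)) cusp (nhds 0)) : R = 0 := by
  have hn : Filter.Tendsto (fun z => ‖R.eval (jS z)‖) cusp (nhds 0) := by simpa using h.norm
  by_cases hd : 0 < R.degree
  · exact absurd (R.tendsto_norm_atTop hd tendsto_norm_jS) (not_tendsto_atTop_of_tendsto_nhds hn)
  · rw [Polynomial.eq_C_of_degree_le_zero (not_lt.1 hd)] at h ⊢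
    simp only [Polynomial.eval_C] at h
    rw [tendsto_nhds_unique tendsto_const_nhds h, map_zero]

/-- The second Faber polynomial of `jS`. -/
lemma eval_eq {P : Polynomial ℂ} {e : ℤ → ℂ} (hP : HasQExp (fun z => P.eval (jnStar 10 z)) e (-2))
    (he2 : e (-2) = 1) (he1 : e (-1) = 0) (he0 : e 0 = 0) (x : ℂ) :
    P.eval x = (x - kap 0) ^ 2 - 2 * kap 1 := by
  set a : ℕ → ℂ := fun m => e (-2 + m) with ha
  have hs : ∀ z : ℂ, 0 < z.im → HasSum (fun m => a m * qc z ^ m) (qc z ^ 2 * P.eval (jS z)) := by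
    intro z hz
    have h := (hP.2 z hz).mul_left (qc z ^ 2)
    simp only [jnStar_ten] at h
    refine h.congr_fun fun m => ?_
    rw [zpow_add₀ (qc_ne_zero z), zpow_natCast, _root_.zpow_neg]
    have := qc_ne_zero z
    simp only [ha]
    field_simp
  have hc : Conv a := fun y hy => by
    by_cases h0 : y = 0
    · subst h0
      exact summable_of_ne_finset_zero (s := {0}) fun k hk => by simp_all
    · obtain ⟨z, hz⟩ := exists_qc_eq h0
      rw [← hz] at hy ⊢
      exact (hs z (im_pos_of_norm_qc_lt_one hy)).summable
  have h1 : (fun z => qc z ^ 2 * P.eval (jS z) - 1) =O[cusp] fun z => qc z ^ 3 := by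
    refine ((hc.isBigO 3).comp_tendsto tendsto_qc).congr' ?_ (by rfl)
    filter_upwards [eventually_cusp 0] with z hz
    simp only [Function.comp]
    rw [(hs z hz).tsum_eq]
    simp [Finset.sum_range_succ, ha, he2, he1, he0]
  set R : Polynomial ℂ := P - ((Polynomial.X - Polynomial.C (kap 0)) ^ 2 - Polynomial.C (2 * kap 1))
    with hR
  have hq1 : qc =O[cusp] fun _ => (1 : ℂ) := tendsto_qc.isBigO_one ℂ
  have h2 : (fun z => qc z ^ 2 * R.eval (jS z)) =O[cusp] fun z => qc z ^ 3 := by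
    have hE := jSd_expansion
    have h3 : (fun z => (jSd (qc z) - 1 - kap 0 * qc z - kap 1 * qc z ^ 2) *
        (jSd (qc z) + 1 - kap 0 * qc z + kap 1 * qc z ^ 2)) =O[cusp] fun z => qc z ^ 3 := by
      have hb : Filter.Tendsto (fun z => jSd (qc z) + 1 - kap 0 * qc z + kap 1 * qc z ^ 2) cusp
          (nhds (jSd 0 + 1 - kap 0 * 0 + kap 1 * 0 ^ 2)) := by
        have h4 := (differentiableAt_jSd (q := 0) (by simp)).continuousAt.tendsto.comp tendsto_qc
        exact ((h4.add_const 1).sub (tendsto_qc.const_mul _)).add ((tendsto_qc.pow 2).const_mul _)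
      simpa using hE.mul (hb.isBigO_one ℂ)
    have h4 : (fun z => kap 1 ^ 2 * qc z ^ 4) =O[cusp] fun z => qc z ^ 3 :=
      (isLittleO_pow_succ 3).isBigO.const_mul_left _
    refine ((h1.sub h3).sub h4).congr' ?_ (by rfl)
    filter_upwards [eventually_cusp 0] with z hz
    have hj : qc z * jS z = jSd (qc z) := by rw [jS_eq hz, mul_inv_cancel_left₀ (qc_ne_zero z)]
    rw [← hj, hR]
    simp only [Polynomial.eval_sub, Polynomial.eval_pow, Polynomial.eval_X, Polynomial.eval_C]
    ring
  have h3 : (fun z => R.eval (jS z)) =O[cusp] qc := by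
    refine ((isBigO_refl (fun z => (qc z ^ 2)⁻¹) cusp).mul h2).congr (fun z => ?_) fun z => ?_ <;>
    · have := qc_ne_zero z
      field_simp
  have hR0 := polynomial_eq_zero (h3.trans_tendsto tendsto_qc)
  have := congrArg (Polynomial.eval x) hR0
  rw [hR] at this
  simp only [Polynomial.eval_sub, Polynomial.eval_pow, Polynomial.eval_X, Polynomial.eval_C,
    Polynomial.eval_zero] at this
  linear_combination this

/-- The second logarithmic coefficient of a block of `HH n`. -/
noncomputable def blk (f a d : ℕ) : ℂ :=
  if f = 1 then
    24 * (uc a d + if a = 1 then d * cg d else 0) - 6 * d * (sr pexp 2 / 2) -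
        6 * ((if a = 1 then sr pexp (2 * d) / 2 else 0) + if a = 2 then sr pexp d else 0) -
          if a = d then 24 * (sr (fun _ => 1) 2 / 2) else 0
  else
    24 * (f * d) * (sr (vexp f) 2 / 2) - 6 * (f * d) * (sr pexp 2 / 2) -
        6 * if f * a = 2 then sr (fun d => pexp (star d f)) (f * d) else 0

lemma asy_HH {n : ℕ} (hn : 0 < n) : Asy (HH n)
    (∑ f ∈ D10, ∑ a ∈ (Nat.divisors n).filter (fun a => f * a ∣ n), blk f a (n / (f * a))) := by
  have h : ∀ f ∈ D10, Asy
      (fun z => ∏ a ∈ (Nat.divisors n).filter (fun a => f * a ∣ n), ∏ b ∈ Finset.range (n / a),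
        Fc (rep f a b (n / (f * a))) z)
      (∑ a ∈ (Nat.divisors n).filter (fun a => f * a ∣ n), blk f a (n / (f * a))) := by
    intro f hf
    refine Asy.prod fun a ha => ?_
    obtain ⟨ha1, d, hd⟩ := Finset.mem_filter.1 ha
    have hfa : 0 < f * a := Nat.pos_of_ne_zero (by rintro h; rw [h] at hd; omega)
    have ha0 : 0 < a := Nat.pos_of_mul_pos_left hfa
    have hd0 : 0 < d := Nat.pos_of_ne_zero (by rintro rfl; omega)
    have h1 : n / (f * a) = d := by rw [hd, Nat.mul_div_cancel_left _ hfa]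
    have h2 : n / a = f * d := by
      rw [hd, show f * a * d = a * (f * d) by ring, Nat.mul_div_cancel_left _ ha0]
    rw [h1, h2]
    by_cases hf1 : f = 1
    · subst hf1
      rw [blk, if_pos rfl]
      simpa only [one_mul] using asy_block_one ha0 hd0
    · rw [blk, if_neg hf1]
      exact asy_block (mem_D10.1 hf) hf1 ha0 hd0
  refine (Asy.prod h).congr (Filter.Eventually.of_forall fun z => ?_)
  rw [HH, idx, Finset.prod_sigma]
  refine Finset.prod_congr rfl fun f _ => ?_
  rw [Finset.prod_sigma]
  rfl

theorem sum_t2Star {P : Polynomial ℂ} {e : ℤ → ℂ}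
    (hP : HasQExp (fun z => P.eval (jnStar 10 z)) e (-2))
    (he2 : e (-2) = 1) (he1 : e (-1) = 0) (he0 : e 0 = 0) {n : ℕ} (hn : 0 < n) :
    12 * ∑ r ∈ ellRange n, t2Star 10 P (4 * n - r ^ 2) =
      -∑ f ∈ D10, ∑ a ∈ (Nat.divisors n).filter (fun a => f * a ∣ n), blk f a (n / (f * a)) := by
  have hA := asy_HH hn
  obtain ⟨N, hN⟩ := hA.exists_bound
  obtain ⟨Q, hQ⟩ := exists_polynomial N (fun z hz => differentiableAt_HH hn hz) (invS_HH hn) hN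
  have hQ0 : Q ≠ 0 := by
    rintro rfl
    obtain ⟨z, h1, h2⟩ := (hA.eventually_ne_zero.and (eventually_cusp 0)).exists
    exact h1 (by simp [hQ z h2])
  have hB : Asy (HH n) (Q.roots.map fun x => kap 1 - (kap 0 - x) ^ 2 / 2).sum := by
    have h := (Asy.const (Polynomial.leadingCoeff_ne_zero.2 hQ0)).mul
      (Asy.multiset_prod (s := Q.roots) asy_jS_sub)
    rw [zero_add] at h
    refine h.congr ?_
    filter_upwards [eventually_cusp 0] with z hz
    rw [hQ z hz]
    exact (IsAlgClosed.splits Q).eval_eq_prod_roots _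
  have h := sum_traces hn hQ0 hQ P
  have hroots : (Q.roots.map P.eval).sum =
      -2 * (Q.roots.map fun x => kap 1 - (kap 0 - x) ^ 2 / 2).sum := by
    rw [← Multiset.sum_map_mul_left]
    congr 1
    refine Multiset.map_congr rfl fun x _ => ?_
    rw [eval_eq hP he2 he1 he0]
    ring
  rw [hroots, ← hA.unique hB] at h
  linear_combination h / 2

end LevelTen

namespace LevelTen

/-! ### Divisor sums -/

/-- `σ₁(n / k)`, zero unless `k ∣ n`. -/
noncomputable def sd (k n : ℕ) : ℂ := if k ∣ n then sg (n / k) else 0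

lemma sd_one (n : ℕ) : sd 1 n = sg n := by simp [sd]

lemma sd_mul_left {k m : ℕ} (hm : 0 < m) (l : ℕ) : sd (m * k) (m * l) = sd k l := by
  simp only [sd, Nat.mul_dvd_mul_iff_left hm, Nat.mul_div_mul_left _ _ hm]

lemma sg_two_mul {m : ℕ} (hm : 0 < m) : sg (2 * m) = 3 * sg m - 2 * sd 2 m := by
  have key : ∀ l : ℕ, 0 < l → ∑ d ∈ (Nat.divisors l).filter (fun d => 2 ∣ d), (d : ℂ) = 2 * sd 2 l := by
    intro l hl
    rw [sd]
    split_ifs with h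
    · obtain ⟨k, rfl⟩ := h
      rw [Nat.mul_div_cancel_left _ two_pos, sg, Finset.mul_sum]
      symm
      refine Finset.sum_bij (fun d _ => 2 * d) ?_ ?_ ?_ ?_
      · intro d hd
        simp only [Finset.mem_filter, Nat.mem_divisors] at hd ⊢
        exact ⟨⟨Nat.mul_dvd_mul_left 2 hd.1, hl.ne'⟩, dvd_mul_right ..⟩
      · intro a _ b _ h; lia
      · intro d hd
        simp only [Finset.mem_filter, Nat.mem_divisors] at hd
        obtain ⟨⟨h1, -⟩, c, rfl⟩ := hd
        exact ⟨c, Nat.mem_divisors.2 ⟨Nat.dvd_of_mul_dvd_mul_left two_pos h1, by lia⟩, rfl⟩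
      · intro d _; push_cast; ring
    · rw [mul_zero]
      refine Finset.sum_eq_zero fun d hd => ?_
      simp only [Finset.mem_filter, Nat.mem_divisors] at hd
      exact absurd (hd.2.trans hd.1.1) h
  have hodd : (Nat.divisors (2 * m)).filter (fun d => ¬2 ∣ d) =
      (Nat.divisors m).filter (fun d => ¬2 ∣ d) := by
    ext d
    simp only [Finset.mem_filter, Nat.mem_divisors]
    refine ⟨fun ⟨⟨h1, h2⟩, h3⟩ => ⟨⟨?_, by lia⟩, h3⟩, fun ⟨⟨h1, h2⟩, h3⟩ =>
      ⟨⟨h1.mul_left 2, by lia⟩, h3⟩⟩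
    exact ((Nat.prime_two.coprime_iff_not_dvd.2 h3).symm).dvd_of_dvd_mul_left h1
  have h1 := Finset.sum_filter_add_sum_filter_not (Nat.divisors (2 * m)) (fun d => 2 ∣ d)
    (fun d => (d : ℂ))
  have h2 := Finset.sum_filter_add_sum_filter_not (Nat.divisors m) (fun d => 2 ∣ d)
    (fun d => (d : ℂ))
  rw [hodd, key _ (by lia)] at h1
  rw [key _ hm] at h2
  change _ = sg m at h2
  have h3 : sd 2 (2 * m) = sg m := by simpa [sd_one] using sd_mul_left (k := 1) two_pos m
  rw [h3] at h1
  rw [sg, ← h1]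
  linear_combination h2

/-- `σ₁(2n/k) = 3σ₁(n/k) - 2σ₁(n/(2k))` for odd `k`. -/
lemma sd_two_mul {k n : ℕ} (hk : Nat.Coprime k 2) (hn : 0 < n) :
    sd k (2 * n) = 3 * sd k n - 2 * sd (2 * k) n := by
  by_cases h : k ∣ n
  · obtain ⟨m, rfl⟩ := h
    have hk0 : 0 < k := Nat.pos_of_mul_pos_right hn
    have hm0 : 0 < m := Nat.pos_of_mul_pos_left hn
    rw [show 2 * (k * m) = k * (2 * m) by ring, mul_comm 2 k, sd_mul_left hk0]
    have := sd_mul_left (k := 1) hk0 (2 * m)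
    rw [mul_one] at this
    rw [this]
    have := sd_mul_left (k := 1) hk0 m
    rw [mul_one] at this
    rw [this, sd_one, sd_one, sg_two_mul hm0]
  · have h1 : ¬k ∣ 2 * n := fun h' => h (hk.dvd_of_dvd_mul_left h')
    have h2 : ¬2 * k ∣ n := fun h' => h ((Dvd.intro_left _ rfl).trans h')
    simp [sd, h, h1, h2]

lemma sr_eq (r : ℕ → ℤ) (n : ℕ) :
    sr r n = -(r 1 * sd 1 n + 2 * r 2 * sd 2 n + 5 * r 5 * sd 5 n + 10 * r 10 * sd 10 n) := by
  have h : ∀ k : ℕ, (if k ∣ n then (k : ℂ) * sg (n / k) else 0) = k * sd k n := fun k => by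
    rw [sd]; split_ifs <;> simp
  rw [sr, D10_eq]
  simp only [h]
  simp
  ring

lemma sd_two_right : sd 1 2 = 3 ∧ sd 2 2 = 1 ∧ sd 5 2 = 0 ∧ sd 10 2 = 0 := by
  have h2 : Nat.divisors 2 = {1, 2} := by decide
  refine ⟨?_, ?_, ?_, ?_⟩ <;> simp [sd, sg, h2]
  norm_num

/-- Summation over the divisors `a` of `n / f`. -/
lemma sum_filter_divisors {f n : ℕ} (hf : 0 < f) (hn : 0 < n) (g : ℕ → ℕ → ℂ) :
    ∑ a ∈ (Nat.divisors n).filter (fun a => f * a ∣ n), g a (n / (f * a)) =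
      if f ∣ n then ∑ a ∈ Nat.divisors (n / f), g a (n / f / a) else 0 := by
  split_ifs with h
  · obtain ⟨m, rfl⟩ := h
    rw [Nat.mul_div_cancel_left _ hf]
    refine Finset.sum_congr ?_ fun a _ => by rw [Nat.mul_div_mul_left _ _ hf]
    ext a
    simp only [Finset.mem_filter, Nat.mem_divisors, Nat.mul_dvd_mul_iff_left hf]
    exact ⟨fun h => ⟨h.2, by rintro rfl; simp at hn⟩, fun h => ⟨⟨h.1.mul_left f, hn.ne'⟩, h.1⟩⟩
  · refine Finset.sum_eq_zero fun a ha => ?_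
    exact absurd ((Dvd.intro _ rfl).trans (Finset.mem_filter.1 ha).2) h

lemma sum_div_divisors (n : ℕ) : ∑ a ∈ Nat.divisors n, ((n / a : ℕ) : ℂ) = sg n :=
  Nat.sum_div_divisors n fun d => (d : ℂ)

lemma sum_blk_one {n : ℕ} (hn : 0 < n) :
    ∑ a ∈ Nat.divisors n, blk 1 a (n / a) =
      24 * ∑ a ∈ Nat.divisors n, uc a (n / a) - 24 * n * cj n + 24 * sd 1 n
        + 24 * sd 1 n - 240 * sd 10 n
        + (48 * sd 4 n + 240 * sd 10 n - 720 * sd 20 n)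
        + 60 * ∑ a ∈ Nat.divisors n, if a = n / a then 1 else 0 := by
  obtain ⟨e1, e2, e5, e10⟩ := sd_two_right
  have hsp : sr pexp 2 = -8 := by rw [sr_eq, e1, e2, e5, e10]; norm_num [pexp, r4]
  have hs1 : sr (fun _ => 1) 2 = -5 := by rw [sr_eq, e1, e2, e5, e10]; norm_num
  have h1 : ∀ g : ℕ → ℂ, ∑ a ∈ Nat.divisors n, (if a = 1 then g (n / a) else 0) = g n := by
    intro g
    rw [Finset.sum_eq_single_of_mem 1 (Nat.one_mem_divisors.2 hn.ne') (by simp +contextual)]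
    simp
  have h2 : ∀ g : ℕ → ℂ, ∑ a ∈ Nat.divisors n, (if a = 2 then g (n / a) else 0) =
      if 2 ∣ n then g (n / 2) else 0 := by
    intro g
    split_ifs with h
    · rw [Finset.sum_eq_single_of_mem 2 (Nat.mem_divisors.2 ⟨h, hn.ne'⟩) (by simp +contextual)]
      simp
    · refine Finset.sum_eq_zero fun a ha => if_neg ?_
      rintro rfl
      exact h (Nat.dvd_of_mem_divisors ha)
  have hp2 : (if 2 ∣ n then sr pexp (n / 2) else 0) = -(8 * sd 4 n + 40 * sd 10 n - 120 * sd 20 n) := by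
    split_ifs with h
    · obtain ⟨m, rfl⟩ := h
      rw [Nat.mul_div_cancel_left _ two_pos, sr_eq, ← sd_mul_left two_pos, ← sd_mul_left two_pos (k := 2),
        ← sd_mul_left two_pos (k := 5), ← sd_mul_left two_pos (k := 10)]
      norm_num [pexp, r4]
      ring
    · have h4 : ¬4 ∣ n := by lia
      have h10 : ¬10 ∣ n := by lia
      have h20 : ¬20 ∣ n := by lia
      simp [sd, h4, h10, h20]
  have hp1 : sr pexp (2 * n) = -8 * sd 1 n + 80 * sd 10 n := by
    have ha : sd 2 (2 * n) = sd 1 n := sd_mul_left (k := 1) two_pos n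
    have hb : sd 10 (2 * n) = sd 5 n := sd_mul_left (k := 5) two_pos n
    rw [sr_eq, ha, hb, sd_two_mul (k := 5) (by norm_num) hn]
    norm_num [pexp, r4]
    ring
  have hcg : cg n = -cj n := by rw [cg, if_neg hn.ne']
  have hblk : ∀ a d : ℕ, blk 1 a d = 24 * uc a d + (if a = 1 then 24 * (d * cg d) - 3 * sr pexp (2 * d) else 0)
      + 24 * (d : ℂ) - (if a = 2 then 6 * sr pexp d else 0) + 60 * if a = d then 1 else 0 := by
    intro a d
    rw [blk, if_pos rfl, hsp, hs1]
    split_ifs <;> ring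
  simp only [hblk, Finset.sum_add_distrib, Finset.sum_sub_distrib, ← Finset.mul_sum]
  rw [h1 (fun d => 24 * (d * cg d) - 3 * sr pexp (2 * d)), h2 (fun d => 6 * sr pexp d),
    sum_div_divisors, ← sd_one, hcg, hp1]
  have : (if 2 ∣ n then 6 * sr pexp (n / 2) else 0) = 6 * if 2 ∣ n then sr pexp (n / 2) else 0 := by
    split_ifs <;> simp
  rw [this, hp2]
  ring

lemma sum_blk {n : ℕ} (hn : 0 < n) :
    ∑ f ∈ D10, ∑ a ∈ (Nat.divisors n).filter (fun a => f * a ∣ n), blk f a (n / (f * a)) =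
      24 * ∑ a ∈ Nat.divisors n, uc a (n / a) - 24 * n * cj n +
        (60 * ∑ a ∈ Nat.divisors n, if a = n / a then 1 else 0) +
        48 * sd 1 n + 144 * sd 2 n - 1200 * sd 10 n := by
  obtain ⟨e1, e2, e5, e10⟩ := sd_two_right
  have hsp : sr pexp 2 = -8 := by rw [sr_eq, e1, e2, e5, e10]; norm_num [pexp, r4]
  have hv2 : sr (vexp 2) 2 = 1 := by rw [sr_eq, e1, e2, e5, e10]; norm_num [vexp, r4]
  have hv5 : sr (vexp 5) 2 = -2 := by rw [sr_eq, e1, e2, e5, e10]; norm_num [vexp, r4]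
  have hv10 : sr (vexp 10) 2 = -7 := by rw [sr_eq, e1, e2, e5, e10]; norm_num [vexp, r4]
  rw [Finset.sum_congr rfl fun f hf =>
    sum_filter_divisors (Nat.pos_of_ne_zero (ne_zero_of_mem_D10 hf)) hn (blk f), D10_eq]
  have b2 : (if 2 ∣ n then ∑ a ∈ Nat.divisors (n / 2), blk 2 a (n / 2 / a) else 0) =
      72 * sd 2 n + 6 * (12 * sd 2 n - 8 * sd 4 n - 100 * sd 10 n + 120 * sd 20 n) := by
    split_ifs with h
    · obtain ⟨m, rfl⟩ := h
      have hm : 0 < m := by lia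
      rw [Nat.mul_div_cancel_left _ two_pos]
      have hb : ∀ a d : ℕ, blk 2 a d = 72 * (d : ℂ) -
          if a = 1 then 6 * sr (fun d => pexp (star d 2)) (2 * d) else 0 := by
        intro a d
        rw [blk, if_neg (by norm_num), hsp, hv2]
        have : 2 * a = 2 ↔ a = 1 := by lia
        simp only [this]
        split_ifs <;> push_cast <;> ring
      simp only [hb, Finset.sum_sub_distrib, ← Finset.mul_sum, sum_div_divisors]
      rw [Finset.sum_eq_single_of_mem 1 (Nat.one_mem_divisors.2 hm.ne') (by simp +contextual),
        if_pos rfl, Nat.div_one, sr_eq]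
      have c1 : sd 2 (2 * m) = sd 1 m := sd_mul_left (k := 1) two_pos m
      have c4 : sd 4 (2 * m) = sd 2 m := sd_mul_left (k := 2) two_pos m
      have c10 : sd 10 (2 * m) = sd 5 m := sd_mul_left (k := 5) two_pos m
      have c20 : sd 20 (2 * m) = sd 10 m := sd_mul_left (k := 10) two_pos m
      rw [c1, c4, c10, c20, sd_two_mul (k := 1) (by norm_num) hm,
        sd_two_mul (k := 5) (by norm_num) hm, ← sd_one]
      norm_num [pexp, r4, star]
      ring
    · have h4 : ¬4 ∣ n := by lia
      have h10 : ¬10 ∣ n := by lia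
      have h20 : ¬20 ∣ n := by lia
      simp [sd, h, h4, h10, h20]
  have b5 : (if 5 ∣ n then ∑ a ∈ Nat.divisors (n / 5), blk 5 a (n / 5 / a) else 0) = 0 := by
    split_ifs
    · refine Finset.sum_eq_zero fun a _ => ?_
      rw [blk, if_neg (by norm_num), hsp, hv5, if_neg (by lia)]
      push_cast
      ring
    · rfl
  have b10 : (if 10 ∣ n then ∑ a ∈ Nat.divisors (n / 10), blk 10 a (n / 10 / a) else 0) =
      -600 * sd 10 n := by
    rw [sd]
    split_ifs
    · rw [← sum_div_divisors, Finset.mul_sum]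
      refine Finset.sum_congr rfl fun a _ => ?_
      rw [blk, if_neg (by norm_num), hsp, hv10, if_neg (by lia)]
      push_cast
      ring
    · simp
  rw [Finset.sum_insert (by decide), Finset.sum_insert (by decide), Finset.sum_insert (by decide),
    Finset.sum_singleton, b2, b5, b10]
  simp only [one_dvd, if_true, Nat.div_one]
  rw [sum_blk_one hn]
  ring

end LevelTen

namespace LevelTen

/-! ### The coefficients of the generating function -/

/-- The conventional values of `t2Star` at nonpositive indices. -/
noncomputable def cv (d : ℤ) : ℂ :=
  if d = 0 then 5 / 2 else if d = -1 then -1 else if d = -4 then -2 else 0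

lemma t2Star_eq (P : Polynomial ℂ) (d : ℤ) :
    t2Star 10 P d = (if 0 < d then t2Star 10 P d else 0) + cv d := by
  by_cases h : 0 < d
  · rw [if_pos h, cv, if_neg (by lia), if_neg (by lia), if_neg (by lia), add_zero]
  · simp [t2Star, cv, h]

lemma cv_eq_zero {d : ℤ} (h : d < -4) : cv d = 0 := by
  rw [cv, if_neg (by lia), if_neg (by lia), if_neg (by lia)]

lemma finsum_t2Star (P : Polynomial ℂ) {m : ℤ} {N : ℕ} (hN : 4 * m + 4 < (N + 1) ^ 2) :
    ∑ᶠ r : ℤ, t2Star 10 P (4 * m - r ^ 2) =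
      ∑ r ∈ Finset.Icc (-N : ℤ) N, t2Star 10 P (4 * m - r ^ 2) := by
  refine finsum_eq_sum_of_support_subset _ fun r hr => ?_
  by_contra h
  have h1 : ((N : ℤ) + 1) ^ 2 ≤ r ^ 2 := by
    rw [Finset.coe_Icc, Set.mem_Icc, not_and_or] at h
    rcases h with h | h <;> nlinarith
  refine hr ?_
  change t2Star 10 P (4 * m - r ^ 2) = 0
  rw [t2Star_eq, if_neg (by lia), cv_eq_zero (by lia), add_zero]

lemma filter_divisors_add {x y : ℕ} (hx : 0 < x) (hy : 0 < y) :
    (Nat.divisors (x * y)).filter (fun a => a + x * y / a = x + y) = {x, y} := by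
  ext a
  simp only [Finset.mem_filter, Nat.mem_divisors, Finset.mem_insert, Finset.mem_singleton]
  constructor
  · rintro ⟨⟨⟨d, hd⟩, h0⟩, h1⟩
    have ha : 0 < a := Nat.pos_of_ne_zero (by rintro rfl; simp at hd; lia)
    rw [hd, Nat.mul_div_cancel_left _ ha] at h1
    have h2 : ((a : ℤ) - x) * (a - y) = 0 := by
      have h3 : (a : ℤ) + d = x + y := by exact_mod_cast h1
      have h4 : (x : ℤ) * y = a * d := by exact_mod_cast hd
      linear_combination h4 + (a : ℤ) * h3
    rcases mul_eq_zero.1 h2 with h | h <;> lia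
  · have h0 : x * y ≠ 0 := (Nat.mul_pos hx hy).ne'
    rintro (rfl | rfl)
    · exact ⟨⟨Dvd.intro _ rfl, h0⟩, by rw [Nat.mul_div_cancel_left _ hx]⟩
    · exact ⟨⟨Dvd.intro_left _ rfl, h0⟩, by rw [Nat.mul_div_cancel _ hy, add_comm]⟩

lemma sum_fiber {n : ℕ} (hn : 0 < n) (r : ℕ) :
    ∑ a ∈ (Nat.divisors n).filter (fun a => a + n / a = r),
      (uc a (n / a) + if a = n / a then 5 / 2 else 0) = cv (4 * n - (r : ℤ) ^ 2) := by
  by_cases hex : ∃ x s : ℕ, n = x * (x + s) ∧ r = x + (x + s) ∧ s ≤ 2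
  · obtain ⟨x, s, rfl, rfl, hs⟩ := hex
    have hx : 0 < x := Nat.pos_of_mul_pos_right hn
    have hy : 0 < x + s := by lia
    have hd : 4 * ((x * (x + s) : ℕ) : ℤ) - ((x + (x + s) : ℕ) : ℤ) ^ 2 = -(s : ℤ) ^ 2 := by
      push_cast; ring
    rw [filter_divisors_add hx hy, hd]
    interval_cases s
    · simp [uc, cv, Nat.mul_div_cancel_left _ hx]
    · rw [Finset.sum_pair (by lia), Nat.mul_div_cancel_left _ hx, Nat.mul_div_cancel _ hy]
      norm_num [uc, cv]
    · rw [Finset.sum_pair (by lia), Nat.mul_div_cancel_left _ hx, Nat.mul_div_cancel _ hy]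
      have h : x + 2 + 1 ≠ x := by lia
      norm_num [uc, cv, h]
  · have hr : ∀ s : ℤ, (r : ℤ) ^ 2 = 4 * n + s ^ 2 → 0 ≤ s → ¬s ≤ 2 := by
      intro s h h0 h2
      obtain ⟨t, rfl⟩ := Int.eq_ofNat_of_zero_le h0
      have hst : t < r := by zify; nlinarith
      obtain ⟨x, hx⟩ : ∃ x, r = x + (x + t) := by
        have hpar : (r : ℤ) % 2 = t % 2 := by
          have : ((r : ℤ) ^ 2) % 2 = ((t : ℤ) ^ 2) % 2 := by lia
          rcases Int.emod_two_eq r with h3 | h3 <;> rcases Int.emod_two_eq t with h4 | h4 <;>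
            simp [pow_two, Int.mul_emod, h3, h4] at this ⊢
        exact ⟨(r - t) / 2, by lia⟩
      refine hex ⟨x, t, ?_, hx, by lia⟩
      zify
      rw [hx] at h
      push_cast at h
      nlinarith
    rw [cv, if_neg fun h => hr 0 (by lia) le_rfl (by norm_num),
      if_neg fun h => hr 1 (by lia) (by norm_num) (by norm_num),
      if_neg fun h => hr 2 (by lia) (by norm_num) le_rfl]
    refine Finset.sum_eq_zero fun a ha => ?_
    obtain ⟨h1, h2⟩ := Finset.mem_filter.1 ha
    obtain ⟨⟨d, rfl⟩, -⟩ := Nat.mem_divisors.1 h1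
    have ha0 : 0 < a := Nat.pos_of_mul_pos_right hn
    rw [Nat.mul_div_cancel_left _ ha0] at h2 ⊢
    have hgen : ∀ s : ℕ, s ≤ 2 → a + s ≠ d ∧ d + s ≠ a := by
      refine fun s hs => ⟨?_, ?_⟩
      · rintro rfl
        exact hex ⟨a, s, rfl, h2.symm, hs⟩
      · rintro rfl
        exact hex ⟨d, s, mul_comm .., by rw [← h2, add_comm], hs⟩
    have h0 := hgen 0 (by norm_num)
    have h1 := hgen 1 (by norm_num)
    have h2 := hgen 2 (by norm_num)
    rw [add_zero] at h0
    simp [uc, h0.1, h1.1, h1.2, h2.1, h2.2]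

lemma sum_cv {n : ℕ} (hn : 0 < n) :
    ∑ r ∈ Finset.Icc (-(2 * n + 2 : ℕ) : ℤ) (2 * n + 2 : ℕ), cv (4 * n - r ^ 2) =
      2 * ∑ a ∈ Nat.divisors n, (uc a (n / a) + if a = n / a then 5 / 2 else 0) := by
  have h0 : cv (4 * n - (0 : ℤ) ^ 2) = 0 := by
    rw [cv, if_neg (by lia), if_neg (by lia), if_neg (by lia)]
  rw [Finset.sum_Icc_of_even_eq_range (fun r => by simp), h0, sub_zero, two_smul, ← two_mul]
  congr 1
  rw [← Finset.sum_fiberwise_of_maps_to (s := Nat.divisors n) (g := fun a => a + n / a)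
    (t := Finset.range (2 * n + 2 + 1))]
  · exact Finset.sum_congr rfl fun r _ => (sum_fiber hn r).symm
  · intro a ha
    have := Nat.divisor_le ha
    have := Nat.div_le_self n a
    simp only [Finset.mem_range]
    lia

/-- The coefficient of `q^n` in the generating function of the traces. -/
theorem coeff_eq {P : Polynomial ℂ} {e : ℤ → ℂ}
    (hP : HasQExp (fun z => P.eval (jnStar 10 z)) e (-2))
    (he2 : e (-2) = 1) (he1 : e (-1) = 0) (he0 : e 0 = 0) (n : ℕ) :
    ∑ᶠ r : ℤ, t2Star 10 P (4 * (n : ℤ) - r ^ 2) =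
      2 * (n * cj n) - (4 * sd 1 n + 12 * sd 2 n - 100 * sd 10 n + if n = 0 then 7 / 2 else 0) := by
  rcases Nat.eq_zero_or_pos n with rfl | hn
  · rw [finsum_t2Star P (N := 2) (by norm_num),
      show Finset.Icc (-(2 : ℕ) : ℤ) (2 : ℕ) = {-2, -1, 0, 1, 2} by decide]
    simp [t2Star, sd, sg_zero]
    norm_num
  · rw [finsum_t2Star P (N := 2 * n + 2) (by push_cast; nlinarith)]
    rw [Finset.sum_congr rfl fun r _ => t2Star_eq P (4 * n - r ^ 2), Finset.sum_add_distrib, sum_cv hn, ← Finset.sum_filter]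
    have hE : (Finset.Icc (-(2 * n + 2 : ℕ) : ℤ) (2 * n + 2 : ℕ)).filter
        (fun r => 0 < 4 * (n : ℤ) - r ^ 2) = ellRange n := by
      ext r
      rw [Finset.mem_filter, Finset.mem_Icc, mem_ellRange]
      refine ⟨fun h => by lia, fun h => ⟨⟨?_, ?_⟩, by lia⟩⟩ <;> push_cast <;> nlinarith
    have hS := sum_t2Star hP he2 he1 he0 hn
    rw [sum_blk hn] at hS
    have hT : ∑ a ∈ Nat.divisors n, (if a = n / a then 5 / 2 else 0 : ℂ) =
        5 / 2 * ∑ a ∈ Nat.divisors n, (if a = n / a then 1 else 0) := by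
      rw [Finset.mul_sum]
      exact Finset.sum_congr rfl fun a _ => by split_ifs <;> simp
    rw [hE, Finset.sum_add_distrib, hT, if_neg hn.ne']
    linear_combination hS / 12

lemma finsum_t2Star_neg_one (P : Polynomial ℂ) : ∑ᶠ r : ℤ, t2Star 10 P (4 * (-1) - r ^ 2) = -2 := by
  rw [finsum_t2Star P (N := 0) (by norm_num), show Finset.Icc (-(0 : ℕ) : ℤ) (0 : ℕ) = {0} by decide]
  simp [t2Star]

/-! ### Fourier expansions -/

lemma summable_sg {q : ℂ} (hq : ‖q‖ < 1) : Summable fun k : ℕ => sg k * q ^ k := by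
  refine Summable.of_norm_bounded (summable_norm_pow_mul_geometric_of_norm_lt_one 2 hq) fun n => ?_
  rw [norm_mul, norm_mul]
  gcongr
  simpa using norm_sg_le n

lemma hasSum_E2 {d : ℕ} (hd : 0 < d) {z : ℂ} (hz : 0 < z.im) :
    HasSum (fun k => sd d k * qc z ^ k) ((1 - E2 (d * z)) / 24) := by
  have hq : ‖qc z ^ d‖ < 1 := norm_pow_lt_one (norm_qc_lt_one hz) hd.ne'
  have h1 : HasSum (fun k => sg k * (qc z ^ d) ^ k) ((1 - E2 (d * z)) / 24) := by
    have h := (summable_sg hq).hasSum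
    rw [(summable_sg hq).tsum_eq_zero_add, sg_zero, zero_mul, zero_add] at h
    convert h using 1
    rw [E2, qc_nat_mul]
    simp only [sg]
    ring
  have hinj : Function.Injective fun k : ℕ => d * k := fun a b h => Nat.eq_of_mul_eq_mul_left hd h
  refine (hinj.hasSum_iff fun k hk => ?_).1 (h1.congr_fun fun k => ?_)
  · rw [sd, if_neg, zero_mul]
    rintro ⟨m, rfl⟩
    exact hk ⟨m, rfl⟩
  · simp [sd, Nat.mul_div_cancel_left _ hd, _root_.pow_mul]

lemma hasSum_deriv_cF {q : ℂ} (hq : ‖q‖ < 1) :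
    HasSum (fun k : ℕ => (k * cj k) * q ^ k) (q * deriv cF q) := by
  have h := (hasSum_tc (differentiableOn_cF.deriv Metric.isOpen_ball) hq).mul_left q
  refine (hasSum_nat_add_iff' 1).1 ?_
  simp only [Finset.range_one, Finset.sum_singleton, Nat.cast_zero, zero_mul, sub_zero]
  refine h.congr_fun fun k => ?_
  rw [cj, tc, tc, ← iteratedDeriv_succ', Nat.factorial_succ]
  have h1 : ((k : ℂ) + 1) ≠ 0 := by exact_mod_cast k.succ_ne_zero
  have h2 : (k.factorial : ℂ) ≠ 0 := by exact_mod_cast k.factorial_ne_zero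
  push_cast
  field_simp
  ring

end LevelTen

/-- **Level 10 identity of weight-2 forms.**
`2 j₁₀'(τ) - G₂^{(10*)}(τ) = (1/6) E₂^{(10)}(τ) + (1/2) E₂^{(5)}(2τ)` on the upper
half-plane; in particular `2 j₁₀' - G₂^{(10*)} ∈ M₂(Γ₀(10))`. -/
theorem weight_two_identity_ten
    (P : Polynomial ℂ) (e : ℤ → ℂ)
    (hP : HasQExp (fun z => Polynomial.eval (jnStar 10 z) P) e (-2))
    (he2 : e (-2) = 1) (he1 : e (-1) = 0) (he0 : e 0 = 0)
    (G : ℂ → ℂ)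
    (hG : ∀ τ : ℂ, 0 < τ.im →
      HasSum (fun n : ℕ =>
          (∑ᶠ r : ℤ, t2Star 10 P (4 * ((n : ℤ) - 1) - r ^ 2)) * qc τ ^ ((n : ℤ) - 1))
        (G τ))
    (τ : ℂ) (hτ : 0 < τ.im) :
    2 * ((2 * Real.pi * Complex.I)⁻¹ * deriv (jn 10) τ) - G τ =
      1 / 6 * E2N 10 τ + 1 / 2 * E2N 5 (2 * τ) := by
  have hL := (hasSum_nat_add_iff' 1).2 (hG τ hτ)
  have h1 := LevelTen.hasSum_E2 one_pos hτ
  have h2 := LevelTen.hasSum_E2 two_pos hτ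
  have h10 := LevelTen.hasSum_E2 (show 0 < 10 by norm_num) hτ
  have hc := LevelTen.hasSum_deriv_cF (LevelTen.norm_qc_lt_one hτ)
  have h0 : HasSum (fun k : ℕ => (if k = 0 then 7 / 2 else 0) * qc τ ^ k) (7 / 2) := by
    simpa using hasSum_single (f := fun k : ℕ => (if k = 0 then 7 / 2 else 0) * qc τ ^ k) 0
      fun k hk => by simp [hk]
  have hR := (hc.mul_left 2).sub
    ((((h1.mul_left 4).add (h2.mul_left 12)).sub (h10.mul_left 100)).add h0)
  have h := hL.unique (hR.congr_fun fun k => by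
    have : 4 * (((k + 1 : ℕ) : ℤ) - 1) = 4 * k := by push_cast; ring
    rw [this, LevelTen.coeff_eq hP he2 he1 he0,
      show (((k + 1 : ℕ) : ℤ) - 1) = k by push_cast; ring, zpow_natCast]
    ring)
  have hj : jn 10 = LevelTen.jj := funext LevelTen.jn_ten
  simp only [Finset.range_one, Finset.sum_singleton, Nat.cast_zero, zero_sub,
    LevelTen.finsum_t2Star_neg_one, _root_.zpow_neg_one] at h
  rw [hj, LevelTen.deriv_jj hτ, E2N, E2N]
  have hq := LevelTen.qc_ne_zero τ
  have hpi := Complex.two_pi_I_ne_zero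
  have hd : (2 * Real.pi * I)⁻¹ * (-(2 * Real.pi * I) * (qc τ)⁻¹ *
      (1 + -(qc τ ^ 2 * deriv LevelTen.cF (qc τ)))) =
      -(qc τ)⁻¹ + qc τ * deriv LevelTen.cF (qc τ) := by
    field_simp
    ring
  rw [hd]
  push_cast at h ⊢
  rw [show (5 : ℂ) * (2 * τ) = 10 * τ by ring]
  rw [one_mul] at h
  linear_combination -h
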